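/- The geometric realization of the total space of the principal twisted cartesian product GΓℤ(2) ×_η S² is weakly homotopy equivalent to the 3-sphere S³ (the unit sphere in ℝ⁴): it is simply connected, π₃ ≅ ℤ, and πₙ(|GΓℤ(2) ×_η S²|) ≅ πₙ(S³) for all n. -/

import Mathlib

open CategoryTheory Simplicial

namespace HopfModel

/-- A map of simplicial sets is a *Kan fibration* if it has the right lifting property
with respect to all horn inclusions `Λ[n, k] ⟶ Δ[n]` for `n ≥ 1`, `0 ≤ k ≤ n`. -/
def IsKanFibration {X Y : SSet} (p : X ⟶ Y) : Prop :=
  ∀ (n : ℕ) (i : Fin (n + 2)), HasLiftingProperty (SSet.horn (n + 1) i).ι p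

/-- The underlying simplicial set of a simplicial group. -/
def uSSet (H : SimplicialObject GrpCat) : SSet := H ⋙ forget GrpCat

/-- The `i`-th face map of a simplicial group, as a group homomorphism. -/
def δHom (H : SimplicialObject GrpCat) {n : ℕ} (i : Fin (n + 2)) :
    (H _⦋n + 1⦌ : Type) →* (H _⦋n⦌ : Type) := (H.δ i).hom

/-- The `i`-th degeneracy map of a simplicial group, as a group homomorphism. -/
def σHom (H : SimplicialObject GrpCat) {n : ℕ} (i : Fin (n + 1)) :
    (H _⦋n⦌ : Type) →* (H _⦋n + 1⦌ : Type) := (H.σ i).hom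

/-- A twisting function `ζ : B → H`, i.e. a family of maps `ζₙ : Bₙ → H_{n-1}` (`n ≥ 1`)
satisfying `∂₀ζ(b) = (ζ(∂₀b))⁻¹·ζ(∂₁b)`, `∂ᵢζ(b) = ζ(∂_{i+1}b)` for `i > 0`,
`sᵢζ(b) = ζ(s_{i+1}b)` for `i ≥ 0`, and `ζ(s₀b) = e`. -/
structure TwistingFunction (B : SSet) (H : SimplicialObject GrpCat) where
  map : ∀ n : ℕ, B _⦋n + 1⦌ → H _⦋n⦌
  map_δ₀ : ∀ (n : ℕ) (b : B _⦋n + 2⦌),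
    H.δ 0 (map (n + 1) b) = (map n (B.δ 0 b))⁻¹ * map n (B.δ 1 b)
  map_δ : ∀ (n : ℕ) (j : Fin (n + 1)) (b : B _⦋n + 2⦌),
    H.δ j.succ (map (n + 1) b) = map n (B.δ j.succ.succ b)
  map_σ : ∀ (n : ℕ) (i : Fin (n + 1)) (b : B _⦋n + 1⦌),
    H.σ i (map n b) = map (n + 1) (B.σ i.succ b)
  map_σ₀ : ∀ (n : ℕ) (b : B _⦋n⦌), map n (B.σ 0 b) = 1

/-- A left action of a simplicial group `H` on a simplicial set `F`:
a degreewise group action commuting with faces and degeneracies. -/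
structure SimplicialAction (H : SimplicialObject GrpCat) (F : SSet) where
  act : ∀ n : ℕ, H _⦋n⦌ → F _⦋n⦌ → F _⦋n⦌
  one_act : ∀ (n : ℕ) (f : F _⦋n⦌), act n 1 f = f
  mul_act : ∀ (n : ℕ) (g h : H _⦋n⦌) (f : F _⦋n⦌),
    act n (g * h) f = act n g (act n h f)
  δ_act : ∀ (n : ℕ) (i : Fin (n + 2)) (g : H _⦋n + 1⦌) (f : F _⦋n + 1⦌),
    F.δ i (act (n + 1) g f) = act n (H.δ i g) (F.δ i f)
  σ_act : ∀ (n : ℕ) (i : Fin (n + 1)) (g : H _⦋n⦌) (f : F _⦋n⦌),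
    F.σ i (act n g f) = act (n + 1) (H.σ i g) (F.σ i f)

/-- A simplicial group acting on (the underlying simplicial set of) itself
by left multiplication. -/
def leftMulAction (H : SimplicialObject GrpCat) : SimplicialAction H (uSSet H) where
  act n g h := g * (show (H _⦋n⦌ : Type) from h)
  one_act n f := one_mul (show (H _⦋n⦌ : Type) from f)
  mul_act n g h f := mul_assoc g h (show (H _⦋n⦌ : Type) from f)
  δ_act n i g f := map_mul (δHom H i) g (show (H _⦋n + 1⦌ : Type) from f)
  σ_act n i g f := map_mul (σHom H i) g (show (H _⦋n⦌ : Type) from f)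

/-- The data exhibiting a simplicial set `P`, together with a map `p : P ⟶ B`, as
the twisted cartesian product `F ×_ζ B` with its projection onto `B`:
`Pₙ ≅ Fₙ × Bₙ`, `∂₀(f,b) = (ζ(b)·∂₀f, ∂₀b)`, `∂ᵢ(f,b) = (∂ᵢf, ∂ᵢb)` for `i > 0`,
`sᵢ(f,b) = (sᵢf, sᵢb)`, and `p(f,b) = b`. -/
structure TCP (H : SimplicialObject GrpCat) (F B : SSet) (A : SimplicialAction H F)
    (ζ : TwistingFunction B H) (P : SSet) (p : P ⟶ B) where
  e : ∀ n : ℕ, P _⦋n⦌ ≃ F _⦋n⦌ × B _⦋n⦌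
  e_δ₀ : ∀ (n : ℕ) (x : P _⦋n + 1⦌),
    e n (P.δ 0 x) =
      (A.act n (ζ.map n (e (n + 1) x).2) (F.δ 0 (e (n + 1) x).1), B.δ 0 (e (n + 1) x).2)
  e_δ : ∀ (n : ℕ) (j : Fin (n + 1)) (x : P _⦋n + 1⦌),
    e n (P.δ j.succ x) = (F.δ j.succ (e (n + 1) x).1, B.δ j.succ (e (n + 1) x).2)
  e_σ : ∀ (n : ℕ) (i : Fin (n + 1)) (x : P _⦋n⦌),
    e (n + 1) (P.σ i x) = (F.σ i (e n x).1, B.σ i (e n x).2)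
  proj : ∀ (n : ℕ) (x : P _⦋n⦌),
    p.app (Opposite.op (SimplexCategory.mk n)) x = (e n x).2

end HopfModel

namespace HopfModel

/-- The chain complex `ℤ(2)` of abelian groups: one copy of `ℤ` in degree `2`
and `0` elsewhere. -/
noncomputable def Z2 : ChainComplex AddCommGrpCat ℕ :=
  (HomologicalComplex.single AddCommGrpCat (ComplexShape.down ℕ) 2).obj (AddCommGrpCat.of ℤ)

/-- The simplicial abelian group `Γℤ(2)` corresponding to the chain complex `ℤ(2)`
under the Dold–Kan correspondence. -/
noncomputable def GammaZ2 : SimplicialObject AddCommGrpCat :=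
  AlgebraicTopology.DoldKan.Γ₀.obj Z2

/-- The underlying simplicial set of `Γℤ(2)`. -/
noncomputable def GammaZ2SSet : SSet := GammaZ2 ⋙ forget AddCommGrpCat

/-- The relations `s₀x = e` (`x ∈ Kₙ`) defining the loop group `G(K)ₙ`. -/
def loopRels (K : SSet) (n : ℕ) : Set (FreeGroup (K _⦋n + 1⦌)) :=
  Set.range fun x : K _⦋n⦌ => FreeGroup.of (K.σ 0 x)

end HopfModel

namespace HopfModel

/-- `S2` is the minimal simplicial model of the 2-sphere, with nondegenerate
`2`-simplex `y`: there is exactly one `0`-simplex and one `1`-simplex, every `2`-simplex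
other than `y` is degenerate, `y` itself is nondegenerate, and every simplex in
dimension `≥ 3` is degenerate. -/
structure IsMinimalS2 (S2 : SSet) (y : S2 _⦋2⦌) : Prop where
  nonempty₀ : Nonempty (S2 _⦋0⦌)
  subsingleton₀ : Subsingleton (S2 _⦋0⦌)
  subsingleton₁ : Subsingleton (S2 _⦋1⦌)
  two_simplices : ∀ z : S2 _⦋2⦌, z = y ∨ ∃ w : S2 _⦋1⦌, z = S2.σ 0 w
  nondegen₀ : ∀ w : S2 _⦋1⦌, y ≠ S2.σ 0 w
  nondegen₁ : ∀ w : S2 _⦋1⦌, y ≠ S2.σ 1 w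
  degen_above : ∀ (n : ℕ) (z : S2 _⦋n + 3⦌),
    ∃ (i : Fin (n + 3)) (w : S2 _⦋n + 2⦌), z = S2.σ i w

end HopfModel

namespace HopfModel

abbrev TS (n : ℕ) := _root_.stdSimplex ℝ (Fin (n + 1))

noncomputable def evS {n : ℕ} {X : TopCat.{0}} (g : Δ[n] ⟶ TopCat.toSSet.obj X) : C(TS n, X) :=
  X.toSSetObjEquiv _ (SSet.yonedaEquiv g)

noncomputable def mkS {n : ℕ} {X : TopCat.{0}} (g : C(TS n, X)) : Δ[n] ⟶ TopCat.toSSet.obj X :=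
  SSet.yonedaEquiv.symm ((X.toSSetObjEquiv _).symm g)

lemma evS_mkS {n : ℕ} {X : TopCat.{0}} (g : C(TS n, X)) : evS (mkS g) = g := by
  simp [evS, mkS]

lemma mkS_evS {n : ℕ} {X : TopCat.{0}} (g : Δ[n] ⟶ TopCat.toSSet.obj X) : mkS (evS g) = g := by
  simp [evS, mkS]

lemma evS_inj {n : ℕ} {X : TopCat.{0}} {g h : Δ[n] ⟶ TopCat.toSSet.obj X} (e : evS g = evS h) :
    g = h := by
  rw [<- mkS_evS g, e, mkS_evS]

lemma evS_map {n m : ℕ} {X : TopCat.{0}} (θ : ⦋n⦌ ⟶ ⦋m⦌) (g : Δ[m] ⟶ TopCat.toSSet.obj X) (u : TS n) :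
    evS (SSet.stdSimplex.map θ ≫ g) u = evS g (stdSimplex.map θ u) := by
  obtain ⟨g, rfl⟩ := SSet.yonedaEquiv.symm.surjective g
  have : SSet.stdSimplex.map θ ≫ SSet.yonedaEquiv.symm g =
    SSet.yonedaEquiv.symm ((TopCat.toSSet.obj X).map θ.op g) := by
    apply SSet.yonedaEquiv.injective
    simp [SSet.yonedaEquiv_comp]
    rfl
  rw [this]
  simp only [evS, Equiv.apply_symm_apply]
  rfl

lemma evS_δ {n : ℕ} {X : TopCat.{0}} (j : Fin (n + 2)) (g : Δ[n + 1] ⟶ TopCat.toSSet.obj X) (u : TS n) :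
    evS (SSet.stdSimplex.δ j ≫ g) u = evS g (stdSimplex.map j.succAbove u) :=
  evS_map (SimplexCategory.δ j) g u

lemma evS_comp {n : ℕ} {X Y : TopCat.{0}} (g : Δ[n] ⟶ TopCat.toSSet.obj X) (p : X ⟶ Y) (u : TS n) :
    evS (g ≫ TopCat.toSSet.map p) u = p (evS g u) := by
  obtain ⟨g, rfl⟩ := SSet.yonedaEquiv.symm.surjective g
  simp only [evS, SSet.yonedaEquiv_comp, Equiv.apply_symm_apply]
  rfl

lemma TS_map_apply {n : ℕ} (j : Fin (n + 2)) (u : TS n) (i : Fin (n + 1)) :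
    (stdSimplex.map j.succAbove u) (j.succAbove i) = u i := by
  simp only [stdSimplex.map_coe, FunOnFinite.linearMap_apply_apply]
  rw [Finset.sum_eq_single i] <;> simp

lemma TS_map_self {n : ℕ} (j : Fin (n + 2)) (u : TS n) :
    (stdSimplex.map j.succAbove u) j = 0 := by
  simp only [stdSimplex.map_coe, FunOnFinite.linearMap_apply_apply]
  apply Finset.sum_eq_zero
  intro i hi
  simp [Fin.succAbove_ne] at hi

lemma TS_drop {n : ℕ} (j : Fin (n + 2)) (t : TS (n + 1)) (h : t j = 0) :
    ∃ u : TS n, stdSimplex.map j.succAbove u = t := by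
  have h1 := stdSimplex.sum_eq_one t
  rw [Fin.sum_univ_succAbove _ j, h, zero_add] at h1
  refine ⟨⟨fun i => t (j.succAbove i), fun i => t.2.1 _, h1⟩, ?_⟩
  ext i
  rcases Fin.eq_self_or_eq_succAbove j i with rfl | ⟨i, rfl⟩
  · rw [TS_map_self, h]
  · rw [TS_map_apply]
    rfl

lemma TS_map_inj {n : ℕ} (j : Fin (n + 2)) {u v : TS n}
    (h : stdSimplex.map j.succAbove u = stdSimplex.map j.succAbove v) : u = v := by
  ext i
  rw [<- TS_map_apply j u i, h, TS_map_apply]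

lemma glue {X : Type} [TopologicalSpace X] {n : ℕ} (S : Set (Fin (n + 2))) (f : S → C(TS n, X))
    (hf : ∀ (j k : S) u v, stdSimplex.map j.1.succAbove u = stdSimplex.map k.1.succAbove v →
      f j u = f k v) :
    ∃ L : C({t : TS (n + 1) // ∃ j ∈ S, t j = 0}, X), ∀ (j : S) u,
      L ⟨stdSimplex.map j.1.succAbove u, j.1, j.2, TS_map_self _ _⟩ = f j u := by
  have hπ0 : ∀ p : (Σ _ : S, TS n), ∃ j ∈ S, (stdSimplex.map p.1.1.succAbove p.2) j = 0 :=
    fun p => ⟨p.1.1, p.1.2, TS_map_self _ _⟩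
  have hπ : Continuous fun p : (Σ _ : S, TS n) => stdSimplex.map p.1.1.succAbove p.2 := by
    rw [continuous_sigma_iff]
    exact fun j => stdSimplex.continuous_map (S := ℝ) j.1.succAbove
  let π : C((Σ _ : S, TS n), {t : TS (n + 1) // ∃ j ∈ S, t j = 0}) :=
    ⟨fun p => ⟨stdSimplex.map p.1.1.succAbove p.2, hπ0 p⟩, by
      rw [continuous_induced_rng]; exact hπ⟩
  have hq : Topology.IsQuotientMap π := by
    have : CompactSpace (Σ _ : S, TS n) := inferInstance
    have : IsClosedMap π := π.continuous.isClosedMap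
    refine this.isQuotientMap π.continuous ?_
    rintro ⟨t, j, hj, h⟩
    obtain ⟨u, hu⟩ := TS_drop j t h
    exact ⟨⟨⟨j, hj⟩, u⟩, Subtype.ext hu⟩
  let F : C((Σ _ : S, TS n), X) := ⟨fun p => f p.1 p.2, continuous_sigma fun j => (f j).continuous⟩
  have hF : Function.FactorsThrough F π := fun a b h => hf _ _ _ _ (congrArg Subtype.val h)
  refine ⟨hq.lift F hF, fun j u => ?_⟩
  have h := DFunLike.congr_fun (hq.lift_comp F hF) ⟨j, u⟩
  rw [ContinuousMap.comp_apply] at h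
  exact h

lemma compat_aux {X : TopCat.{0}} {n : ℕ} {A : (Δ[n + 1] : SSet.{0}).Subcomplex}
    (φ : (A : SSet) ⟶ TopCat.toSSet.obj X)
    {j k : Fin (n + 2)} (a b : Δ[n] ⟶ (A : SSet)) (ha : a ≫ A.ι = SSet.stdSimplex.δ j)
    (hb : b ≫ A.ι = SSet.stdSimplex.δ k) (hjk : j < k) (u v : TS n)
    (h : stdSimplex.map j.succAbove u = stdSimplex.map k.succAbove v) :
    evS (a ≫ φ) u = evS (b ≫ φ) v := by
  obtain _ | n := n
  · exfalso
    obtain ⟨rfl, rfl⟩ : j = 0 ∧ k = 1 := by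
      revert j k
      simp only [Nat.reduceAdd]
      intros
      constructor <;> grind
    have h2 := TS_map_apply 1 v 0
    rw [<- h] at h2
    have h3 := TS_map_self 0 u
    have h4 := stdSimplex.sum_eq_one v
    rw [Fin.sum_univ_one] at h4
    rw [<- h2] at h4
    exact zero_ne_one (h3.symm.trans h4)
  obtain ⟨j, rfl⟩ := j.eq_castSucc_of_ne_last (Fin.ne_last_of_lt hjk)
  obtain ⟨k, rfl⟩ := k.eq_succ_of_ne_zero (Fin.ne_zero_of_lt hjk)
  have hjk' : j ≤ k := Fin.castSucc_lt_succ_iff.1 hjk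
  have e1 : j.castSucc.succAbove k = k.succ := Fin.succAbove_of_le_castSucc _ _ (by simpa using hjk')
  have hu : u k = 0 := by
    rw [<- TS_map_apply j.castSucc u k, e1, h, TS_map_self]
  obtain ⟨w, rfl⟩ := TS_drop k u hu
  have e2 : SSet.stdSimplex.δ k ≫ a = SSet.stdSimplex.δ j ≫ b := by
    rw [<- cancel_mono (SSet.Subcomplex.ι _), Category.assoc, Category.assoc, ha, hb,
      SSet.stdSimplex.δ_comp_δ hjk']
  have e3 : stdSimplex.map j.succAbove w = v := by
    apply TS_map_inj k.succ
    rw [<- h, stdSimplex.map_comp_apply, stdSimplex.map_comp_apply]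
    congr 1
    funext i
    have := SimplexCategory.δ_comp_δ (n := n) hjk'
    exact congrArg (fun f => f.toOrderHom i) this
  rw [<- e3, <- evS_δ, <- evS_δ, <- Category.assoc, <- Category.assoc, e2]

lemma compat {X : TopCat.{0}} {n : ℕ} {A : (Δ[n + 1] : SSet.{0}).Subcomplex}
    (φ : (A : SSet) ⟶ TopCat.toSSet.obj X)
    {j k : Fin (n + 2)} (a b : Δ[n] ⟶ (A : SSet)) (ha : a ≫ A.ι = SSet.stdSimplex.δ j)
    (hb : b ≫ A.ι = SSet.stdSimplex.δ k) (u v : TS n)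
    (h : stdSimplex.map j.succAbove u = stdSimplex.map k.succAbove v) :
    evS (a ≫ φ) u = evS (b ≫ φ) v := by
  rcases lt_trichotomy j k with hjk | rfl | hjk
  · exact compat_aux φ a b ha hb hjk u v h
  · obtain rfl : a = b := by rw [<- cancel_mono (SSet.Subcomplex.ι _), ha, hb]
    rw [TS_map_inj _ h]
  · exact (compat_aux φ b a hb ha hjk v u h.symm).symm

end HopfModel

namespace HopfModel

section horn
variable {n : ℕ} (i : Fin (n + 2))

lemma erase_ne : (Finset.univ.erase i).Nonempty := by
  obtain ⟨j, hj⟩ := exists_ne i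
  exact ⟨j, by simp [hj]⟩

noncomputable def hm (t : TS (n + 1)) : ℝ := (Finset.univ.erase i).inf' (erase_ne i) fun j => t j

lemma hm_le (t : TS (n + 1)) (j : Fin (n + 2)) (hj : j ≠ i) : hm i t ≤ t j :=
  Finset.inf'_le (fun j => t j) (by simp [hj])

lemma hm_nonneg (t : TS (n + 1)) : 0 ≤ hm i t := by
  simp [hm, Finset.le_inf'_iff]

lemma hm_mem (t : TS (n + 1)) : ∃ j, j ≠ i ∧ t j = hm i t := by
  obtain ⟨j, hj, h⟩ := Finset.exists_mem_eq_inf' (erase_ne i) fun j => t j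
  exact ⟨j, by simpa using hj, h.symm⟩

lemma continuous_coord {n : ℕ} (j : Fin (n + 1)) : Continuous fun t : TS n => t j :=
  (continuous_apply j).comp continuous_subtype_val

lemma hm_cont : Continuous (hm i) :=
  Continuous.finset_inf'_apply _ fun j _ => continuous_coord j

noncomputable def sh (p : TS (n + 1) × ℝ) : TS (n + 1) :=
  ⟨fun j => p.1 j + max 0 (min p.2 (hm i p.1)) * (if j = i then (n + 1 : ℝ) else -1), by
    intro j
    have h0 := hm_nonneg i p.1
    have h1 : max 0 (min p.2 (hm i p.1)) ≤ hm i p.1 := by simp [h0]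
    have h2 : 0 ≤ max 0 (min p.2 (hm i p.1)) := le_max_left _ _
    have := stdSimplex.zero_le p.1 j
    dsimp only
    split_ifs with h
    · positivity
    · have := hm_le i p.1 j h
      linarith, by
    dsimp only
    rw [Finset.sum_add_distrib, <- Finset.mul_sum, stdSimplex.sum_eq_one,
      <- Finset.add_sum_erase _ _ (Finset.mem_univ i),
      Finset.sum_congr rfl (g := fun _ => (-1 : ℝ)) (by simp +contextual)]
    simp⟩

lemma sh_apply (p : TS (n + 1) × ℝ) (j : Fin (n + 2)) : sh i p j =
    p.1 j + max 0 (min p.2 (hm i p.1)) * (if j = i then (n + 1 : ℝ) else -1) := rfl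

lemma sh_cont : Continuous (sh i) := by
  refine Continuous.subtype_mk (continuous_pi fun j => ?_) _
  have h1 : Continuous fun p : TS (n + 1) × ℝ => p.1 j := (continuous_coord j).comp continuous_fst
  have h2 : Continuous fun p : TS (n + 1) × ℝ => hm i p.1 := (hm_cont i).comp continuous_fst
  fun_prop

lemma sh_zero (t : TS (n + 1)) (s : ℝ) (h : s ≤ 0 ∨ hm i t = 0) : sh i (t, s) = t := by
  ext j
  have := hm_nonneg i t
  have h : max 0 (min s (hm i t)) = 0 := by
    rcases h with h | h
    · simp [h]
    · simp [h]
  rw [sh_apply, h]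
  simp

lemma sh_mem (t : TS (n + 1)) : ∃ j ∈ ({i}ᶜ : Set (Fin (n + 2))), sh i (t, hm i t) j = 0 := by
  obtain ⟨j, hj, h⟩ := hm_mem i t
  refine ⟨j, by simpa using hj, ?_⟩
  rw [sh_apply]
  simp [hj, h, hm_nonneg]

noncomputable def hr : C(TS (n + 1), {t : TS (n + 1) // ∃ j ∈ ({i}ᶜ : Set (Fin (n + 2))), t j = 0}) :=
  ⟨fun t => ⟨sh i (t, hm i t), sh_mem i t⟩, Continuous.subtype_mk
    ((sh_cont i).comp (continuous_id.prodMk (hm_cont i))) _⟩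

lemma hm_zero {t : TS (n + 1)} (h : ∃ j ∈ ({i}ᶜ : Set (Fin (n + 2))), t j = 0) : hm i t = 0 := by
  obtain ⟨j, hj, h⟩ := h
  exact le_antisymm (h ▸ hm_le i t j hj) (hm_nonneg i t)

lemma hr_self (t : TS (n + 1)) (h : ∃ j ∈ ({i}ᶜ : Set (Fin (n + 2))), t j = 0) : hr i t = ⟨t, h⟩ :=
  Subtype.ext (sh_zero i t _ (Or.inr (hm_zero i h)))

lemma horn_glue {X : TopCat.{0}} (φ : (Λ[n + 1, i] : SSet.{0}) ⟶ TopCat.toSSet.obj X) :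
    ∃ L : C({t : TS (n + 1) // ∃ j ∈ ({i}ᶜ : Set (Fin (n + 2))), t j = 0}, X), ∀ (j) (hj : j ≠ i) u,
      L ⟨stdSimplex.map j.succAbove u, j, hj, TS_map_self _ _⟩ = evS (SSet.horn.ι i j hj ≫ φ) u := by
  obtain ⟨L, hL⟩ := glue ({i}ᶜ) (fun j => evS (SSet.horn.ι i j.1 j.2 ≫ φ)) fun j k u v h =>
    compat φ _ _ (SSet.horn.ι_ι _ _ _) (SSet.horn.ι_ι _ _ _) u v h
  exact ⟨L, fun j hj u => hL ⟨j, hj⟩ u⟩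

end horn

abbrev PX (X : TopCat.{0}) : TopCat.{0} := TopCat.of C(unitInterval, X)

def endMap (X : TopCat.{0}) : PX X ⟶ TopCat.of (X × X) :=
  TopCat.ofHom ⟨fun γ => (γ 0, γ 1), by fun_prop⟩

def startMap (X : TopCat.{0}) : PX X ⟶ X := TopCat.ofHom ⟨fun γ => γ 0, by fun_prop⟩

open SSet.modelCategoryQuillen in
lemma fib_of_horn {E B : SSet.{0}} (p : E ⟶ B)
    (h : ∀ (n : ℕ) (i : Fin (n + 2)), HasLiftingProperty (SSet.horn (n + 1) i).ι p) :
    HomotopicalAlgebra.fibrations SSet p := by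
  rw [fibrations_eq]
  intro _ _ _ hf
  simp only [J, MorphismProperty.iSup_iff] at hf
  obtain ⟨n, ⟨i⟩⟩ := hf
  exact h n i

lemma hlp_sing (X : TopCat.{0}) (n : ℕ) (i : Fin (n + 2)) :
    HasLiftingProperty (SSet.horn (n + 1) i).ι
      (TopCat.toSSet.map (TopCat.ofHom (⟨fun _ => (), by fun_prop⟩ : C(X, Unit)))) := by
  refine ⟨fun {φ b} _ => ?_⟩
  obtain ⟨L, hL⟩ := horn_glue i φ
  refine ⟨⟨{ l := mkS (L.comp (hr i))
             fac_left := SSet.horn.hom_ext' fun j hj => ?_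
             fac_right := ?_ }⟩⟩
  · apply evS_inj
    ext u
    rw [<- hL, SSet.horn.ι_ι_assoc, evS_δ, evS_mkS, ContinuousMap.comp_apply, hr_self]
  · apply evS_inj
    ext u

lemma hlp_end (X : TopCat.{0}) (n : ℕ) (i : Fin (n + 2)) :
    HasLiftingProperty (SSet.horn (n + 1) i).ι (TopCat.toSSet.map (endMap X)) := by
  refine ⟨fun {φ b} sq => ?_⟩
  obtain ⟨L, hL⟩ := horn_glue i φ
  have hb : ∀ z, evS b z.1 = (L z 0, L z 1) := by
    rintro ⟨z, j, hj, h⟩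
    obtain ⟨u, rfl⟩ := TS_drop j z h
    rw [hL j hj, <- evS_δ, <- SSet.horn.ι_ι i j hj, Category.assoc, <- sq.w, <- Category.assoc, evS_comp]
    rfl
  let w : TS (n + 1) × unitInterval → ℝ := fun p => (2 * p.2 - 1) * (1 + hm i p.1)
  have hm1 : Continuous fun p : TS (n + 1) × unitInterval => hm i p.1 := (hm_cont i).comp continuous_fst
  have hw : Continuous w := by fun_prop
  let A : TS (n + 1) × unitInterval → X := fun p =>
    L (hr i p.1) (Set.projIcc 0 1 zero_le_one ((w p + 1) / 2))
  have hA : Continuous A := by fun_prop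
  let s : TS (n + 1) × unitInterval → TS (n + 1) := fun p => sh i (p.1, hm i p.1 - (|w p| - 1))
  have hs : Continuous s := (sh_cont i).comp (by fun_prop)
  let F : TS (n + 1) × unitInterval → X := fun p =>
    if w p ≤ -1 then (evS b (s p)).1 else if w p ≤ 1 then A p else (evS b (s p)).2
  have hs1 : ∀ p, |w p| = 1 → s p = (hr i p.1).1 := by
    intro p hp
    simp [s, hr, hp]
  have hF : Continuous F := by
    refine Continuous.if_le ?_ (Continuous.if_le ?_ ?_ ?_ ?_ ?_) ?_ ?_ ?_
    any_goals fun_prop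
    · intro p hp
      rw [hs1 p (by simp [hp]), hb]
      simp [A, hp]
    · intro p hp
      rw [hs1 p (by simp [hp]), hb]
      simp [A, hp]
  have F0 : ∀ t, F (t, 0) = (evS b t).1 := by
    intro t
    have h0 := hm_nonneg i t
    have h : w (t, 0) = - (1 + hm i t) := by simp [w]
    have h' : s (t, 0) = t := by
      simp only [s, h]
      apply sh_zero
      left
      rw [abs_neg, abs_of_nonneg (by linarith)]
      linarith
    simp [F, h, h', h0]
  have F1 : ∀ t, F (t, 1) = (evS b t).2 := by
    intro t
    have h0 := hm_nonneg i t
    have h : w (t, 1) = (1 + hm i t) := by simp only [w]; norm_num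
    have h' : s (t, 1) = t := by
      simp only [s, h]
      apply sh_zero
      left
      rw [abs_of_nonneg (by linarith)]
      linarith
    simp only [F, h, h']
    rw [if_neg (by linarith)]
    split_ifs with h1
    · have h2 : hm i t = 0 := by linarith
      have h3 : (hr i t).1 = t := by simp [hr, sh_zero, h2]
      have := hb (hr i t)
      rw [h3] at this
      rw [this]
      simp [A, h, h2]
    · rfl
  have FZ : ∀ (z : {t : TS (n + 1) // ∃ j ∈ ({i}ᶜ : Set (Fin (n + 2))), t j = 0}) u,
      F (z.1, u) = L z u := by
    intro z u
    have h0 := hm_zero i z.2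
    have hw : w (z.1, u) = 2 * u - 1 := by simp [w, h0]
    have h1 := u.2.1
    have h2 := u.2.2
    have hAz : A (z.1, u) = L z u := by
      simp only [A, hw]
      rw [hr_self i _ z.2]
      congr 1
      ext
      simp [Set.projIcc, h1, h2]
    by_cases h3 : w (z.1, u) ≤ -1
    · have : u = 0 := by
        ext
        rw [hw] at h3
        change (u : ℝ) = 0
        linarith
      subst this
      rw [F0, hb]
    · simp only [F, if_neg h3]
      rw [if_pos (by linarith), hAz]
  let Φ : C(TS (n + 1), PX X) := (⟨F, hF⟩ : C(TS (n + 1) × unitInterval, X)).curry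
  refine ⟨⟨{ l := mkS Φ
             fac_left := SSet.horn.hom_ext' fun j hj => ?_
             fac_right := ?_ }⟩⟩
  · apply evS_inj
    ext u : 1
    rw [<- hL, SSet.horn.ι_ι_assoc, evS_δ, evS_mkS]
    ext v
    exact FZ ⟨_, j, hj, TS_map_self j u⟩ v
  · apply evS_inj
    ext u : 1
    rw [evS_comp, evS_mkS]
    exact Prod.ext (F0 u) (F1 u)

lemma anodyne_lift {A B : SSet.{0}} (i : A ⟶ B) (hi : SSet.anodyneExtensions i) {E Y : TopCat.{0}}
    (p : E ⟶ Y) (hp : ∀ (n : ℕ) (i : Fin (n + 2)),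
      HasLiftingProperty (SSet.horn (n + 1) i).ι (TopCat.toSSet.map p)) :
    HasLiftingProperty (SSet.toTop.map i) p := by
  rw [sSetTopAdj.hasLiftingProperty_iff]
  exact hi _ (fib_of_horn _ hp)

lemma anodyne_sdr {A B : SSet.{0}} (i : A ⟶ B) (hi : SSet.anodyneExtensions i) :
    ∃ r : |B| ⟶ |A|, SSet.toTop.map i ≫ r = 𝟙 _ ∧ ∃ H : C(|B|, C(unitInterval, |B|)),
      (∀ b, H b 0 = b) ∧ (∀ b, H b 1 = SSet.toTop.map i (r b)) ∧
      ∀ a u, H (SSet.toTop.map i a) u = SSet.toTop.map i a := by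
  have h1 := anodyne_lift i hi _ (hlp_sing |A|)
  have sq : CommSq (𝟙 |A|) (SSet.toTop.map i)
    (TopCat.ofHom (⟨fun _ => (), by fun_prop⟩ : C(|A|, Unit)))
    (TopCat.ofHom (⟨fun _ => (), by fun_prop⟩ : C(|B|, Unit))) := ⟨rfl⟩
  refine ⟨sq.lift, sq.fac_left, ?_⟩
  have h2 := anodyne_lift i hi _ (hlp_end |B|)
  have hr : ∀ a, sq.lift (SSet.toTop.map i a) = a := fun a => ConcreteCategory.congr_hom sq.fac_left a
  have sq2 : CommSq (SSet.toTop.map i ≫ TopCat.ofHom (ContinuousMap.const' : C(|B|, C(unitInterval, |B|))))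
    (SSet.toTop.map i) (endMap |B|)
    (TopCat.ofHom ⟨fun b => (b, SSet.toTop.map i (sq.lift b)), by fun_prop⟩) := ⟨by
      ext a : 1
      refine Prod.ext rfl ?_
      simp [endMap, hr]⟩
  refine ⟨sq2.lift.hom, fun b => ?_, fun b => ?_, fun a u => ?_⟩
  · exact congrArg Prod.fst (ConcreteCategory.congr_hom sq2.fac_right b)
  · exact congrArg Prod.snd (ConcreteCategory.congr_hom sq2.fac_right b)
  · exact DFunLike.congr_fun (ConcreteCategory.congr_hom sq2.fac_left a) u

end HopfModel

namespace HopfModel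

section bdry
variable {n : ℕ}

noncomputable def rho (t : TS (n + 1)) : ℝ :=
  1 - (n + 2) * Finset.univ.inf' Finset.univ_nonempty fun j => t j

lemma rho_cont : Continuous (rho (n := n)) := by
  have : Continuous fun t : TS (n + 1) => Finset.univ.inf' Finset.univ_nonempty fun j => t j :=
    Continuous.finset_inf'_apply _ fun j _ => continuous_coord j
  unfold rho
  fun_prop

lemma rho_le (t : TS (n + 1)) : rho t ≤ 1 := by
  have : 0 ≤ Finset.univ.inf' Finset.univ_nonempty fun j => t j := by simp [Finset.le_inf'_iff]
  unfold rho
  have : 0 ≤ (n + 2 : ℝ) * Finset.univ.inf' Finset.univ_nonempty fun j => t j := by positivity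
  linarith

lemma rho_coord (t : TS (n + 1)) (j : Fin (n + 2)) : 1 - rho t ≤ (n + 2) * t j := by
  have : (Finset.univ.inf' Finset.univ_nonempty fun j => t j) ≤ t j :=
    Finset.inf'_le _ (Finset.mem_univ j)
  unfold rho
  have : (0 : ℝ) < n + 2 := by positivity
  nlinarith

lemma rho_mem (t : TS (n + 1)) : ∃ j, 1 - rho t = (n + 2) * t j := by
  obtain ⟨j, _, h⟩ := Finset.exists_mem_eq_inf' Finset.univ_nonempty fun j => t j
  exact ⟨j, by rw [<- h]; simp [rho]⟩

lemma rho_eq_one {t : TS (n + 1)} (h : ∃ j ∈ (Set.univ : Set (Fin (n + 2))), t j = 0) : rho t = 1 := by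
  obtain ⟨j, -, h⟩ := h
  have := rho_coord t j
  rw [h] at this
  linarith [rho_le t]

noncomputable def dk (p : TS (n + 1) × unitInterval) : ℝ := min (1 + p.2) (max (rho p.1) (1 / 2))⁻¹

lemma dk_pos (p : TS (n + 1) × unitInterval) : 0 < dk p := by
  have := p.2.2.1
  have : (0 : ℝ) < max (rho p.1) (1 / 2) := lt_max_of_lt_right (by norm_num)
  unfold dk
  positivity

lemma dk_le (p : TS (n + 1) × unitInterval) : dk p * rho p.1 ≤ 1 := by
  have h : (0 : ℝ) < max (rho p.1) (1 / 2) := lt_max_of_lt_right (by norm_num)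
  calc dk p * rho p.1 ≤ dk p * max (rho p.1) (1 / 2) := by
        have := dk_pos p
        gcongr
        exact le_max_left _ _
    _ ≤ (max (rho p.1) (1 / 2))⁻¹ * max (rho p.1) (1 / 2) := by
        gcongr
        exact min_le_right _ _
    _ = 1 := by field_simp

noncomputable def dil (p : TS (n + 1) × unitInterval) : TS (n + 1) :=
  ⟨fun j => 1 / (n + 2) + dk p * (p.1 j - 1 / (n + 2)), by
    intro j
    have h1 := dk_le p
    have h2 := dk_pos p
    have h3 := rho_coord p.1 j
    have h4 : (0 : ℝ) < n + 2 := by positivity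
    have : 1 / (n + 2) + dk p * (p.1 j - 1 / (n + 2)) =
      ((1 - dk p * rho p.1) + dk p * ((n + 2) * p.1 j - (1 - rho p.1))) / (n + 2) := by
      field_simp
      ring
    dsimp only
    rw [this]
    have : 0 ≤ dk p * ((n + 2) * p.1 j - (1 - rho p.1)) := by
      apply mul_nonneg h2.le
      linarith
    apply div_nonneg _ h4.le
    linarith, by
    have h4 : (n + 2 : ℝ) ≠ 0 := by positivity
    dsimp only
    rw [Finset.sum_add_distrib, <- Finset.mul_sum, Finset.sum_sub_distrib, stdSimplex.sum_eq_one]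
    simp
    field_simp
    ring⟩

lemma dil_apply (p : TS (n + 1) × unitInterval) (j) :
  dil p j = 1 / (n + 2) + dk p * (p.1 j - 1 / (n + 2)) := rfl

lemma dil_cont : Continuous (dil (n := n)) := by
  refine Continuous.subtype_mk (continuous_pi fun j => ?_) _
  have h1 : Continuous fun p : TS (n + 1) × unitInterval => p.1 j := (continuous_coord j).comp continuous_fst
  have h2 : Continuous fun p : TS (n + 1) × unitInterval => rho p.1 := rho_cont.comp continuous_fst
  have h3 : Continuous fun p : TS (n + 1) × unitInterval => (max (rho p.1) (1 / 2))⁻¹ :=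
    Continuous.inv₀ (by fun_prop) fun p => (lt_max_of_lt_right (by norm_num)).ne'
  unfold dk
  fun_prop

lemma dil_mem (p : TS (n + 1) × unitInterval) (h : 1 ≤ (1 + p.2) * rho p.1) :
    ∃ j ∈ (Set.univ : Set (Fin (n + 2))), dil p j = 0 := by
  have h1 := p.2.2.2
  have h0 : 0 < rho p.1 := by
    by_contra! h0
    nlinarith [p.2.2.1]
  have h2 : 1 / 2 ≤ rho p.1 := by nlinarith
  obtain ⟨j, hj⟩ := rho_mem p.1
  refine ⟨j, trivial, ?_⟩
  have h3 : dk p = (rho p.1)⁻¹ := by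
    rw [dk, max_eq_left h2, min_eq_right]
    rwa [inv_le_iff_one_le_mul₀ h0]
  have h4 : (n + 2 : ℝ) ≠ 0 := by positivity
  rw [dil_apply, h3]
  have : p.1 j = (1 - rho p.1) / (n + 2) := by rw [hj]; field_simp
  rw [this]
  field_simp
  ring

lemma dk_zero (t : TS (n + 1)) : dk (t, 0) = 1 := by
  have := rho_le t
  rw [dk, min_eq_left]
  · simp
  · simp only [Set.Icc.coe_zero, add_zero]
    rw [one_le_inv₀ (lt_max_of_lt_right (by norm_num))]
    exact max_le this (by norm_num)

lemma dk_bdry {t : TS (n + 1)} (h : rho t = 1) (u) : dk (t, u) = 1 := by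
  have := u.2.1
  simp only [dk, h]
  norm_num
  exact this

lemma dil_one {p : TS (n + 1) × unitInterval} (h : dk p = 1) : dil p = p.1 := by
  ext j
  rw [dil_apply, h]
  ring

lemma bdry_glue {X : TopCat.{0}} (φ : (∂Δ[n + 1] : SSet.{0}) ⟶ TopCat.toSSet.obj X) :
    ∃ L : C({t : TS (n + 1) // ∃ j ∈ (Set.univ : Set (Fin (n + 2))), t j = 0}, X), ∀ (j : Fin (n + 2)) (u : TS n),
      L ⟨stdSimplex.map j.succAbove u, j, Set.mem_univ j, TS_map_self j u⟩ = evS (SSet.boundary.ι j ≫ φ) u := by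
  obtain ⟨L, hL⟩ := glue (Set.univ : Set (Fin (n + 2))) (fun j => evS (SSet.boundary.ι j.1 ≫ φ)) fun j k u v h =>

    compat φ (SSet.boundary.ι j.1) (SSet.boundary.ι k.1) (SSet.boundary.ι_ι j.1) (SSet.boundary.ι_ι k.1) u v h
  exact ⟨L, fun j u => hL ⟨j, Set.mem_univ j⟩ u⟩

end bdry

lemma hlp_start (X : TopCat.{0}) (n : ℕ) :
    HasLiftingProperty (SSet.boundary (n + 1)).ι (TopCat.toSSet.map (startMap X)) := by
  refine ⟨fun {φ b} sq => ?_⟩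
  obtain ⟨L, hL⟩ := bdry_glue φ
  have hb : ∀ z, evS b z.1 = L z 0 := by
    rintro ⟨z, j, hj, h⟩
    obtain ⟨u, rfl⟩ := TS_drop j z h
    rw [hL j, <- evS_δ, <- SSet.boundary.ι_ι j, Category.assoc, <- sq.w, <- Category.assoc, evS_comp]
    rfl
  let w : TS (n + 1) × unitInterval → ℝ := fun p => (1 + p.2) * rho p.1
  have hm1 : Continuous fun p : TS (n + 1) × unitInterval => rho p.1 := rho_cont.comp continuous_fst
  have hw : Continuous w := by fun_prop
  have hdc := dil_cont (n := n)
  classical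
  let F : TS (n + 1) × unitInterval → X := fun p =>
    if h : 1 ≤ w p then L ⟨dil p, dil_mem p h⟩ (Set.projIcc 0 1 zero_le_one (w p - 1)) else evS b (dil p)
  have F1 : ∀ p, w p ≤ 1 → F p = evS b (dil p) := by
    intro p hp
    by_cases h : 1 ≤ w p
    · have e : w p = 1 := le_antisymm hp h
      simp only [F, dif_pos h]
      have := hb ⟨dil p, dil_mem p h⟩
      rw [this]
      congr 1
      exact Set.projIcc_of_le_left _ (by linarith)
    · simp only [F, dif_neg h]
  have hF : Continuous F := by
    have c1 : ContinuousOn F {p | w p ≤ 1} :=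
      ContinuousOn.congr (f := fun p => evS b (dil p)) (by fun_prop) F1
    have c2 : ContinuousOn F {p | 1 ≤ w p} := by
      rw [continuousOn_iff_continuous_domRestrict]
      have : Set.domRestrict {p | 1 ≤ w p} F = fun p =>
          L ⟨dil p.1, dil_mem p.1 p.2⟩ (Set.projIcc 0 1 zero_le_one (w p.1 - 1)) := by
        funext p
        have hp : 1 ≤ w p.1 := p.2
        simp [Set.domRestrict, F, hp]
      rw [this]
      have : Continuous fun p : {p | 1 ≤ w p} => (⟨dil p.1, dil_mem p.1 p.2⟩ :
        {t : TS (n + 1) // ∃ j ∈ (Set.univ : Set (Fin (n + 2))), t j = 0}) :=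
        Continuous.subtype_mk (by fun_prop) _
      fun_prop
    rw [<- continuousOn_univ]
    have : (Set.univ : Set (TS (n + 1) × unitInterval)) = {p | w p ≤ 1} ∪ {p | 1 ≤ w p} := by
      ext p; simp [le_total]
    rw [this]
    exact c1.union_of_isClosed c2 (isClosed_le hw continuous_const) (isClosed_le continuous_const hw)
  let Φ : C(TS (n + 1), PX X) := (⟨F, hF⟩ : C(TS (n + 1) × unitInterval, X)).curry
  refine ⟨⟨{ l := mkS Φ
             fac_left := SSet.boundary.hom_ext fun j => ?_
             fac_right := ?_ }⟩⟩
  · apply evS_inj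
    ext u : 1
    rw [<- hL, SSet.boundary.ι_ι_assoc, evS_δ, evS_mkS]
    ext v
    have hz : ∃ j' ∈ (Set.univ : Set (Fin (n + 2))), (stdSimplex.map j.succAbove u) j' = 0 :=
      ⟨j, trivial, TS_map_self j u⟩
    have hr := rho_eq_one hz
    have hwv : w (stdSimplex.map j.succAbove u, v) = 1 + v := by simp [w, hr]
    have hd := dil_one (dk_bdry hr v)
    have hv := v.2.1
    have : F (stdSimplex.map j.succAbove u, v) = L ⟨_, hz⟩ v := by
      simp only [F, hwv]
      rw [dif_pos (by linarith)]
      simp only [hd]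
      congr 1
      ext
      simp [Set.projIcc, hv, v.2.2]
    exact this
  · apply evS_inj
    ext u : 1
    rw [evS_comp, evS_mkS]
    have : F (u, 0) = evS b u := by
      rw [F1, dil_one (dk_zero u)]
      simp [w, rho_le]
    exact this

lemma cell_hep {A B : SSet.{0}} (i : A ⟶ B) {n : ℕ} (a : (∂Δ[n + 1] : SSet.{0}) ⟶ A) (b : Δ[n + 1] ⟶ B)
    (hp : IsPushout a (SSet.boundary (n + 1)).ι i b) (X : TopCat.{0}) (f : |B| ⟶ X)
    (H : C(|A|, C(unitInterval, X))) (hH : ∀ x, H x 0 = f (SSet.toTop.map i x)) :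
    ∃ K : C(|B|, C(unitInterval, X)), (∀ x, K x 0 = f x) ∧ ∀ x, K (SSet.toTop.map i x) = H x := by
  have := hlp_start X n
  have h1 : HasLiftingProperty i (TopCat.toSSet.map (startMap X)) := hp.hasLiftingProperty _
  rw [<- sSetTopAdj.hasLiftingProperty_iff] at h1
  have sq : CommSq (TopCat.ofHom H : |A| ⟶ PX X) (SSet.toTop.map i) (startMap X) f :=
    ⟨by ext x; exact hH x⟩
  exact ⟨sq.lift.hom, fun x => ConcreteCategory.congr_hom sq.fac_right x,
    fun x => ConcreteCategory.congr_hom sq.fac_left x⟩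

end HopfModel

namespace HopfModel
open scoped unitInterval Topology Topology.Homotopy

section cubeHEP
variable {N : Type} [Fintype N]

noncomputable def crho (x : N → I) : ℝ := ‖fun j => (2 * (x j : ℝ) - 1)‖

lemma crho_cont : Continuous (crho (N := N)) := by unfold crho; fun_prop

lemma crho_le (x : N → I) : crho x ≤ 1 := by
  refine (pi_norm_le_iff_of_nonneg zero_le_one).2 fun j => ?_
  have := (x j).2.1; have := (x j).2.2
  rw [Real.norm_eq_abs, abs_le]; constructor <;> linarith

lemma crho_coord (x : N → I) (j : N) : abs (2 * (x j : ℝ) - 1) ≤ crho x :=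
  norm_le_pi_norm (fun j => (2 * (x j : ℝ) - 1)) j

lemma crho_bdry {x : N → I} (h : x ∈ Cube.boundary N) : crho x = 1 := by
  refine le_antisymm (crho_le x) ?_
  obtain ⟨j, h | h⟩ := h <;>
  · have := crho_coord x j
    rw [h] at this; norm_num at this; exact this

lemma crho_attained {x : N → I} (h : 0 < crho x) : ∃ j, abs (2 * (x j : ℝ) - 1) = crho x := by
  by_cases hN : Nonempty N
  · obtain ⟨j, -, hj⟩ := Finset.exists_max_image Finset.univ (fun j => abs (2 * (x j : ℝ) - 1)) Finset.univ_nonempty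
    refine ⟨j, le_antisymm (crho_coord x j) ?_⟩
    exact (pi_norm_le_iff_of_nonneg (abs_nonneg _)).2 fun i => hj i (Finset.mem_univ i)
  · have : IsEmpty N := not_nonempty_iff.1 hN
    exfalso
    have : crho x ≤ 0 := (pi_norm_le_iff_of_nonneg le_rfl).2 fun j => isEmptyElim j
    linarith

noncomputable def ck (p : (N → I) × I) : ℝ := min (1 + p.2) (max (crho p.1) (1 / 2))⁻¹

lemma ck_cont : Continuous (ck (N := N)) := by
  have h := crho_cont (N := N)
  have : Continuous fun p : (N → I) × I => (max (crho p.1) (1 / 2))⁻¹ :=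
    Continuous.inv₀ (by fun_prop) fun p => (lt_max_of_lt_right (by norm_num)).ne'
  unfold ck
  fun_prop

lemma ck_nonneg (p : (N → I) × I) : 0 ≤ ck p :=
  le_min (by have := p.2.2.1; linarith) (inv_nonneg.2 (le_max_of_le_right (by norm_num)))

lemma ck_mul (p : (N → I) × I) (j) : abs (ck p * (2 * (p.1 j : ℝ) - 1)) ≤ 1 := by
  rw [abs_mul, abs_of_nonneg (ck_nonneg p)]
  have h0 : (0 : ℝ) < max (crho p.1) (1 / 2) := lt_max_of_lt_right (by norm_num)
  calc _ ≤ (max (crho p.1) (1 / 2))⁻¹ * max (crho p.1) (1 / 2) :=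
        mul_le_mul (min_le_right _ _) ((crho_coord _ j).trans (le_max_left _ _)) (abs_nonneg _)
          (inv_nonneg.2 h0.le)
    _ = 1 := inv_mul_cancel₀ h0.ne'

noncomputable def cdil (p : (N → I) × I) : N → I := fun j =>
  ⟨(1 + ck p * (2 * (p.1 j : ℝ) - 1)) / 2, by
    have := abs_le.1 (ck_mul p j)
    constructor <;> linarith⟩

lemma cdil_cont : Continuous (cdil (N := N)) := by
  have := ck_cont (N := N)
  unfold cdil
  fun_prop

lemma cdil_mem (p : (N → I) × I) (h : 1 ≤ (1 + (p.2 : ℝ)) * crho p.1) : cdil p ∈ Cube.boundary N := by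
  have h2 := p.2.2.2
  have h1 := p.2.2.1
  have hr : 1 / 2 ≤ crho p.1 := by
    have : 0 ≤ crho p.1 := norm_nonneg _
    nlinarith
  have hk : ck p = (crho p.1)⁻¹ := by
    rw [ck, max_eq_left hr, min_eq_right]
    rw [inv_le_iff_one_le_mul₀ (by linarith)]
    linarith
  obtain ⟨j, hj⟩ := crho_attained (x := p.1) (by linarith)
  refine ⟨j, ?_⟩
  have h0 : crho p.1 ≠ 0 := by intro h; rw [h] at hr; norm_num at hr
  rcases abs_eq_abs.1 (hj.trans (abs_of_nonneg (by linarith : 0 ≤ crho p.1)).symm) with e | e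
  · right
    ext
    simp [cdil, hk, e, h0]
  · left
    ext
    simp [cdil, hk, e, h0]

lemma cdil_zero (x : N → I) : cdil (x, 0) = x := by
  have : ck (x, (0 : I)) = 1 := by
    rw [ck, min_eq_left]
    · simp
    · simp only [Set.Icc.coe_zero, add_zero]
      rw [one_le_inv₀ (lt_max_of_lt_right (by norm_num))]
      exact max_le (crho_le x) (by norm_num)
  ext j
  simp [cdil, this]

lemma cdil_bdry {x : N → I} (h : x ∈ Cube.boundary N) (t : I) : cdil (x, t) = x := by
  have : ck (x, t) = 1 := by
    have := t.2.1
    simp only [ck, crho_bdry h]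
    norm_num
    exact this
  ext j
  simp [cdil, this]

lemma cube_hep {X : Type} [TopologicalSpace X] (a : C(N → I, X)) (Γ : C(Cube.boundary N × I, X))
    (h0 : ∀ y, Γ (y, 0) = a y) :
    ∃ K : C((N → I) × I, X), (∀ x, K (x, 0) = a x) ∧ ∀ (y : Cube.boundary N) t, K (y, t) = Γ (y, t) := by
  let w : (N → I) × I → ℝ := fun p => (1 + p.2) * crho p.1
  have hm1 : Continuous fun p : (N → I) × I => crho p.1 := crho_cont.comp continuous_fst
  have hw : Continuous w := by fun_prop
  have hdc := cdil_cont (N := N)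
  classical
  let F : (N → I) × I → X := fun p =>
    if h : 1 ≤ w p then Γ (⟨cdil p, cdil_mem p h⟩, Set.projIcc 0 1 zero_le_one (w p - 1)) else a (cdil p)
  have F1 : ∀ p, w p ≤ 1 → F p = a (cdil p) := by
    intro p hp
    by_cases h : 1 ≤ w p
    · have e : w p = 1 := le_antisymm hp h
      simp only [F, dif_pos h]
      rw [<- h0 ⟨cdil p, cdil_mem p h⟩]
      congr 2
      exact Set.projIcc_of_le_left _ (by linarith)
    · simp only [F, dif_neg h]
  have hF : Continuous F := by
    have c1 : ContinuousOn F {p | w p ≤ 1} :=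
      ContinuousOn.congr (f := fun p => a (cdil p)) (by fun_prop) F1
    have c2 : ContinuousOn F {p | 1 ≤ w p} := by
      rw [continuousOn_iff_continuous_domRestrict]
      have : Set.domRestrict {p | 1 ≤ w p} F = fun p =>
          Γ (⟨cdil p.1, cdil_mem p.1 p.2⟩, Set.projIcc 0 1 zero_le_one (w p.1 - 1)) := by
        funext p
        have hp : 1 ≤ w p.1 := p.2
        simp [Set.domRestrict, F, hp]
      rw [this]
      have : Continuous fun p : {p | 1 ≤ w p} => (⟨cdil p.1, cdil_mem p.1 p.2⟩ : Cube.boundary N) :=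
        Continuous.subtype_mk (by fun_prop) _
      fun_prop
    rw [<- continuousOn_univ]
    have : (Set.univ : Set ((N → I) × I)) = {p | w p ≤ 1} ∪ {p | 1 ≤ w p} := by
      ext p; simp [le_total]
    rw [this]
    exact c1.union_of_isClosed c2 (isClosed_le hw continuous_const) (isClosed_le continuous_const hw)
  refine ⟨⟨F, hF⟩, fun x => ?_, fun y t => ?_⟩
  · change F _ = _
    rw [F1, cdil_zero]
    simpa [w] using crho_le x
  · change F _ = _
    have hwv : w (y.1, t) = 1 + t := by simp [w, crho_bdry y.2]
    have ht := t.2.1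
    simp only [F, hwv]
    rw [dif_pos (by linarith)]
    congr 2
    · ext1; exact cdil_bdry y.2 t
    · ext
      simp [Set.projIcc, ht, t.2.2]

end cubeHEP
end HopfModel

namespace HopfModel
open scoped unitInterval Topology Topology.Homotopy

section Fh
variable {N : Type} {X : Type} [TopologicalSpace X]

def Fh (γ : C(I, X)) (a b : C(N → I, X)) : Prop :=
  ∃ h : C((N → I) × I, X), (∀ x, h (x, 0) = a x) ∧ (∀ x, h (x, 1) = b x) ∧
    ∀ y ∈ Cube.boundary N, ∀ t, h (y, t) = γ t

lemma Fh_symm {γ : C(I, X)} {a b : C(N → I, X)} (h : Fh γ a b) :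
    Fh (γ.comp ⟨unitInterval.symm, by fun_prop⟩) b a := by
  obtain ⟨h, h0, h1, h2⟩ := h
  exact ⟨⟨fun p => h (p.1, unitInterval.symm p.2), by fun_prop⟩, fun x => by simp [h1],
    fun x => by simp [h0], fun y hy t => h2 y hy _⟩

lemma Fh_exists [Fintype N] (γ : C(I, X)) (a : C(N → I, X)) (ha : ∀ y ∈ Cube.boundary N, a y = γ 0) :
    ∃ b, Fh γ a b := by
  obtain ⟨K, h0, h1⟩ := cube_hep a ⟨fun p => γ p.2, by fun_prop⟩ fun y => (ha y y.2).symm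
  exact ⟨⟨fun x => K (x, 1), by fun_prop⟩, K, h0, fun _ => rfl, fun y hy t => h1 ⟨y, hy⟩ t⟩

lemma Fh_unique [Fintype N] {γ : C(I, X)} {a b a' b' : C(N → I, X)} (h : Fh γ a b) (h' : Fh γ a' b')
    (k : Fh (ContinuousMap.const _ (γ 0)) a a') : Fh (ContinuousMap.const _ (γ 1)) b b' := by
  obtain ⟨h, h0, h1, h2⟩ := h
  obtain ⟨h', h0', h1', h2'⟩ := h'
  obtain ⟨k, k0, k1, k2⟩ := k
  have key : ∀ q ∈ Cube.boundary (Option N), q none ≠ 0 → q none ≠ 1 → (fun j => q (some j)) ∈ Cube.boundary N := by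
    rintro q ⟨j, hj⟩ hq0 hq1
    cases j with
    | none => rcases hj with hj | hj <;> contradiction
    | some j => exact ⟨j, hj⟩
  let Γ : C(Cube.boundary (Option N) × I, X) :=
    ⟨fun p => if (p.1.1 none : ℝ) ≤ 1 / 2 then h (fun j => p.1.1 (some j), p.2)
      else h' (fun j => p.1.1 (some j), p.2), by
      have hc : ∀ j, Continuous fun p : Cube.boundary (Option N) × I => p.1.1 j := fun j =>
        (continuous_apply j).comp (continuous_subtype_val.comp continuous_fst)
      have hc0 := hc none
      have hc2 : Continuous fun p : Cube.boundary (Option N) × I => fun j => p.1.1 (some j) :=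
        continuous_pi fun j => hc (some j)
      refine Continuous.if_le (h.continuous.comp (hc2.prodMk continuous_snd))
        (h'.continuous.comp (hc2.prodMk continuous_snd)) (continuous_subtype_val.comp hc0) continuous_const fun p hp => ?_
      have : (fun j => p.1.1 (some j)) ∈ Cube.boundary N := key p.1.1 p.1.2
        (by intro h; rw [h] at hp; norm_num at hp) (by intro h; rw [h] at hp; norm_num at hp)
      rw [h2 _ this, h2' _ this]⟩
  have hΓ0 : ∀ (p : Cube.boundary (Option N)) t, p.1 none = 0 → Γ (p, t) = h (fun j => p.1 (some j), t) := by
    intro p t hp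
    simp only [Γ, ContinuousMap.coe_mk, hp]
    rw [if_pos (by simp)]
  have hΓ1 : ∀ (p : Cube.boundary (Option N)) t, p.1 none = 1 → Γ (p, t) = h' (fun j => p.1 (some j), t) := by
    intro p t hp
    simp only [Γ, ContinuousMap.coe_mk, hp]
    rw [if_neg (by norm_num)]
  have hΓ2 : ∀ (p : Cube.boundary (Option N)) t, (fun j => p.1 (some j)) ∈ Cube.boundary N → Γ (p, t) = γ t := by
    intro p t hp
    simp only [Γ, ContinuousMap.coe_mk, h2 _ hp, h2' _ hp, ite_self]
  obtain ⟨K, hK0, hK1⟩ := cube_hep (N := Option N) ⟨fun p => k (fun j => p (some j), p none), by fun_prop⟩ Γ <| by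
    intro y
    by_cases y0 : y.1 none = 0
    · rw [hΓ0 _ _ y0]
      simp [y0, k0, h0]
    by_cases y1 : y.1 none = 1
    · rw [hΓ1 _ _ y1]
      simp [y1, k1, h0']
    have := key _ y.2 y0 y1
    rw [hΓ2 _ _ this]
    exact (k2 _ this _).symm
  let e : C((N → I) × I, Option N → I) := ⟨fun p j => j.elim p.2 p.1, by
    refine continuous_pi fun j => ?_
    cases j <;> simp only [Option.elim] <;> fun_prop⟩
  have e0 : ∀ (x : N → I), e (x, 0) ∈ Cube.boundary (Option N) := fun x => ⟨none, Or.inl rfl⟩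
  have e1 : ∀ (x : N → I), e (x, 1) ∈ Cube.boundary (Option N) := fun x => ⟨none, Or.inr rfl⟩
  refine ⟨⟨fun p => K (e p, 1), by fun_prop⟩, fun x => ?_, fun x => ?_, fun y hy t => ?_⟩
  · exact (hK1 ⟨_, e0 x⟩ 1).trans ((hΓ0 ⟨_, e0 x⟩ 1 rfl).trans (h1 x))
  · exact (hK1 ⟨_, e1 x⟩ 1).trans ((hΓ1 ⟨_, e1 x⟩ 1 rfl).trans (h1' x))
  · have e2 : e (y, t) ∈ Cube.boundary (Option N) := by
      obtain ⟨j, hj⟩ := hy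
      exact ⟨some j, hj⟩
    exact (hK1 ⟨_, e2⟩ 1).trans (hΓ2 ⟨_, e2⟩ 1 hy)

lemma Fh_iff {x : X} {f g : Ω^ N X x} : GenLoop.Homotopic f g ↔ Fh (ContinuousMap.const _ x) f.1 g.1 := by
  constructor
  · rintro ⟨H⟩
    refine ⟨⟨fun p => H (p.2, p.1), by fun_prop⟩, fun y => H.apply_zero y, fun y => H.apply_one y, fun y hy t => ?_⟩
    exact (H.eq_fst t hy).trans (f.2 y hy)
  · rintro ⟨h, h0, h1, h2⟩
    refine ⟨⟨⟨⟨fun p => h (p.2, p.1), by fun_prop⟩, h0, h1⟩, fun t y hy => ?_⟩⟩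
    exact (h2 y hy t).trans (f.2 y hy).symm

variable [DecidableEq N]

lemma transAt_apply (i : N) {x : X} (f g : Ω^ N X x) (t : N → I) : GenLoop.transAt i f g t =
   if (t i : ℝ) ≤ 1 / 2
      then f (Function.update t i <| Set.projIcc 0 1 zero_le_one (2 * t i))
      else g (Function.update t i <| Set.projIcc 0 1 zero_le_one (2 * t i - 1)) := rfl

lemma Fh_transAt (i : N) {γ : C(I, X)} {x x' : X} {a a' : Ω^ N X x} {b b' : Ω^ N X x'}
    (h : Fh γ a.1 b.1) (h' : Fh γ a'.1 b'.1) :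
    Fh γ (GenLoop.transAt i a a').1 (GenLoop.transAt i b b').1 := by
  obtain ⟨h, h0, h1, h2⟩ := h
  obtain ⟨h', h0', h1', h2'⟩ := h'
  refine ⟨⟨fun p => if (p.1 i : ℝ) ≤ 1 / 2
      then h (Function.update p.1 i <| Set.projIcc 0 1 zero_le_one (2 * p.1 i), p.2)
      else h' (Function.update p.1 i <| Set.projIcc 0 1 zero_le_one (2 * p.1 i - 1), p.2), ?_⟩, ?_, ?_, ?_⟩
  · refine Continuous.if_le (by fun_prop) (by fun_prop) (by fun_prop) (by fun_prop) fun p hp => ?_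
    rw [hp, h2 _ ⟨i, by right; simp⟩, h2' _ ⟨i, by left; simp⟩]
  · intro y
    simp only [ContinuousMap.coe_mk, h0, h0']
    exact (transAt_apply i a a' y).symm
  · intro y
    simp only [ContinuousMap.coe_mk, h1, h1']
    exact (transAt_apply i b b' y).symm
  · rintro y ⟨j, hj⟩ t
    simp only [ContinuousMap.coe_mk]
    by_cases hji : j = i
    · subst hji
      rcases hj with hj | hj
      · rw [if_pos (by rw [hj]; norm_num), h2 _ ⟨j, by left; simp [hj]⟩]
      · rw [if_neg (by rw [hj]; norm_num), h2' _ ⟨j, by right; simp [hj]; norm_num⟩]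
    · split_ifs
      · rw [h2 _ ⟨j, by simpa [hji] using hj⟩]
      · rw [h2' _ ⟨j, by simpa [hji] using hj⟩]

end Fh

section homs
variable {N M : Type} [DecidableEq N] [Nonempty N] [DecidableEq M] [Nonempty M] {X Y : Type} [TopologicalSpace X]
  [TopologicalSpace Y]

noncomputable def mkHom {x : X} {y : Y} (Φ : Ω^ N X x → Ω^ M Y y)
    (h1 : ∀ a b, GenLoop.Homotopic a b → GenLoop.Homotopic (Φ a) (Φ b)) (i : N) (j : M)
    (h2 : ∀ a b, GenLoop.Homotopic (Φ (GenLoop.transAt i a b)) (GenLoop.transAt j (Φ a) (Φ b))) :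
    HomotopyGroup N X x →* HomotopyGroup M Y y :=
  MonoidHom.mk' (Quotient.map Φ h1) <| by
    intro a b
    induction a using Quotient.inductionOn with | h a => ?_
    induction b using Quotient.inductionOn with | h b => ?_
    have e1 := HomotopyGroup.mul_spec (i := i) (p := a) (q := b)
    have e2 := HomotopyGroup.mul_spec (i := j) (p := Φ a) (q := Φ b)
    simp only at e1 e2
    rw [e1]
    refine Eq.trans ?_ e2.symm
    exact Quotient.sound (h2 b a)

lemma mkHom_surj {x : X} {y : Y} (Φ : Ω^ N X x → Ω^ M Y y) (h1 i j h2)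
    (h : ∀ b, ∃ a, GenLoop.Homotopic (Φ a) b) : Function.Surjective (mkHom Φ h1 i j h2) := by
  intro b
  induction b using Quotient.inductionOn with | h b => ?_
  obtain ⟨a, ha⟩ := h b
  exact ⟨⟦a⟧, Quotient.sound ha⟩

lemma mkHom_inj {x : X} {y : Y} (Φ : Ω^ N X x → Ω^ M Y y) (h1 i j h2)
    (h : ∀ a b, GenLoop.Homotopic (Φ a) (Φ b) → GenLoop.Homotopic a b) :
    Function.Injective (mkHom Φ h1 i j h2) := by
  intro a b
  induction a using Quotient.inductionOn with | h a => ?_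
  induction b using Quotient.inductionOn with | h b => ?_
  intro hab
  exact Quotient.sound (h a b (Quotient.exact hab))

def gmap (F : C(X, Y)) {x : X} {y : Y} (hy : F x = y) (a : Ω^ N X x) : Ω^ N Y y :=
  ⟨F.comp a.1, fun z hz => by
    have := a.2 z hz
    simp only [ContinuousMap.comp_apply]
    rw [this, hy]⟩

lemma gmap_homotopic (F : C(X, Y)) {x : X} {y : Y} (hy : F x = y) (a b : Ω^ N X x)
    (h : GenLoop.Homotopic a b) : GenLoop.Homotopic (gmap F hy a) (gmap F hy b) := by
  rw [Fh_iff] at *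
  obtain ⟨h, h0, h1, h2⟩ := h
  refine ⟨F.comp h, fun x => congrArg F (h0 x), fun x => congrArg F (h1 x), fun y hy t => ?_⟩
  simp only [ContinuousMap.comp_apply]
  rw [h2 y hy]
  exact ‹F x = _›

lemma gmap_transAt (F : C(X, Y)) {x : X} {y : Y} (hy : F x = y) (i : N) (a b : Ω^ N X x) :
    gmap F hy (GenLoop.transAt i a b) = GenLoop.transAt i (gmap F hy a) (gmap F hy b) := by
  ext t
  rw [transAt_apply]
  refine (congrArg F (transAt_apply i a b t)).trans ?_
  split_ifs <;> rfl

lemma pi_basechange [Fintype N] {x x' : X} (h : Joined x x') :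
    Nonempty (HomotopyGroup N X x ≃* HomotopyGroup N X x') := by
  obtain ⟨γ⟩ := h
  obtain ⟨i⟩ : Nonempty N := inferInstance
  have hex : ∀ a : Ω^ N X x, ∃ b : Ω^ N X x', Fh γ.toContinuousMap a.1 b.1 := by
    intro a
    obtain ⟨b, hb⟩ := Fh_exists γ.toContinuousMap a.1 fun y hy => (a.2 y hy).trans γ.source.symm
    refine ⟨⟨b, fun y hy => ?_⟩, hb⟩
    obtain ⟨h, h0, h1, h2⟩ := hb
    rw [<- h1, h2 y hy]
    exact γ.target
  choose Φ hΦ using hex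
  have e0 : (ContinuousMap.const I x) = ContinuousMap.const I (γ.toContinuousMap 0) := by
    congr 1; exact γ.source.symm
  have e1 : (ContinuousMap.const I x') = ContinuousMap.const I (γ.toContinuousMap 1) := by
    congr 1; exact γ.target.symm
  have uq : ∀ a a' : Ω^ N X x, ∀ b b' : Ω^ N X x', Fh γ.toContinuousMap a.1 b.1 → Fh γ.toContinuousMap a'.1 b'.1 →
    GenLoop.Homotopic a a' → GenLoop.Homotopic b b' := by
    intro a a' b b' h h' k
    rw [Fh_iff] at *
    rw [e1]
    rw [e0] at k
    exact Fh_unique h h' k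
  refine ⟨MulEquiv.ofBijective (mkHom Φ (fun a b h => uq _ _ _ _ (hΦ a) (hΦ b) h) i i
    (fun a b => uq _ _ _ _ (hΦ _) (Fh_transAt i (hΦ a) (hΦ b)) (GenLoop.Homotopic.refl _)))
    ⟨mkHom_inj _ _ _ _ _ ?_, mkHom_surj _ _ _ _ _ ?_⟩⟩
  · intro a b h
    rw [Fh_iff] at *
    have h1 := Fh_symm (hΦ a)
    have h2 := Fh_symm (hΦ b)
    have := Fh_unique h1 h2 (by
      have e : (γ.toContinuousMap.comp ⟨unitInterval.symm, by fun_prop⟩ : C(I, X)) 0 = x' := by simp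
      rwa [e])
    have e : (γ.toContinuousMap.comp ⟨unitInterval.symm, by fun_prop⟩ : C(I, X)) 1 = x := by simp
    rwa [e] at this
  · intro b
    obtain ⟨a, ha⟩ := Fh_exists (γ.toContinuousMap.comp ⟨unitInterval.symm, by fun_prop⟩) b.1
      fun y hy => (b.2 y hy).trans (by simp)
    have ha' : ∀ y ∈ Cube.boundary N, a y = x := by
      intro y hy
      obtain ⟨h, h0, h1, h2⟩ := ha
      rw [<- h1, h2 y hy]
      simp
    refine ⟨⟨a, ha'⟩, uq ⟨a, ha'⟩ ⟨a, ha'⟩ _ _ (hΦ _) ?_ (GenLoop.Homotopic.refl _)⟩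
    have := Fh_symm ha
    convert this using 1
    ext t
    simp

lemma gmap_id_bij [Fintype N] (F : C(X, X)) (H : C(X × I, X)) (H0 : ∀ x, H (x, 0) = x) (H1 : ∀ x, H (x, 1) = F x)
    (x : X) : (∀ a b : Ω^ N X x, GenLoop.Homotopic (gmap F rfl a) (gmap F rfl b) → GenLoop.Homotopic a b) ∧
      ∀ b : Ω^ N X (F x), ∃ a : Ω^ N X x, GenLoop.Homotopic (gmap F rfl a) b := by
  let γ : C(I, X) := ⟨fun t => H (x, t), by fun_prop⟩
  have g0 : γ 0 = x := H0 x
  have g1 : γ 1 = F x := H1 x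
  have g0' : (γ.comp ⟨unitInterval.symm, by fun_prop⟩ : C(I, X)) 1 = x := by simpa using g0
  have g1' : (γ.comp ⟨unitInterval.symm, by fun_prop⟩ : C(I, X)) 0 = F x := by simpa using g1
  have key : ∀ a : Ω^ N X x, Fh γ a.1 (gmap F rfl a).1 := fun a =>
    ⟨⟨fun p => H (a.1 p.1, p.2), by fun_prop⟩, fun y => H0 _, fun y => H1 _, fun y hy t => by
      simp only [ContinuousMap.coe_mk, γ]
      rw [a.2 y hy]⟩
  constructor
  · intro a b h
    rw [Fh_iff] at *
    have := Fh_unique (Fh_symm (key a)) (Fh_symm (key b)) (by rwa [g1'])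
    rwa [g0'] at this
  · intro b
    obtain ⟨a, ha⟩ := Fh_exists (γ.comp ⟨unitInterval.symm, by fun_prop⟩) b.1
      fun y hy => (b.2 y hy).trans g1'.symm
    have ha' : ∀ y ∈ Cube.boundary N, a y = x := by
      intro y hy
      obtain ⟨h, h0, h1, h2⟩ := ha
      rw [<- h1, h2 y hy, g0']
    refine ⟨⟨a, ha'⟩, ?_⟩
    have e : ContinuousMap.const I (F x) = ContinuousMap.const I (γ 1) := by rw [g1]
    rw [Fh_iff, e]
    refine Fh_unique (a := a) (a' := a) (key ⟨a, ha'⟩) ?_ ?_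
    · have := Fh_symm ha
      convert this using 1
      ext t
      simp
    · rw [g0]
      exact Fh_iff.1 (GenLoop.Homotopic.refl (⟨a, ha'⟩ : Ω^ N X x))

open ContinuousMap in
lemma pi_equiv [Fintype N] (e : X ≃ₕ Y) (x : X) :
    Nonempty (HomotopyGroup N X x ≃* HomotopyGroup N Y (e x)) := by
  obtain ⟨i⟩ : Nonempty N := inferInstance
  obtain ⟨H⟩ := e.left_inv
  obtain ⟨K⟩ := e.right_inv
  have h1 := fun x => gmap_id_bij (N := N) (e.invFun.comp e.toFun) ⟨fun p => H.symm (p.2, p.1), by fun_prop⟩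
    (fun x => by simp) (fun x => by simp) x
  have h2 := fun x => gmap_id_bij (N := N) (e.toFun.comp e.invFun) ⟨fun p => K.symm (p.2, p.1), by fun_prop⟩
    (fun x => by simp) (fun x => by simp) x
  refine ⟨MulEquiv.ofBijective (mkHom (gmap e.toFun rfl) (gmap_homotopic e.toFun rfl) i i
    (fun a b => by rw [gmap_transAt]))
    ⟨mkHom_inj _ _ _ _ _ ?_, mkHom_surj _ _ _ _ _ ?_⟩⟩
  · intro a b h
    exact (h1 x).1 a b (gmap_homotopic e.invFun rfl _ _ h)
  · intro b
    obtain ⟨a, ha⟩ := (h1 x).2 (gmap e.invFun rfl b)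
    refine ⟨a, (h2 (e x)).1 _ _ ?_⟩
    exact gmap_homotopic e.toFun rfl _ _ ha

end homs
end HopfModel

namespace HopfModel
open scoped unitInterval Topology Topology.Homotopy

section GP
variable {N : Type} [Fintype N] {V : Type} [NormedAddCommGroup V] [NormedSpace ℝ V] [FiniteDimensional ℝ V]

lemma smooth_approx (f : C((N → I) × I, V × ℝ)) (w : V × ℝ) {ε : ℝ} (hε : 0 < ε) :
    ∃ g : (N → ℝ) × ℝ → V × ℝ, ContDiff ℝ 1 g ∧
      (∀ x : (N → I) × I, ‖g (fun j => (x.1 j : ℝ), (x.2 : ℝ)) - f x‖ < ε) ∧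
      ∀ x : (N → I) × I, f x = w → g (fun j => (x.1 j : ℝ), (x.2 : ℝ)) = w := by
  let pr : (N → ℝ) × ℝ → (N → I) × I := fun p => (fun j => Set.projIcc 0 1 zero_le_one (p.1 j), Set.projIcc 0 1 zero_le_one p.2)
  have hpr : Continuous pr := by
    refine Continuous.prodMk (continuous_pi fun j => ?_) ?_
    · exact continuous_projIcc.comp (by fun_prop)
    · exact continuous_projIcc.comp (by fun_prop)
  have hpr2 : ∀ x : (N → I) × I, pr (fun j => (x.1 j : ℝ), (x.2 : ℝ)) = x := fun x => by
    simp [pr]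
  obtain ⟨g, hg, hgf, -⟩ := (f.continuous.comp hpr).exists_contDiff_approx 1 (ε := fun _ => ε / 3)
    continuous_const (fun _ => by positivity)
  let φ : ContDiffBump w := ⟨ε / 3, 2 * ε / 3, by positivity, by linarith⟩
  have hd : ∀ x : (N → I) × I, ‖g (fun j => (x.1 j : ℝ), (x.2 : ℝ)) - f x‖ < ε / 3 := fun x => by
    have := hgf (fun j => (x.1 j : ℝ), (x.2 : ℝ))
    rw [dist_eq_norm] at this
    simpa [hpr2] using this
  refine ⟨fun p => g p + φ (g p) • (w - g p), ?_, fun x => ?_, fun x hx => ?_⟩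
  · have hφ : ContDiff ℝ 1 φ := φ.contDiff
    have hg' : ContDiff ℝ 1 g := hg
    exact hg'.add ((hφ.comp hg').smul (contDiff_const.sub hg'))
  · set z := g (fun j => (x.1 j : ℝ), (x.2 : ℝ)) with hz
    have h1 : ‖φ z • (w - z)‖ ≤ 2 * ε / 3 := by
      by_cases h : dist z w < 2 * ε / 3
      · rw [norm_smul, Real.norm_of_nonneg (φ.nonneg)]
        rw [dist_comm, dist_eq_norm] at h
        calc _ ≤ 1 * ‖w - z‖ := mul_le_mul_of_nonneg_right φ.le_one (norm_nonneg _)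
          _ ≤ _ := by linarith
      · rw [φ.zero_of_le_dist (by exact not_lt.1 h)]
        simp; positivity
    calc _ = ‖(z - f x) + φ z • (w - z)‖ := by congr 1; simp only [<- hz]; abel
      _ ≤ _ := norm_add_le _ _
      _ < ε := by have := hd x; rw [<- hz] at this; linarith
  · have := hd x
    rw [hx] at this
    have e : φ (g (fun j => (x.1 j : ℝ), (x.2 : ℝ))) = 1 := φ.one_of_mem_closedBall (by
      rw [Metric.mem_closedBall, dist_eq_norm]; exact this.le)
    simp only [e, one_smul]
    abel

lemma gen_pos (hN : Fintype.card N + 2 < 2 * Module.finrank ℝ V) (f : C((N → I) × I, V × ℝ)) (w : V)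
    {ε : ℝ} (hε : 0 < ε) :
    ∃ f' : C((N → I) × I, V × ℝ), (∀ x, ‖f' x - f x‖ < ε) ∧ (∀ x, f x = (w, 0) → f' x = (w, 0)) ∧
      ∀ x s t, (f' (x, s)).1 = 0 → 0 < (f' (x, s)).2 → (f' (x, t)).1 = 0 → 0 ≤ (f' (x, t)).2 := by
  obtain ⟨g, hg, hgf, hgw⟩ := smooth_approx f (w, 0) (half_pos hε)
  let D := ((N → ℝ) × ℝ) × ℝ
  let B : Set D := {p | 0 < (g p.1).2 ∧ (g (p.1.1, p.2)).2 < 0}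
  let Φ : D → V × V := fun p => (-((g p.1).2⁻¹ • (g p.1).1), (g (p.1.1, p.2)).2⁻¹ • (g (p.1.1, p.2)).1)
  have hΦ : ∀ p ∈ B, ∃ C : NNReal, ∃ t ∈ 𝓝[B] p, LipschitzOnWith C Φ t := by
    intro p hp
    have : ContDiffAt ℝ 1 Φ p := by
      have h1 : ContDiffAt ℝ 1 (fun p : D => g p.1) p := (hg.comp contDiff_fst).contDiffAt
      have h2 : ContDiffAt ℝ 1 (fun p : D => g (p.1.1, p.2)) p :=
        (hg.comp ((contDiff_fst.comp contDiff_fst).prodMk contDiff_snd)).contDiffAt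
      exact (((h1.snd).inv hp.1.ne').smul h1.fst).neg.prodMk (((h2.snd).inv hp.2.ne).smul h2.fst)
    obtain ⟨K, t, ht, hK⟩ := this.exists_lipschitzOnWith
    exact ⟨K, t, mem_nhdsWithin_of_mem_nhds ht, hK⟩
  have hdim : dimH (Φ '' B) < Module.finrank ℝ (V × V) := by
    refine (dimH_image_le_of_locally_lipschitzOn hΦ).trans_lt ((dimH_mono (Set.subset_univ _)).trans_lt ?_)
    rw [Real.dimH_univ_eq_finrank]
    simp only [D, Module.finrank_prod, Module.finrank_pi, Module.finrank_self]
    norm_cast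
    omega
  have hdense := dense_compl_of_dimH_lt_finrank hdim
  obtain ⟨C, hC⟩ : ∃ C : ℝ, ∀ x : (N → I) × I, abs (g (fun j => (x.1 j : ℝ), (x.2 : ℝ))).2 ≤ C := by
    have hc : Continuous fun x : (N → I) × I => abs (g (fun j => (x.1 j : ℝ), (x.2 : ℝ))).2 := by
      have := hg.continuous
      fun_prop
    obtain ⟨C, hC⟩ := (isCompact_range hc).bddAbove
    exact ⟨C, fun x => hC ⟨x, rfl⟩⟩
  have hC0 : 0 ≤ C := (abs_nonneg _).trans (hC (fun _ => 0, 0))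
  have hδ : 0 < ε / (4 * (C + 1)) := by positivity
  obtain ⟨⟨a, b⟩, hab, hd⟩ := hdense.exists_dist_lt (0 : V × V) hδ
  rw [dist_comm, dist_zero_right] at hd
  have ha : ‖a‖ < ε / (4 * (C + 1)) := (norm_fst_le (a, b)).trans_lt hd
  have hb : ‖b‖ < ε / (4 * (C + 1)) := (norm_snd_le (a, b)).trans_lt hd
  have hab' : ∀ p ∈ B, Φ p ≠ (a, b) := fun p hp h => hab ⟨p, hp, h⟩
  let R : V × ℝ → V × ℝ := fun z => (z.1 + max 0 z.2 • a + max 0 (-z.2) • b, z.2)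
  have hR : Continuous R := by fun_prop
  let ι : (N → I) × I → (N → ℝ) × ℝ := fun x => (fun j => (x.1 j : ℝ), (x.2 : ℝ))
  have hι : Continuous ι := by fun_prop
  refine ⟨⟨fun x => R (g (ι x)), hR.comp (hg.continuous.comp hι)⟩, fun x => ?_, fun x hx => ?_, fun x s t h1 h2 h3 => ?_⟩
  · have e : R (g (ι x)) - f x = (max 0 (g (ι x)).2 • a + max 0 (-(g (ι x)).2) • b, 0) + (g (ι x) - f x) := by
      ext
      · simp [R]; abel
      · simp [R]
    have hm1 : max 0 (g (ι x)).2 ≤ C := max_le hC0 ((le_abs_self _).trans (hC x))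
    have hm2 : max 0 (-(g (ι x)).2) ≤ C := max_le hC0 ((neg_le_abs _).trans (hC x))
    have hn : ‖max 0 (g (ι x)).2 • a + max 0 (-(g (ι x)).2) • b‖ ≤ ε / 2 := by
      have hC1 : C * (ε / (4 * (C + 1))) ≤ ε / 4 := by
        rw [<- mul_div_assoc, div_le_div_iff₀ (by positivity) (by norm_num)]
        nlinarith
      calc _ ≤ ‖max 0 (g (ι x)).2 • a‖ + ‖max 0 (-(g (ι x)).2) • b‖ := norm_add_le _ _
        _ ≤ C * (ε / (4 * (C + 1))) + C * (ε / (4 * (C + 1))) := by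
          rw [norm_smul, norm_smul, Real.norm_of_nonneg (le_max_left _ _), Real.norm_of_nonneg (le_max_left _ _)]
          gcongr
        _ ≤ _ := by linarith
    change ‖R (g (ι x)) - f x‖ < ε
    rw [e]
    refine (norm_add_le _ _).trans_lt ?_
    have h3 : ‖((max 0 (g (ι x)).2 • a + max 0 (-(g (ι x)).2) • b, 0) : V × ℝ)‖ ≤ ε / 2 := by
      rw [Prod.norm_def]
      simpa using hn
    have := hgf x
    change ‖g (ι x) - f x‖ < ε / 2 at this
    linarith
  · change R (g (ι x)) = _
    have := hgw x hx
    change g (ι x) = _ at this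
    rw [this]
    simp [R]
  · simp only [ContinuousMap.coe_mk, R] at h1 h2 h3 ⊢
    by_contra! h4
    rw [max_eq_right h2.le, max_eq_left (by linarith), zero_smul, add_zero] at h1
    rw [max_eq_left h4.le, max_eq_right (by linarith), zero_smul, add_zero] at h3
    refine hab' (ι (x, s), (t : ℝ)) ⟨h2, h4⟩ ?_
    simp only [Φ]
    ext1
    · rw [eq_neg_of_add_eq_zero_left h1, smul_neg, neg_neg, smul_smul, inv_mul_cancel₀ h2.ne', one_smul]
    · change (g (ι (x, t))).2⁻¹ • (g (ι (x, t))).1 = b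
      rw [eq_neg_of_add_eq_zero_left h3, neg_smul, neg_neg, smul_smul, inv_mul_cancel₀ h4.ne, one_smul]

end GP
end HopfModel

namespace HopfModel
open scoped unitInterval Topology Topology.Homotopy

abbrev NZ (V : Type) [NormedAddCommGroup V] := {v : V // v ≠ 0}

section T
variable {N : Type} {V : Type} [NormedAddCommGroup V] [NormedSpace ℝ V]

def up (w : NZ V) : NZ (V × ℝ) := ⟨(w.1, 0), fun h => w.2 (congrArg Prod.fst h)⟩

structure BC (w : NZ V) (f : (N → I) × I → V × ℝ) : Prop where
  c : Continuous f
  nz : ∀ p, f p ≠ 0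
  b : ∀ x s, (x ∈ Cube.boundary N ∨ s = 0 ∨ s = 1) → f (x, s) = (w.1, 0)

def ofBC {w : NZ V} {f : (N → I) × I → V × ℝ} (hf : BC w f) : Ω^ (Option N) (NZ (V × ℝ)) (up w) :=
  ⟨⟨fun p => ⟨f (fun j => p (some j), p none), hf.nz _⟩, by
    have := hf.c
    exact Continuous.subtype_mk (by fun_prop) _⟩, by
    rintro y ⟨j, hj⟩
    apply Subtype.ext
    refine hf.b _ _ ?_
    cases j with
    | none => exact Or.inr hj
    | some j => exact Or.inl ⟨j, hj⟩⟩

lemma ofBC_homotopic {w : NZ V} (F : ((N → I) × I) × I → V × ℝ) (hF : Continuous F)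
    (h : ∀ r, BC w fun p => F (p, r)) : GenLoop.Homotopic (ofBC (h 0)) (ofBC (h 1)) := by
  rw [Fh_iff]
  refine ⟨⟨fun p => ofBC (h p.2) p.1, ?_⟩, fun x => rfl, fun x => rfl, fun y hy t => GenLoop.boundary (ofBC (h t)) y hy⟩
  exact Continuous.subtype_mk (f := fun p : (Option N → I) × I => F ((fun j => p.1 (some j), p.1 none), p.2))
    (hF.comp (by fun_prop)) _

lemma ofBC_straight {w : NZ V} {f g : (N → I) × I → V × ℝ} (hf : BC w f) (hg : BC w g)
    (h : ∀ p (r : I), (1 - (r : ℝ)) • f p + (r : ℝ) • g p ≠ 0) : GenLoop.Homotopic (ofBC hf) (ofBC hg) := by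
  have hc := hf.c
  have hc' := hg.c
  have hr : ∀ r : I, BC w fun p => (1 - (r : ℝ)) • f p + (r : ℝ) • g p := fun r =>
    ⟨by fun_prop, fun p => h p r, fun x s hx => by
      simp only [hf.b x s hx, hg.b x s hx, <- add_smul]; simp⟩
  have := ofBC_homotopic (w := w) (fun q => (1 - (q.2 : ℝ)) • f q.1 + (q.2 : ℝ) • g q.1) (by fun_prop) hr
  convert this using 2 <;> simp

lemma exists_ofBC {w : NZ V} (a : Ω^ (Option N) (NZ (V × ℝ)) (up w)) :
    ∃ (f : (N → I) × I → V × ℝ) (hf : BC w f), ofBC hf = a := by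
  let e : (N → I) × I → Option N → I := fun p j => j.elim p.2 p.1
  have he : Continuous e := by
    refine continuous_pi fun j => ?_
    cases j <;> simp only [e, Option.elim] <;> fun_prop
  refine ⟨fun p => (a (e p)).1, ⟨?_, fun p => (a (e p)).2, fun x s h => ?_⟩, ?_⟩
  · exact continuous_subtype_val.comp (a.1.continuous.comp he)
  · rw [GenLoop.boundary a]
    · rfl
    · rcases h with ⟨j, hj⟩ | h
      · exact ⟨some j, hj⟩
      · exact ⟨none, h⟩
  · ext p : 1
    change a (e _) = a p
    congr 1
    ext j
    cases j <;> rfl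

noncomputable def ta (s : ℝ) : ℝ := min (2 * s) (2 - 2 * s)

noncomputable def tf (w v : V) (s : ℝ) : V × ℝ :=
  ((1 - ta s) • w + ta s • v, (2 * s - 1) * (ta s * ‖v - w‖))

lemma ta_half : ta (1 / 2) = 1 := by simp [ta]; norm_num

lemma ta_zero : ta 0 = 0 := by simp [ta]

lemma ta_one : ta 1 = 0 := by simp [ta]

lemma ta_cont : Continuous ta := by unfold ta; fun_prop

lemma ta_nonneg {s : ℝ} (h0 : 0 ≤ s) (h1 : s ≤ 1) : 0 ≤ ta s := le_min (by linarith) (by linarith)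

lemma tf_cont : Continuous fun p : V × V × ℝ => tf p.1 p.2.1 p.2.2 := by
  have := ta_cont
  unfold tf
  fun_prop

lemma tf_pos {w v : V} (hw : w ≠ 0) (hv : v ≠ 0) (s : I) (h : (tf w v s).1 = 0) :
    (s : ℝ) ≠ 1 / 2 ∧ 0 < ta s * ‖v - w‖ := by
  have h0 := ta_nonneg s.2.1 s.2.2
  refine ⟨fun e => ?_, lt_of_le_of_ne (by positivity) fun e => ?_⟩
  · rw [e] at h
    simp only [tf, ta_half] at h
    simp [hv] at h
  · rcases mul_eq_zero.1 e.symm with e | e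
    · simp [tf, e, hw] at h
    · rw [norm_eq_zero, sub_eq_zero] at e
      subst e
      simp only [tf, <- add_smul] at h
      simp [hw] at h

def SEP (τ : (N → I) → I) (f : (N → I) × I → V × ℝ) : Prop :=
  ∀ x s, (s ≤ τ x → (f (x, s)).1 = 0 → (f (x, s)).2 < 0) ∧ (τ x ≤ s → (f (x, s)).1 = 0 → 0 < (f (x, s)).2)

noncomputable def hI : I := ⟨1 / 2, by norm_num, by norm_num⟩

lemma le_hI (s : I) : s ≤ hI ↔ (s : ℝ) ≤ 1 / 2 := Iff.rfl

lemma hI_le (s : I) : hI ≤ s ↔ 1 / 2 ≤ (s : ℝ) := Iff.rfl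

noncomputable def Tf {w : NZ V} (β : Ω^ N (NZ V) w) : (N → I) × I → V × ℝ := fun p => tf w.1 (β p.1).1 p.2

lemma Tf_SEP {w : NZ V} (β : Ω^ N (NZ V) w) : SEP (fun _ => hI) (Tf β) := by
  intro x s
  constructor
  · intro hs h
    obtain ⟨h1, h2⟩ := tf_pos w.2 (β x).2 s h
    rw [le_hI] at hs
    have := lt_of_le_of_ne hs h1
    exact mul_neg_of_neg_of_pos (by linarith) h2
  · intro hs h
    obtain ⟨h1, h2⟩ := tf_pos w.2 (β x).2 s h
    rw [hI_le] at hs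
    have := lt_of_le_of_ne hs h1.symm
    exact mul_pos (by linarith) h2

lemma Tf_BC {w : NZ V} (β : Ω^ N (NZ V) w) : BC w (Tf β) where
  c := by
    have h2 : Continuous fun p : (N → I) × I => (β p.1).1 :=
      continuous_subtype_val.comp (β.1.continuous.comp continuous_fst)
    exact tf_cont.comp (f := fun p : (N → I) × I => (w.1, (β p.1).1, (p.2 : ℝ))) (by fun_prop)
  nz p h := by
    have h1 := Tf_SEP β p.1 p.2
    have e1 : (Tf β (p.1, p.2)).1 = 0 := by rw [h]; rfl
    have e2 : (Tf β (p.1, p.2)).2 = 0 := by rw [h]; rfl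
    rcases le_total p.2 hI with h3 | h3
    · exact (h1.1 h3 e1).ne e2
    · exact (h1.2 h3 e1).ne' e2
  b x s h := by
    rcases h with h | rfl | rfl
    · have := GenLoop.boundary β x h
      simp only [Tf, this, tf, <- add_smul]
      simp
    · simp [Tf, tf, ta_zero]
    · simp [Tf, tf, ta_one]

noncomputable def T {w : NZ V} (β : Ω^ N (NZ V) w) : Ω^ (Option N) (NZ (V × ℝ)) (up w) := ofBC (Tf_BC β)

lemma T_homotopic {w : NZ V} (β β' : Ω^ N (NZ V) w) (h : GenLoop.Homotopic β β') :
    GenLoop.Homotopic (T β) (T β') := by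
  rw [Fh_iff] at h
  obtain ⟨h, h0, h1, h2⟩ := h
  let B : I → Ω^ N (NZ V) w := fun r => ⟨⟨fun x => h (x, r), by fun_prop⟩, fun y hy => h2 y hy r⟩
  have := ofBC_homotopic (w := w) (fun q => Tf (B q.2) q.1) (by
    have h2 : Continuous fun p : ((N → I) × I) × I => (h (p.1.1, p.2)).1 :=
      continuous_subtype_val.comp (h.continuous.comp (by fun_prop))
    exact tf_cont.comp (f := fun p : ((N → I) × I) × I => (w.1, (h (p.1.1, p.2)).1, (p.1.2 : ℝ))) (by fun_prop))
    (fun r => Tf_BC (B r))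
  have e0 : B 0 = β := by ext x : 1; exact h0 x
  have e1 : B 1 = β' := by ext x : 1; exact h1 x
  simp only [e0, e1] at this
  exact this

lemma T_transAt [DecidableEq N] {w : NZ V} (i : N) (β β' : Ω^ N (NZ V) w) :
    T (GenLoop.transAt i β β') = GenLoop.transAt (some i) (T β) (T β') := by
  ext p : 1
  rw [transAt_apply]
  apply Subtype.ext
  change tf w.1 (GenLoop.transAt i β β' fun j => p (some j)).1 (p none) = _
  rw [transAt_apply]
  have key : ∀ u : I, (fun j => Function.update p (some i) u (some j)) = Function.update (fun j => p (some j)) i u := by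
    intro u
    ext j
    by_cases h : j = i
    · subst h; simp
    · simp [h]
  split_ifs with h
  · rw [<- key]
    change _ = tf _ _ _
    simp
  · rw [<- key]
    change _ = tf _ _ _
    simp

def mid {w : NZ V} {f : (N → I) × I → V × ℝ} (hf : BC w f) (τ : C(N → I, I)) (hτ : SEP τ f) : Ω^ N (NZ V) w :=
  ⟨⟨fun x => ⟨(f (x, τ x)).1, fun h => by
    have h1 := (hτ x (τ x)).1 le_rfl h
    have h2 := (hτ x (τ x)).2 le_rfl h
    linarith⟩, by
    have := hf.c
    exact Continuous.subtype_mk (by fun_prop) _⟩, fun y hy => Subtype.ext (by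
      change (f _).1 = _
      rw [hf.b y _ (Or.inl hy)])⟩

noncomputable def rep (u s : I) : I := ⟨(u : ℝ) * min (2 * (s : ℝ)) 1 + (1 - (u : ℝ)) * max (2 * (s : ℝ) - 1) 0, by
  have := u.2.1; have := u.2.2; have := s.2.1; have := s.2.2
  constructor
  · have : 0 ≤ min (2 * (s : ℝ)) 1 := le_min (by linarith) (by norm_num)
    have : 0 ≤ max (2 * (s : ℝ) - 1) 0 := le_max_right _ _
    have : 0 ≤ 1 - (u : ℝ) := by linarith
    positivity
  · have : min (2 * (s : ℝ)) 1 ≤ 1 := min_le_right _ _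
    have : max (2 * (s : ℝ) - 1) 0 ≤ 1 := max_le (by linarith) (by norm_num)
    nlinarith⟩

lemma rep_cont : Continuous fun p : I × I => rep p.1 p.2 := by
  unfold rep
  fun_prop

lemma rep_le {u s : I} (h : s ≤ hI) : rep u s ≤ u := by
  rw [le_hI] at h
  have : max (2 * (s : ℝ) - 1) 0 = 0 := max_eq_right (by linarith)
  have h2 : min (2 * (s : ℝ)) 1 ≤ 1 := min_le_right _ _
  have := u.2.1
  rw [<- Subtype.coe_le_coe]
  simp only [rep, *]
  nlinarith

lemma le_rep {u s : I} (h : hI ≤ s) : u ≤ rep u s := by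
  rw [hI_le] at h
  have h2 : min (2 * (s : ℝ)) 1 = 1 := min_eq_right (by linarith)
  have h3 : 0 ≤ max (2 * (s : ℝ) - 1) 0 := le_max_right _ _
  have := u.2.2
  rw [<- Subtype.coe_le_coe]
  simp only [rep, h2]
  nlinarith

lemma rep_half (u : I) : rep u hI = u := by
  ext; simp [rep, hI]

lemma rep_zero (u : I) : rep u 0 = 0 := by
  ext; simp [rep]

lemma rep_one (u : I) : rep u 1 = 1 := by
  ext; simp [rep]; norm_num

noncomputable def lerpI (r a b : I) : I := ⟨(1 - r) * a + r * b, by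
  have := a.2.1; have := a.2.2; have := b.2.1; have := b.2.2; have := r.2.1; have := r.2.2
  have : 0 ≤ 1 - (r : ℝ) := by linarith
  constructor
  · positivity
  · nlinarith⟩

lemma lerpI_cont : Continuous fun p : I × I × I => lerpI p.1 p.2.1 p.2.2 := by
  unfold lerpI; fun_prop

lemma lerpI_zero (a b : I) : lerpI 0 a b = a := by ext; simp [lerpI]

lemma lerpI_one (a b : I) : lerpI 1 a b = b := by ext; simp [lerpI]

lemma lerpI_self (r a : I) : lerpI r a a = a := by ext; simp [lerpI]; ring

lemma le_lerpI {r a b c : I} (h : c ≤ a) (h' : c ≤ b) : c ≤ lerpI r a b := by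
  rw [<- Subtype.coe_le_coe] at *
  have := r.2.1; have := r.2.2
  simp only [lerpI]
  nlinarith

lemma lerpI_le {r a b c : I} (h : a ≤ c) (h' : b ≤ c) : lerpI r a b ≤ c := by
  rw [<- Subtype.coe_le_coe] at *
  have := r.2.1; have := r.2.2
  simp only [lerpI]
  nlinarith

lemma ofBC_mid {w : NZ V} {f : (N → I) × I → V × ℝ} (hf : BC w f) (τ : C(N → I, I)) (hτ : SEP τ f) :
    GenLoop.Homotopic (ofBC hf) (T (mid hf τ hτ)) := by
  have hc := hf.c
  have hrc := rep_cont
  have hlc := lerpI_cont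
  have b1 : ∀ r : I, BC w fun p : (N → I) × I => f (p.1, lerpI r p.2 (rep (τ p.1) p.2)) := fun r => by
    refine ⟨?_, fun p => hf.nz _, fun x s h => hf.b _ _ ?_⟩
    · exact hc.comp (continuous_fst.prodMk (hlc.comp (continuous_const.prodMk (continuous_snd.prodMk
        (hrc.comp ((τ.continuous.comp continuous_fst).prodMk continuous_snd))))))
    · rcases h with h | rfl | rfl
      · exact Or.inl h
      · right; left; simp only [rep_zero]; exact lerpI_self _ _
      · right; right; simp only [rep_one]; exact lerpI_self _ _
  have s1 := ofBC_homotopic (w := w) (fun q => f (q.1.1, lerpI q.2 q.1.2 (rep (τ q.1.1) q.1.2)))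
    (hc.comp ((continuous_fst.comp continuous_fst).prodMk (hlc.comp (continuous_snd.prodMk
      ((continuous_snd.comp continuous_fst).prodMk
        (hrc.comp ((τ.continuous.comp (continuous_fst.comp continuous_fst)).prodMk (continuous_snd.comp continuous_fst)))))))) b1
  simp only [lerpI_zero, lerpI_one] at s1
  set g : (N → I) × I → V × ℝ := fun p => f (p.1, rep (τ p.1) p.2) with hg
  have gbc : BC w g := by have := b1 1; simpa only [lerpI_one] using this
  have gc := gbc.c
  have gs : SEP (fun _ => hI) g := fun x s => ⟨fun h => (hτ x _).1 (rep_le h), fun h => (hτ x _).2 (le_rep h)⟩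
  have gm : ∀ x, (g (x, hI)).1 = (mid hf τ hτ x).1 := fun x => by simp only [g, rep_half]; rfl
  let k : (N → I) × I → V × ℝ := fun p => ((g p).1, (2 * p.2 - 1) * ‖(g p).1 - w.1‖)
  have aux : ∀ x (s : I), (g (x, s)).1 = 0 → (s : ℝ) ≠ 1 / 2 := by
    intro x s h e
    have := gs x s
    have h1 := this.1 e.le h
    have h2 := this.2 e.ge h
    linarith
  have hw := norm_pos_iff.2 w.2
  have kbc : BC w k := by
    refine ⟨by fun_prop, fun p h => ?_, fun x s h => ?_⟩
    · have e1 : (g p).1 = 0 := congrArg Prod.fst h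
      have e2 : (2 * (p.2 : ℝ) - 1) * ‖(g p).1 - w.1‖ = 0 := congrArg Prod.snd h
      rw [e1, zero_sub, norm_neg] at e2
      have := aux p.1 p.2 e1
      rcases mul_eq_zero.1 e2 with e | e
      · exact this (by linarith)
      · exact hw.ne' e
    · simp only [k, gbc.b x s h]
      simp
  have s2 : GenLoop.Homotopic (ofBC gbc) (ofBC kbc) := by
    refine ofBC_straight _ _ fun p r h => ?_
    have e1 : (1 - (r : ℝ)) • (g p).1 + (r : ℝ) • (g p).1 = 0 := congrArg Prod.fst h
    have e2 : (1 - (r : ℝ)) * (g p).2 + (r : ℝ) * ((2 * (p.2 : ℝ) - 1) * ‖(g p).1 - w.1‖) = 0 := congrArg Prod.snd h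
    rw [<- add_smul, sub_add_cancel, one_smul] at e1
    rw [e1, zero_sub, norm_neg] at e2
    have h3 := aux p.1 p.2 e1
    have r0 := r.2.1
    have r1 := r.2.2
    have r1' : 0 ≤ 1 - (r : ℝ) := by linarith
    rcases lt_or_gt_of_ne h3 with h4 | h4
    · have h5 : (g p).2 < 0 := (gs p.1 p.2).1 h4.le e1
      have h6 : (2 * (p.2 : ℝ) - 1) * ‖w.1‖ < 0 := mul_neg_of_neg_of_pos (by linarith) hw
      rcases eq_or_lt_of_le r0 with r0 | r0
      · rw [<- r0] at e2; simp at e2; linarith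
      · nlinarith
    · have h5 : 0 < (g p).2 := (gs p.1 p.2).2 h4.le e1
      have h6 : 0 < (2 * (p.2 : ℝ) - 1) * ‖w.1‖ := mul_pos (by linarith) hw
      rcases eq_or_lt_of_le r0 with r0 | r0
      · rw [<- r0] at e2; simp at e2; linarith
      · nlinarith
  have s3 : GenLoop.Homotopic (ofBC kbc) (T (mid hf τ hτ)) := by
    refine ofBC_straight _ _ fun p r h => ?_
    set b := (mid hf τ hτ p.1).1 with hb
    have hb0 : b ≠ 0 := (mid hf τ hτ p.1).2
    have e1 : (1 - (r : ℝ)) • (g p).1 + (r : ℝ) • ((1 - ta p.2) • w.1 + ta p.2 • b) = 0 := congrArg Prod.fst h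
    have e2 : (1 - (r : ℝ)) * ((2 * (p.2 : ℝ) - 1) * ‖(g p).1 - w.1‖) +
      (r : ℝ) * ((2 * (p.2 : ℝ) - 1) * (ta p.2 * ‖b - w.1‖)) = 0 := congrArg Prod.snd h
    by_cases hs : (p.2 : ℝ) = 1 / 2
    · rw [hs, ta_half] at e1
      have hp : p = (p.1, hI) := by
        ext1
        · rfl
        · ext; exact hs
      rw [hp, gm, <- hb] at e1
      simp only [sub_self, zero_smul, zero_add, one_smul, <- add_smul] at e1
      simp at e1
      exact hb0 e1
    · have e3 : (1 - (r : ℝ)) * ‖(g p).1 - w.1‖ + (r : ℝ) * (ta p.2 * ‖b - w.1‖) = 0 := by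
        have h1 : (2 * (p.2 : ℝ) - 1) ≠ 0 := fun h => hs (by linarith)
        apply mul_left_cancel₀ h1
        linarith
      have r0 := r.2.1
      have r1 := r.2.2
      have r1' : 0 ≤ 1 - (r : ℝ) := by linarith
      have ht := ta_nonneg p.2.2.1 p.2.2.2
      have q1 : 0 ≤ (1 - (r : ℝ)) * ‖(g p).1 - w.1‖ := by positivity
      have q2 : 0 ≤ (r : ℝ) * (ta p.2 * ‖b - w.1‖) := by positivity
      have z1 : (1 - (r : ℝ)) • ((g p).1 - w.1) = 0 := by
        rw [<- norm_eq_zero, norm_smul, Real.norm_of_nonneg r1']; linarith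
      have z2 : (r : ℝ) • (ta p.2 • (b - w.1)) = 0 := by
        rw [<- norm_eq_zero, norm_smul, norm_smul, Real.norm_of_nonneg r0, Real.norm_of_nonneg ht]; linarith
      apply w.2
      have : (1 - (r : ℝ)) • (g p).1 + (r : ℝ) • ((1 - ta p.2) • w.1 + ta p.2 • b) =
        w.1 + (1 - (r : ℝ)) • ((g p).1 - w.1) + (r : ℝ) • (ta p.2 • (b - w.1)) := by module
      rw [e1, z1, z2] at this
      simpa using this.symm
  exact (s1.trans s2).trans s3

end T
end HopfModel

namespace HopfModel
open scoped unitInterval Topology Topology.Homotopy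

section T3
variable {N : Type} [Fintype N] {V : Type} [NormedAddCommGroup V] [NormedSpace ℝ V]

lemma nz_homotopic {w : NZ V} (a b : Ω^ N (NZ V) w) (F : (N → I) × I → V) (hF : Continuous F)
    (nz : ∀ p, F p ≠ 0) (hb : ∀ y ∈ Cube.boundary N, ∀ t, F (y, t) = w.1)
    (h0 : ∀ x, F (x, 0) = (a x).1) (h1 : ∀ x, F (x, 1) = (b x).1) : GenLoop.Homotopic a b := by
  rw [Fh_iff]
  exact ⟨⟨fun p => ⟨F p, nz p⟩, hF.subtype_mk _⟩, fun x => Subtype.ext (h0 x), fun x => Subtype.ext (h1 x),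
    fun y hy t => Subtype.ext (hb y hy t)⟩

lemma pos_min {X : Type} [TopologicalSpace X] {K : Set X} (hK : IsCompact K) (f : X → ℝ) (hf : Continuous f)
    (h : ∀ x ∈ K, 0 < f x) : ∃ m > 0, ∀ x ∈ K, m ≤ f x := by
  rcases K.eq_empty_or_nonempty with rfl | hne
  · exact ⟨1, one_pos, by simp⟩
  · obtain ⟨x, hx, hm⟩ := hK.exists_isMinOn hne hf.continuousOn
    exact ⟨f x, h x hx, fun y hy => hm hy⟩

lemma sep_exists (f : C((N → I) × I, V × ℝ)) (nz : ∀ p, f p ≠ 0) (n0 : ∀ x, (f (x, 0)).1 ≠ 0)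
    (n1 : ∀ x, (f (x, 1)).1 ≠ 0)
    (gp : ∀ x s t, (f (x, s)).1 = 0 → 0 < (f (x, s)).2 → (f (x, t)).1 = 0 → 0 ≤ (f (x, t)).2) :
    ∃ τ : C(N → I, I), SEP τ f := by
  let A : Set (N → I) := Prod.fst '' (Set.ofPred fun p : (N → I) × I => (f p).1 = 0 ∧ 0 ≤ (f p).2)
  let B : Set (N → I) := Prod.fst '' (Set.ofPred fun p : (N → I) × I => (f p).1 = 0 ∧ (f p).2 ≤ 0)
  have cA : IsClosed A := by
    apply IsCompact.isClosed
    apply IsCompact.image _ continuous_fst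
    apply IsClosed.isCompact
    exact (isClosed_eq (f := fun p => (f p).1) (by fun_prop) continuous_const).inter (isClosed_le (g := fun p => (f p).2) continuous_const (by fun_prop))
  have cB : IsClosed B := by
    apply IsCompact.isClosed
    apply IsCompact.image _ continuous_fst
    apply IsClosed.isCompact
    exact (isClosed_eq (f := fun p => (f p).1) (by fun_prop) continuous_const).inter (isClosed_le (f := fun p => (f p).2) (by fun_prop) continuous_const)
  have ne : ∀ p, (f p).1 = 0 → (f p).2 ≠ 0 := fun p h1 h2 => nz p (Prod.ext h1 h2)
  have dj : Disjoint A B := by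
    rw [Set.disjoint_left]
    rintro x ⟨⟨x, s⟩, ⟨h1, h2⟩, rfl⟩ ⟨⟨x', t⟩, ⟨h3, h4⟩, h5⟩
    simp only at h5
    subst h5
    have := lt_of_le_of_ne h2 (ne _ h1).symm
    have := gp _ s t h1 this h3
    exact ne _ h3 (le_antisymm h4 this)
  obtain ⟨g, g0, g1, g2⟩ := exists_continuous_zero_one_of_isClosed cA cB dj
  refine ⟨⟨fun x => ⟨g x, g2 x⟩, by fun_prop⟩, fun x s => ⟨fun h1 h2 => ?_, fun h1 h2 => ?_⟩⟩
  · by_contra h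
    have hx : g x = 0 := g0 ⟨(x, s), ⟨h2, not_lt.1 h⟩, rfl⟩
    have : s = 0 := le_antisymm (h1.trans (Subtype.coe_le_coe.1 hx.le)) s.2.1
    subst this
    exact n0 x h2
  · by_contra h
    have hx : g x = 1 := g1 ⟨(x, s), ⟨h2, not_lt.1 h⟩, rfl⟩
    have : s = 1 := le_antisymm s.2.2 (le_trans (show (1 : I) ≤ ⟨g x, g2 x⟩ from hx.ge) h1)
    subst this
    exact n1 x h2

lemma T_surj [FiniteDimensional ℝ V] (hN : Fintype.card N + 2 < 2 * Module.finrank ℝ V) {w : NZ V}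
    (a : Ω^ (Option N) (NZ (V × ℝ)) (up w)) : ∃ β : Ω^ N (NZ V) w, GenLoop.Homotopic (T β) a := by
  obtain ⟨f, hf, rfl⟩ := exists_ofBC a
  obtain ⟨m, m0, hm⟩ := pos_min (K := Set.univ) isCompact_univ (fun p => ‖f p‖) hf.c.norm
    (fun p _ => norm_pos_iff.2 (hf.nz p))
  obtain ⟨f', h1, h2, h3⟩ := gen_pos hN ⟨f, hf.c⟩ w.1 m0
  have far : ∀ p (z : V × ℝ), ‖z - f p‖ < m → z ≠ 0 := by
    rintro p z h rfl
    have := hm p trivial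
    simp at h
    linarith
  have bc : BC w f' := ⟨f'.continuous, fun p => far p _ (h1 p), fun x s h => h2 _ (hf.b x s h)⟩
  obtain ⟨τ, hτ⟩ := sep_exists f' bc.nz (fun x => by rw [bc.b x 0 (by simp)]; exact w.2)
    (fun x => by rw [bc.b x 1 (by simp)]; exact w.2) h3
  refine ⟨mid bc τ hτ, GenLoop.Homotopic.trans (GenLoop.Homotopic.symm (ofBC_mid bc τ hτ)) ?_⟩
  refine ofBC_straight bc hf fun p r => far p _ ?_
  have : (1 - (r : ℝ)) • f' p + (r : ℝ) • f p - f p = (1 - (r : ℝ)) • (f' p - f p) := by module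
  rw [this, norm_smul, Real.norm_of_nonneg (by linarith [r.2.2])]
  have := h1 p
  simp only [ContinuousMap.coe_mk] at this
  nlinarith [r.2.1, norm_nonneg (f' p - f p)]

lemma main3 {w : NZ V} {f : (N → I) × I → V × ℝ} (hf : BC w f) (hs : SEP (fun _ => hI) f) :
    ∃ m > 0, ∀ (Q : (N → I) × I → V × ℝ) (hQ : BC w Q) (τ : C(N → I, I)) (hτ : SEP τ Q),
      (∀ p, ‖Q p - f p‖ < m) → GenLoop.Homotopic (mid hQ τ hτ) (mid hf (ContinuousMap.const _ hI) hs) := by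
  have fc := hf.c
  obtain ⟨m1, p1, hm1⟩ := pos_min (K := (Set.ofPred fun p : (N → I) × I => p.2 ≤ hI))
    (isClosed_le (by fun_prop) (by fun_prop)).isCompact (fun p => max ‖(f p).1‖ (-(f p).2)) (by fun_prop) (by
      intro p hp
      by_cases h : (f p).1 = 0
      · exact lt_max_of_lt_right (by have := (hs p.1 p.2).1 hp h; simpa using this)
      · exact lt_max_of_lt_left (norm_pos_iff.2 h))
  obtain ⟨m2, p2, hm2⟩ := pos_min (K := (Set.ofPred fun p : (N → I) × I => hI ≤ p.2))
    (isClosed_le (by fun_prop) (by fun_prop)).isCompact (fun p => max ‖(f p).1‖ ((f p).2)) (by fun_prop) (by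
      intro p hp
      by_cases h : (f p).1 = 0
      · exact lt_max_of_lt_right (by have := (hs p.1 p.2).2 hp h; simpa using this)
      · exact lt_max_of_lt_left (norm_pos_iff.2 h))
  refine ⟨min m1 m2, lt_min p1 p2, fun Q hQ τ hτ hd => ?_⟩
  have c1 : ∀ p : (N → I) × I, p.2 ≤ hI → ∀ z : V × ℝ, ‖z - f p‖ < min m1 m2 → z.1 = 0 → z.2 < 0 := by
    intro p hp z hz hz1
    have h0 := lt_of_lt_of_le hz (min_le_left _ _)
    have h1 := (norm_fst_le (z - f p)).trans_lt h0
    have h2 := (norm_snd_le (z - f p)).trans_lt h0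
    have h3 := hm1 p hp
    simp only [Prod.fst_sub, hz1, zero_sub, norm_neg] at h1
    rcases le_max_iff.1 h3 with h3 | h3
    · linarith
    · rw [Real.norm_eq_abs, abs_lt] at h2
      simp only [Prod.snd_sub] at h2
      linarith
  have c2 : ∀ p : (N → I) × I, hI ≤ p.2 → ∀ z : V × ℝ, ‖z - f p‖ < min m1 m2 → z.1 = 0 → 0 < z.2 := by
    intro p hp z hz hz1
    have h0 := lt_of_lt_of_le hz (min_le_right _ _)
    have h1 := (norm_fst_le (z - f p)).trans_lt h0
    have h2 := (norm_snd_le (z - f p)).trans_lt h0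
    have h3 := hm2 p hp
    simp only [Prod.fst_sub, hz1, zero_sub, norm_neg] at h1
    rcases le_max_iff.1 h3 with h3 | h3
    · linarith
    · rw [Real.norm_eq_abs, abs_lt] at h2
      simp only [Prod.snd_sub] at h2
      linarith
  have Qc := hQ.c
  have hlc := lerpI_cont
  let mQ : Ω^ N (NZ V) w := ⟨⟨fun x => ⟨(Q (x, hI)).1, fun h => by
    have h1 := c1 (x, hI) le_rfl _ (hd _) h
    have h2 := c2 (x, hI) le_rfl _ (hd _) h
    linarith⟩, Continuous.subtype_mk (by fun_prop) _⟩, fun y hy => Subtype.ext (by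
      change (Q _).1 = _
      rw [hQ.b y _ (Or.inl hy)])⟩
  have s1 : GenLoop.Homotopic (mid hQ τ hτ) mQ := by
    refine nz_homotopic _ _ (fun p => (Q (p.1, lerpI p.2 (τ p.1) hI)).1) ?_ ?_ ?_ ?_ ?_
    · exact continuous_fst.comp (Qc.comp (continuous_fst.prodMk (hlc.comp (continuous_snd.prodMk
        ((τ.continuous.comp continuous_fst).prodMk continuous_const)))))
    · intro p h
      rcases le_total (τ p.1) hI with h1 | h1
      · have h2 := (hτ p.1 _).2 (le_lerpI (r := p.2) le_rfl h1) h
        have h3 := c1 (p.1, lerpI p.2 (τ p.1) hI) (lerpI_le h1 le_rfl) _ (hd _) h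
        linarith
      · have h2 := (hτ p.1 _).1 (lerpI_le (r := p.2) le_rfl h1) h
        have h3 := c2 (p.1, lerpI p.2 (τ p.1) hI) (le_lerpI h1 le_rfl) _ (hd _) h
        linarith
    · intro y hy t
      simp only [hQ.b y _ (Or.inl hy)]
    · intro x; simp only [lerpI_zero]; rfl
    · intro x; simp only [lerpI_one]; rfl
  refine s1.trans ?_
  refine nz_homotopic _ _ (fun p => ((1 - (p.2 : ℝ)) • Q (p.1, hI) + (p.2 : ℝ) • f (p.1, hI)).1) (by fun_prop) ?_ ?_ ?_ ?_
  · intro p h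
    have h0 : ‖((1 - (p.2 : ℝ)) • Q (p.1, hI) + (p.2 : ℝ) • f (p.1, hI)) - f (p.1, hI)‖ < min m1 m2 := by
      have : (1 - (p.2 : ℝ)) • Q (p.1, hI) + (p.2 : ℝ) • f (p.1, hI) - f (p.1, hI) = (1 - (p.2 : ℝ)) • (Q (p.1, hI) - f (p.1, hI)) := by module
      rw [this, norm_smul, Real.norm_of_nonneg (by linarith [p.2.2.2])]
      have := hd (p.1, hI)
      nlinarith [p.2.2.1, norm_nonneg (Q (p.1, hI) - f (p.1, hI))]
    have h1 := c1 (p.1, hI) le_rfl _ h0 h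
    have h2 := c2 (p.1, hI) le_rfl _ h0 h
    linarith
  · intro y hy t
    simp only [hQ.b y _ (Or.inl hy), hf.b y _ (Or.inl hy), <- add_smul]
    simp
  · intro x; simp [mQ]; rfl
  · intro x; simp; rfl

lemma mid_Tf {w : NZ V} (β : Ω^ N (NZ V) w) : mid (Tf_BC β) (ContinuousMap.const _ hI) (Tf_SEP β) = β := by
  ext x : 1
  apply Subtype.ext
  change (1 - ta (1 / 2)) • w.1 + ta (1 / 2) • (β x).1 = _
  rw [ta_half]; simp

lemma T_inj [FiniteDimensional ℝ V] (hN : Fintype.card N + 3 < 2 * Module.finrank ℝ V) {w : NZ V}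
    (β β' : Ω^ N (NZ V) w) (h : GenLoop.Homotopic (T β) (T β')) : GenLoop.Homotopic β β' := by
  rw [Fh_iff] at h
  obtain ⟨F, F0, F1, F2⟩ := h
  let e : (Option N → I) × I → Option N → I := fun p j => j.elim p.2 (fun j => p.1 (some j))
  have he : Continuous e := by
    refine continuous_pi fun j => ?_
    cases j <;> simp only [e, Option.elim] <;> fun_prop
  let f : C((Option N → I) × I, V × ℝ) := ⟨fun p => (F (e p, p.1 none)).1, by fun_prop⟩
  have fnz : ∀ p, f p ≠ 0 := fun p => (F (e p, p.1 none)).2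
  obtain ⟨m, m0, hm⟩ := pos_min (K := Set.univ) isCompact_univ (fun p => ‖f p‖) f.continuous.norm
    (fun p _ => norm_pos_iff.2 (fnz p))
  obtain ⟨m1, m10, hm1⟩ := main3 (Tf_BC β) (Tf_SEP β)
  obtain ⟨m2, m20, hm2⟩ := main3 (Tf_BC β') (Tf_SEP β')
  obtain ⟨f', h1, h2, h3⟩ := gen_pos (by simp; omega) f w.1 (lt_min m0 (lt_min m10 m20))
  have nz : ∀ p, f' p ≠ 0 := by
    rintro p h
    have h4 := hm p trivial
    have h5 := (h1 p).trans_le (min_le_left _ _)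
    rw [h] at h5
    simp at h5
    linarith
  have fb : ∀ p s, ((fun j => p (some j)) ∈ Cube.boundary N ∨ s = 0 ∨ s = 1) → f' (p, s) = (w.1, 0) := by
    intro p s h
    apply h2
    change (F (e (p, s), p none)).1 = _
    rw [F2]
    · rfl
    · rcases h with ⟨j, hj⟩ | h
      · exact ⟨some j, hj⟩
      · exact ⟨none, h⟩
  obtain ⟨τ, hτ⟩ := sep_exists f' nz (fun x => by rw [fb x 0 (by simp)]; exact w.2)
    (fun x => by rw [fb x 1 (by simp)]; exact w.2) h3
  let k : (N → I) × I → (Option N → I) := fun p j => j.elim p.2 p.1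
  have hk : Continuous k := by
    refine continuous_pi fun j => ?_
    cases j <;> simp only [k, Option.elim] <;> fun_prop
  have ekx : ∀ x (r s : I), f (k (x, r), s) = (F (k (x, s), r)).1 := by
    intro x r s
    change (F (e _, _)).1 = _
    congr 2
  have ek : ∀ x (s : I), (fun j => k (x, s) (some j)) = x := fun x s => rfl
  have bc : ∀ r : I, BC w fun p : (N → I) × I => f' (k (p.1, r), p.2) := fun r =>
    ⟨by fun_prop, fun p => nz _, fun x s h => fb _ _ h⟩
  let t : I → C(N → I, I) := fun r => ⟨fun x => τ (k (x, r)), by fun_prop⟩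
  have ht : ∀ r, SEP (t r) fun p : (N → I) × I => f' (k (p.1, r), p.2) := fun r x s => hτ (k (x, r)) s
  have q0 := hm1 _ (bc 0) (t 0) (ht 0) (fun p => by
    have := h1 (k (p.1, 0), p.2)
    rw [ekx, show F (k (p.1, p.2), 0) = T β (k (p.1, p.2)) from F0 _] at this
    exact (this.trans_le (min_le_right _ _)).trans_le (min_le_left _ _))
  have q1 := hm2 _ (bc 1) (t 1) (ht 1) (fun p => by
    have := h1 (k (p.1, 1), p.2)
    rw [ekx, show F (k (p.1, p.2), 1) = T β' (k (p.1, p.2)) from F1 _] at this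
    exact (this.trans_le (min_le_right _ _)).trans_le (min_le_right _ _))
  rw [mid_Tf] at q0 q1
  refine (GenLoop.Homotopic.symm q0).trans (GenLoop.Homotopic.trans ?_ q1)
  refine nz_homotopic _ _ (fun p => (f' (k p, τ (k p))).1) (by fun_prop) ?_ ?_ ?_ ?_
  · intro p h
    have h1 := (hτ (k p) _).1 le_rfl h
    have h2 := (hτ (k p) _).2 le_rfl h
    linarith
  · intro y hy t
    rw [fb _ _ (Or.inl hy)]
  · intro x; rfl
  · intro x; rfl

noncomputable def Th [DecidableEq N] [Nonempty N] (i : N) (w : NZ V) :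
    HomotopyGroup N (NZ V) w →* HomotopyGroup (Option N) (NZ (V × ℝ)) (up w) :=
  mkHom T T_homotopic i (some i) fun a b => by rw [T_transAt]

end T3
end HopfModel

namespace HopfModel
open scoped unitInterval Topology Topology.Homotopy

section Hopf

def Lin (q : ℂ × ℝ) (v : ℂ × ℂ) : Prop :=
  (1 - q.2) * v.1 = q.1 * v.2 ∧ (starRingEnd ℂ) q.1 * v.1 = (1 + q.2) * v.2

noncomputable def Pr (q : ℂ × ℝ) (v : ℂ × ℂ) : ℂ × ℂ :=
  (((1 + q.2) * v.1 + q.1 * v.2) / 2, ((starRingEnd ℂ) q.1 * v.1 + (1 - q.2) * v.2) / 2)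

def unitq (q : ℂ × ℝ) : Prop := q.1 * (starRingEnd ℂ) q.1 + q.2 * q.2 = 1

lemma Pr_cont : Continuous fun p : (ℂ × ℝ) × (ℂ × ℂ) => Pr p.1 p.2 := by
  unfold Pr; fun_prop

lemma Lin_Pr {q : ℂ × ℝ} (h : unitq q) (v) : Lin q (Pr q v) := by
  unfold unitq at h
  constructor
  · simp only [Pr]; linear_combination v.1 / 2 * (-h)
  · simp only [Pr]; linear_combination v.2 / 2 * h

lemma Lin_base : Lin (1, 0) (1, 1) := by simp [Lin]

lemma Pr_base : Pr (1, 0) (1, 1) = (1, 1) := by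
  simp only [Pr]; norm_num

lemma Pr_ne {q q' : ℂ × ℝ} {v : ℂ × ℂ} (h : Lin q' v) (hv : v ≠ 0) (hd : ‖q - q'‖ < 1) : Pr q v ≠ 0 := by
  intro h0
  have e1 : v.1 = ((q'.2 - q.2 : ℝ) * v.1 + (q'.1 - q.1) * v.2) / 2 := by
    have := congrArg Prod.fst h0
    simp only [Pr, Prod.fst_zero] at this
    have h1 := h.1
    push_cast
    linear_combination this + h1 / 2
  have e2 : v.2 = ((starRingEnd ℂ) (q'.1 - q.1) * v.1 + (q.2 - q'.2 : ℝ) * v.2) / 2 := by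
    have := congrArg Prod.snd h0
    simp only [Pr, Prod.snd_zero] at this
    have h1 := h.2
    push_cast
    rw [map_sub]
    linear_combination this - h1 / 2
  have d1 := (norm_fst_le (q - q')).trans_lt hd
  have d2 := (norm_snd_le (q - q')).trans_lt hd
  rw [Prod.fst_sub, norm_sub_rev] at d1
  rw [Prod.snd_sub] at d2
  have d2' := d2
  rw [norm_sub_rev] at d2'
  have b1 : ‖v.1‖ ≤ (‖q'.2 - q.2‖ * ‖v.1‖ + ‖q'.1 - q.1‖ * ‖v.2‖) / 2 := by
    conv_lhs => rw [e1]
    rw [norm_div, Complex.norm_ofNat]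
    gcongr
    refine (norm_add_le _ _).trans ?_
    rw [norm_mul, norm_mul, Complex.norm_real]
  have b2 : ‖v.2‖ ≤ (‖q'.1 - q.1‖ * ‖v.1‖ + ‖q.2 - q'.2‖ * ‖v.2‖) / 2 := by
    conv_lhs => rw [e2]
    rw [norm_div, Complex.norm_ofNat]
    gcongr
    refine (norm_add_le _ _).trans ?_
    rw [norm_mul, norm_mul, Complex.norm_real, RCLike.norm_conj]
  have n1 := norm_nonneg v.1
  have n2 := norm_nonneg v.2
  have hpos : 0 < ‖v.1‖ + ‖v.2‖ := by
    by_contra hc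
    have : ‖v.1‖ = 0 := by linarith
    have : ‖v.2‖ = 0 := by linarith
    exact hv (Prod.ext (norm_eq_zero.1 ‹_›) (norm_eq_zero.1 ‹_›))
  rw [norm_sub_rev q'.2] at b1
  nlinarith

noncomputable def mi (n k : ℕ) (s : I) : I := ⟨min s (k / n), le_min s.2.1 (by positivity), (min_le_left _ _).trans s.2.2⟩

lemma mi_cont (n k : ℕ) : Continuous (mi n k) := by unfold mi; fun_prop

lemma mi_zero (n k : ℕ) : mi n k 0 = 0 := by
  ext; simp only [mi]; exact min_eq_left (by simp; positivity)

lemma mi_z (n : ℕ) (s : I) : mi n 0 s = 0 := by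
  ext; simp only [mi]; simp [s.2.1]

lemma mi_n {n : ℕ} (hn : 0 < n) (s : I) : mi n n s = s := by
  ext; simp only [mi]; rw [div_self (by positivity)]; exact min_eq_left s.2.2

lemma mi_dist (n k : ℕ) (s : I) : dist (mi n (k + 1) s) (mi n k s) ≤ 1 / n := by
  rw [Subtype.dist_eq, Real.dist_eq]
  simp only [mi]
  refine (abs_min_sub_min_le_max _ _ _ _).trans ?_
  simp
  rw [<- sub_div, add_sub_cancel_left, abs_of_nonneg (by positivity)]
  simp

lemma hopf_lift {Y : Type} [MetricSpace Y] [CompactSpace Y] (q : C(Y × I, ℂ × ℝ)) (hq : ∀ p, unitq (q p))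
    (h0 : ∀ y, q (y, 0) = (1, 0)) : ∃ L : C(Y × I, ℂ × ℂ), (∀ p, L p ≠ 0) ∧ (∀ p, Lin (q p) (L p)) ∧
      (∀ y, L (y, 0) = (1, 1)) ∧ ∀ y, (∀ s, q (y, s) = (1, 0)) → ∀ s, L (y, s) = (1, 1) := by
  have hu := CompactSpace.uniformContinuous_of_continuous q.continuous
  rw [Metric.uniformContinuous_iff] at hu
  obtain ⟨δ, hδ, hu⟩ := hu 1 one_pos
  obtain ⟨n, hn⟩ := exists_nat_one_div_lt hδ
  have key : ∀ k : ℕ, ∃ L : C(Y × I, ℂ × ℂ), (∀ p, L p ≠ 0) ∧ (∀ p, Lin (q (p.1, mi (n + 1) k p.2)) (L p)) ∧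
      (∀ y, L (y, 0) = (1, 1)) ∧ ∀ y, (∀ s, q (y, s) = (1, 0)) → ∀ s, L (y, s) = (1, 1) := by
    intro k
    induction k with
    | zero =>
      refine ⟨ContinuousMap.const _ (1, 1), fun p => by simp, fun p => ?_, fun y => rfl, fun y _ s => rfl⟩
      rw [mi_z, h0]
      exact Lin_base
    | succ k ih =>
      obtain ⟨L, l1, l2, l3, l4⟩ := ih
      have mc := mi_cont (n + 1) (k + 1)
      refine ⟨⟨fun p => Pr (q (p.1, mi (n + 1) (k + 1) p.2)) (L p), ?_⟩, fun p => ?_, fun p => ?_, fun y => ?_, fun y hy s => ?_⟩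
      · exact Pr_cont.comp ((q.continuous.comp (by fun_prop)).prodMk L.continuous)
      · refine Pr_ne (l2 p) (l1 p) ?_
        rw [<- dist_eq_norm]
        apply hu
        rw [Prod.dist_eq]
        simp only [dist_self]
        refine max_lt hδ ((mi_dist _ _ _).trans_lt ?_)
        push_cast
        exact hn
      · exact Lin_Pr (hq _) _
      · change Pr (q (y, mi _ _ 0)) (L (y, 0)) = _
        rw [mi_zero, h0, l3, Pr_base]
      · change Pr (q (y, mi _ _ s)) (L (y, s)) = _
        rw [hy, l4 y hy, Pr_base]
  obtain ⟨L, l1, l2, l3, l4⟩ := key (n + 1)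
  refine ⟨L, l1, fun p => ?_, l3, l4⟩
  have := l2 p
  rwa [mi_n (Nat.succ_pos _)] at this

noncomputable def rhc (q : ℂ × ℝ) : ℝ := √(Complex.normSq q.1 + q.2 * q.2)

lemma rhc_pos {q : ℂ × ℝ} (h : q ≠ 0) : 0 < rhc q := by
  apply Real.sqrt_pos.2
  by_contra hc
  have h1 := Complex.normSq_nonneg q.1
  have h2 := mul_self_nonneg q.2
  exact h (Prod.ext (Complex.normSq_eq_zero.1 (by linarith)) (mul_self_eq_zero.1 (by linarith)))

noncomputable def nrm (q : ℂ × ℝ) : ℂ × ℝ := (rhc q)⁻¹ • q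

lemma rhc_cont : Continuous rhc := by
  unfold rhc
  have := Complex.continuous_normSq
  fun_prop

lemma nrm_unit {q : ℂ × ℝ} (h : q ≠ 0) : unitq (nrm q) := by
  have hp := rhc_pos h
  have e : rhc q * rhc q = Complex.normSq q.1 + q.2 * q.2 := Real.mul_self_sqrt
    (add_nonneg (Complex.normSq_nonneg _) (mul_self_nonneg _))
  unfold unitq nrm
  simp only [Prod.smul_fst, Prod.smul_snd, Complex.real_smul, map_mul, Complex.conj_ofReal, smul_eq_mul]
  have h1 : q.1 * (starRingEnd ℂ) q.1 = (Complex.normSq q.1 : ℂ) := Complex.mul_conj q.1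
  have h2 : ((rhc q)⁻¹ * (rhc q)⁻¹) * (Complex.normSq q.1 + q.2 * q.2) = 1 := by
    rw [<- e]; field_simp
  have h3 : (((rhc q)⁻¹ * (rhc q)⁻¹ : ℝ) : ℂ) * (Complex.normSq q.1 + q.2 * q.2) = 1 := by exact_mod_cast h2
  push_cast at *
  linear_combination h3 + (rhc q : ℂ)⁻¹ * (rhc q : ℂ)⁻¹ * h1

lemma nrm_base : nrm (1, 0) = (1, 0) := by
  simp [nrm, rhc]

def oneC : NZ ℂ := ⟨1, one_ne_zero⟩

lemma hopf_inj {N : Type} [Fintype N] (β : Ω^ N (NZ ℂ) oneC) (h : GenLoop.Homotopic (T β) GenLoop.const) :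
    GenLoop.Homotopic β GenLoop.const := by
  rw [Fh_iff] at h
  obtain ⟨F, F0, F1, F2⟩ := h
  let e : ((N → I) × I) × I → Option N → I := fun p j => j.elim p.2 p.1.1
  have he : Continuous e := by
    refine continuous_pi fun j => ?_
    cases j <;> simp only [e, Option.elim] <;> fun_prop
  let f : ((N → I) × I) × I → ℂ × ℝ := fun p => (F (e p, p.1.2)).1
  have fc : Continuous f := by fun_prop
  have fnz : ∀ p, f p ≠ 0 := fun p => (F (e p, p.1.2)).2
  have rc := rhc_cont
  let q : C(((N → I) × I) × I, ℂ × ℝ) := ⟨fun p => nrm (f p), by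
    unfold nrm
    exact Continuous.smul (Continuous.inv₀ (rhc_cont.comp fc) fun p => (rhc_pos (fnz p)).ne') fc⟩
  have q0 : ∀ x s, q ((x, 0), s) = nrm (Tf β (x, s)) := by
    intro x s
    change nrm (F (_, 0)).1 = _
    rw [F0]; rfl
  have q1 : ∀ x s, q ((x, 1), s) = (1, 0) := by
    intro x s
    change nrm (F (_, 1)).1 = _
    rw [F1]; exact nrm_base
  have qb : ∀ x r s, (x ∈ Cube.boundary N ∨ s = 0 ∨ s = 1) → q ((x, r), s) = (1, 0) := by
    intro x r s h
    change nrm (F (_, r)).1 = _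
    rw [F2]
    · exact nrm_base
    · rcases h with ⟨j, hj⟩ | h
      · exact ⟨some j, hj⟩
      · exact ⟨none, h⟩
  obtain ⟨L, l1, l2, l3, l4⟩ := hopf_lift q (fun p => nrm_unit (fnz p)) (fun y => qb _ _ _ (by simp))
  have Lb : ∀ x ∈ Cube.boundary N, ∀ r s, L ((x, r), s) = (1, 1) := fun x hx r s =>
    l4 _ (fun s => qb _ _ _ (Or.inl hx)) s
  have nz1 : ∀ p, (q p).2 ≠ -1 → (L p).1 ≠ 0 := by
    intro p hp h
    obtain ⟨e1, e2⟩ := l2 p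
    rw [h, mul_zero] at e2
    rcases mul_eq_zero.1 e2.symm with e | e
    · exact hp (by have : (1 : ℝ) + (q p).2 = 0 := by exact_mod_cast e
                   linarith)
    · exact l1 p (Prod.ext h e)
  have nz2 : ∀ p, (q p).2 ≠ 1 → (L p).2 ≠ 0 := by
    intro p hp h
    obtain ⟨e1, e2⟩ := l2 p
    rw [h, mul_zero] at e1
    rcases mul_eq_zero.1 e1 with e | e
    · exact hp (by have : (1 : ℝ) - (q p).2 = 0 := by exact_mod_cast e
                   linarith)
    · exact l1 p (Prod.ext e h)
  have t2 : ∀ x (s : I), (q ((x, 0), s)).2 = (rhc (Tf β (x, s)))⁻¹ * ((2 * s - 1) * (ta s * ‖(β x).1 - 1‖)) := by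
    intro x s; rw [q0]; rfl
  have rp : ∀ x s, 0 < (rhc (Tf β (x, s)))⁻¹ := fun x s => inv_pos.2 (rhc_pos ((Tf_BC β).nz _))
  have lowt : ∀ x (s : I), s ≤ hI → (q ((x, 0), s)).2 ≠ 1 := by
    intro x s hs
    rw [le_hI] at hs
    have : (q ((x, 0), s)).2 ≤ 0 := by
      rw [t2]
      have h1 := ta_nonneg s.2.1 s.2.2
      have h2 : 0 ≤ ta s * ‖(β x).1 - 1‖ := by positivity
      have h3 := (rp x s).le
      exact mul_nonpos_of_nonneg_of_nonpos h3 (mul_nonpos_of_nonpos_of_nonneg (by linarith) h2)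
    linarith
  have hight : ∀ x (s : I), hI ≤ s → (q ((x, 0), s)).2 ≠ -1 := by
    intro x s hs
    rw [hI_le] at hs
    have : 0 ≤ (q ((x, 0), s)).2 := by
      rw [t2]
      have h1 := ta_nonneg s.2.1 s.2.2
      have h2 : 0 ≤ ta s * ‖(β x).1 - 1‖ := by positivity
      have h3 := (rp x s).le
      exact mul_nonneg h3 (mul_nonneg (by linarith) h2)
    linarith
  have hlc := lerpI_cont
  have lc : ∀ {a b : I}, Continuous fun p : (N → I) × I => lerpI p.2 a b := fun {a b} => by
    exact hlc.comp (continuous_snd.prodMk (continuous_const.prodMk continuous_const))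
  let mk : ∀ c : C(N → I, ℂ), (∀ x, c x ≠ 0) → (∀ x ∈ Cube.boundary N, c x = 1) → Ω^ N (NZ ℂ) oneC :=
    fun c h1 h2 => ⟨⟨fun x => ⟨c x, h1 x⟩, c.continuous.subtype_mk _⟩, fun x hx => Subtype.ext (h2 x hx)⟩
  have mid0 : ∀ x, q ((x, 0), hI) = nrm ((β x).1, 0) := by
    intro x
    rw [q0]
    congr 1
    change ((1 - ta (1 / 2)) • (1 : ℂ) + ta (1 / 2) • (β x).1, (2 * (1 / 2) - 1) * _) = _
    rw [ta_half]; simp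
  have hβ : ∀ x, rhc ((β x).1, 0) > 0 := fun x => rhc_pos fun h => (β x).2 (congrArg Prod.fst h)
  have midz : ∀ x, (L ((x, 0), hI)).1 = ((rhc ((β x).1, 0))⁻¹ : ℝ) * (β x).1 * (L ((x, 0), hI)).2 := by
    intro x
    have := (l2 ((x, 0), hI)).1
    rw [mid0] at this
    simpa [nrm] using this
  have βc : Continuous fun x => (β x).1 := continuous_subtype_val.comp β.1.continuous
  let g1 := mk ⟨fun x => (L ((x, 0), hI)).1, by fun_prop⟩ (fun x => nz1 _ (hight x _ le_rfl)) (fun x hx => by simp [Lb x hx])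
  let g2 := mk ⟨fun x => (L ((x, 0), 1)).1, by fun_prop⟩ (fun x => nz1 _ (hight x _ hI.2.2)) (fun x hx => by simp [Lb x hx])
  have c1 : GenLoop.Homotopic β g1 := by
    let g0 := mk ⟨fun x => (β x).1 * (L ((x, 0), hI)).2, by fun_prop⟩
      (fun x => mul_ne_zero (β x).2 (nz2 _ (lowt x _ le_rfl)))
      (fun x hx => by
        have := congrArg Subtype.val (GenLoop.boundary β x hx)
        simp only [ContinuousMap.coe_mk, Lb x hx, mul_one]; exact this)
    have d1 : GenLoop.Homotopic β g0 := by
      refine nz_homotopic _ _ (fun p => (β p.1).1 * (L ((p.1, 0), lerpI p.2 0 hI)).2) ?_ ?_ ?_ ?_ ?_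
      · have := lc (a := 0) (b := hI)
        exact (βc.comp continuous_fst).mul (continuous_snd.comp (L.continuous.comp (by fun_prop)))
      · exact fun p => mul_ne_zero (β _).2 (nz2 _ (lowt _ _ (lerpI_le hI.2.1 le_rfl)))
      · intro y hy t
        simp [Lb y hy, GenLoop.boundary β y hy]
      · intro x
        simp [lerpI_zero, l3]
      · intro x
        simp only [lerpI_one]
        rfl
    refine d1.trans ?_
    have Rc : Continuous fun x => (rhc ((β x).1, 0))⁻¹ :=
      Continuous.inv₀ (rhc_cont.comp (by fun_prop)) fun x => (hβ x).ne'
    refine nz_homotopic _ _ (fun p => ((1 - p.2 + p.2 * (rhc ((β p.1).1, 0))⁻¹ : ℝ) : ℂ) * ((β p.1).1 * (L ((p.1, 0), hI)).2)) ?_ ?_ ?_ ?_ ?_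
    · have Rc2 := Rc.comp (continuous_fst (X := N → I) (Y := I))
      refine Continuous.mul (Complex.continuous_ofReal.comp (Continuous.add (by fun_prop) (Continuous.mul (by fun_prop) Rc2))) (by fun_prop)
    · intro p
      refine mul_ne_zero ?_ (mul_ne_zero (β _).2 (nz2 _ (lowt _ _ le_rfl)))
      have h1 := inv_pos.2 (hβ p.1)
      have h2 := p.2.2.1
      have h3 := p.2.2.2
      have : 0 < (1 - p.2 + p.2 * (rhc ((β p.1).1, 0))⁻¹ : ℝ) := by
        rcases eq_or_lt_of_le h2 with h | h
        · rw [<- h]; norm_num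
        · have := mul_pos h h1; linarith
      exact_mod_cast this.ne'
    · intro y hy t
      simp only [Lb y hy, GenLoop.boundary β y hy]
      simp [oneC, rhc]
    · intro x; simp; rfl
    · intro x
      change _ = (L ((x, 0), hI)).1
      rw [midz]; simp; ring
  have c2 : GenLoop.Homotopic g1 g2 := by
    refine nz_homotopic _ _ (fun p => (L ((p.1, 0), lerpI p.2 hI 1)).1) ?_ ?_ ?_ ?_ ?_
    · have := lc (a := hI) (b := 1)
      exact (continuous_fst.comp (L.continuous.comp (by fun_prop)))
    · exact fun p => nz1 _ (hight _ _ (le_lerpI le_rfl hI.2.2))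
    · intro y hy t
      simp [Lb y hy, oneC]
    · intro x; simp only [lerpI_zero]; rfl
    · intro x; simp only [lerpI_one]; rfl
  have c3 : GenLoop.Homotopic g2 GenLoop.const := by
    refine nz_homotopic _ _ (fun p => (L (p, 1)).1) (by fun_prop) ?_ ?_ ?_ ?_
    · exact fun p => nz1 _ (by rw [qb _ _ _ (by simp)]; norm_num)
    · intro y hy t
      simp [Lb y hy, oneC]
    · intro x; rfl
    · intro x
      rw [l4 _ (q1 x)]; rfl
  exact (c1.trans c2).trans c3

noncomputable def pi1C : HomotopyGroup (Fin 1) (NZ ℂ) oneC ≃* Multiplicative ℤ :=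
  (HomotopyGroup.pi1MulEquivFundamentalGroup).trans <|
    (Complex.isAddQuotientCoveringMap_exp.fundamentalGroupEquiv (x := oneC) ⟨0, by simp [oneC]⟩).trans <|
    (MulOpposite.opMulEquiv (M := Multiplicative (AddSubgroup.zmultiples (2 * Real.pi * Complex.I)))).symm.trans <|
    (AddEquiv.toMultiplicative (AddEquiv.ofBijective ((zmultiplesHom (AddSubgroup.zmultiples (2 * Real.pi * Complex.I))
      ⟨_, AddSubgroup.mem_zmultiples _⟩)) (by
        constructor
        · rw [injective_iff_map_eq_zero]
          intro a ha
          have := congrArg Subtype.val ha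
          simpa using this
        · rintro ⟨_, k, rfl⟩
          exact ⟨k, Subtype.ext (by simp)⟩)).symm)

noncomputable abbrev base4 : NZ ((ℂ × ℝ) × ℝ) := up (up oneC)

lemma pi3 : Nonempty (HomotopyGroup (Option (Option (Fin 1))) (NZ ((ℂ × ℝ) × ℝ)) base4 ≃* Multiplicative ℤ) := by
  have b1 : Function.Bijective (Th (V := ℂ) (0 : Fin 1) oneC) := by
    constructor
    · rw [injective_iff_map_eq_one]
      intro a
      induction a using Quotient.inductionOn with | h a => ?_
      intro ha
      exact Quotient.sound (hopf_inj a (Quotient.exact ha))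
    · exact mkHom_surj _ _ _ _ _ (T_surj (by simp [Complex.finrank_real_complex]))
  have b2 : Function.Bijective (Th (V := ℂ × ℝ) (some (0 : Fin 1)) (up oneC)) :=
    ⟨mkHom_inj _ _ _ _ _ (T_inj (by simp [Complex.finrank_real_complex])),
      mkHom_surj _ _ _ _ _ (T_surj (by simp [Complex.finrank_real_complex]))⟩
  exact ⟨(((MulEquiv.ofBijective _ b1).trans (MulEquiv.ofBijective _ b2)).symm).trans pi1C⟩

end Hopf
end HopfModel

namespace HopfModel
open scoped unitInterval Topology Topology.Homotopy ContinuousMap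

section S3

lemma NZ_pc {V : Type} [NormedAddCommGroup V] [NormedSpace ℝ V] (h : 1 < Module.rank ℝ V) : PathConnectedSpace (NZ V) :=
  isPathConnected_iff_pathConnectedSpace.1 (isPathConnected_compl_singleton_of_one_lt_rank h (0 : V))

abbrev W4 := (ℂ × ℝ) × ℝ

lemma W4_pc : PathConnectedSpace (NZ W4) := NZ_pc (by
  rw [<- Module.finrank_eq_rank]; simp [Complex.finrank_real_complex])

lemma W3_pc : PathConnectedSpace (NZ (ℂ × ℝ)) := NZ_pc (by
  rw [<- Module.finrank_eq_rank]; simp [Complex.finrank_real_complex])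

lemma W4_sc : SimplyConnectedSpace (NZ W4) := by
  have := W4_pc
  have := W3_pc
  rw [simply_connected_iff_loops_nullhomotopic]
  refine ⟨W4_pc, fun x γ => ?_⟩
  have h1 : Subsingleton (HomotopyGroup (Option (Fin 0)) (NZ W4) base4) := by
    have hc : ∀ β β' : Ω^ (Fin 0) (NZ (ℂ × ℝ)) (up oneC), GenLoop.Homotopic β β' := by
      intro β β'
      let p := PathConnectedSpace.somePath (β default) (β' default)
      rw [Fh_iff]
      refine ⟨⟨fun q => p q.2, by fun_prop⟩, fun x => ?_, fun x => ?_, fun y hy => hy.choose.elim0⟩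
      · simp [p]; exact congrArg β (Subsingleton.elim _ _)
      · simp [p]; exact congrArg β' (Subsingleton.elim _ _)
    constructor
    intro a b
    induction a using Quotient.inductionOn with | h a => ?_
    induction b using Quotient.inductionOn with | h b => ?_
    obtain ⟨β, hβ⟩ := T_surj (by simp [Complex.finrank_real_complex]) a
    obtain ⟨β', hβ'⟩ := T_surj (by simp [Complex.finrank_real_complex]) b
    exact Quotient.sound ((GenLoop.Homotopic.symm hβ).trans ((T_homotopic _ _ (hc β β')).trans hβ'))
  have h2 : Subsingleton (FundamentalGroup (NZ W4) base4) :=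
    (homotopyGroupEquivFundamentalGroupOfUnique (Option (Fin 0))).symm.subsingleton
  have h3 : Subsingleton (FundamentalGroup (NZ W4) x) :=
    (FundamentalGroup.fundamentalGroupMulEquivOfPathConnected x base4).toEquiv.subsingleton
  exact Quotient.exact (h3.elim (Quotient.mk _ γ : Path.Homotopic.Quotient x x) (Quotient.mk _ (Path.refl x) : Path.Homotopic.Quotient x x))

abbrev S3 := Metric.sphere (0 : EuclideanSpace ℝ (Fin 4)) 1

noncomputable def linE : EuclideanSpace ℝ (Fin 4) ≃L[ℝ] W4 := ContinuousLinearEquiv.ofFinrankEq (by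
  simp [Complex.finrank_real_complex])

lemma S3_hequiv : Nonempty (S3 ≃ₕ NZ W4) := by
  let f : C(S3, NZ W4) := ⟨fun x => ⟨linE x.1, fun h => by
    have h1 : x.1 = 0 := by simpa using h
    have := x.2
    simp [h1] at this⟩, by
      exact Continuous.subtype_mk (linE.continuous.comp continuous_subtype_val) _⟩
  have hn : ∀ v : NZ W4, ‖linE.symm v.1‖ ≠ 0 := fun v => by simpa using v.2
  have ec : Continuous fun v : NZ W4 => linE.symm v.1 := linE.symm.continuous.comp continuous_subtype_val
  let g : C(NZ W4, S3) := ⟨fun v => ⟨‖linE.symm v.1‖⁻¹ • linE.symm v.1, by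
    rw [mem_sphere_zero_iff_norm, norm_smul, norm_inv, norm_norm, inv_mul_cancel₀ (hn v)]⟩,
    by exact Continuous.subtype_mk (Continuous.smul (Continuous.inv₀ ec.norm hn) ec) _⟩
  refine ⟨⟨f, g, ?_, ?_⟩⟩
  · have : g.comp f = ContinuousMap.id _ := by
      ext x : 2
      simp [f, g]
    rw [this]
  · let H : C(I × NZ W4, NZ W4) := ⟨fun p => ⟨((1 - (p.1 : ℝ)) * ‖linE.symm p.2.1‖⁻¹ + p.1) • p.2.1, by
      refine smul_ne_zero ?_ p.2.2
      have h1 : 0 < ‖linE.symm p.2.1‖⁻¹ := inv_pos.2 (lt_of_le_of_ne (norm_nonneg _) (hn _).symm)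
      have h2 := p.1.2.1
      have h3 := p.1.2.2
      rcases eq_or_lt_of_le h2 with h | h
      · rw [<- h]; simpa using h1.ne'
      · have : 0 ≤ 1 - (p.1 : ℝ) := by linarith
        positivity⟩, by
      have e2 := (Continuous.inv₀ ec.norm hn).comp (continuous_snd (X := I))
      exact Continuous.subtype_mk (Continuous.smul (Continuous.add (Continuous.mul (by fun_prop) e2) (by fun_prop)) (by fun_prop)) _⟩
    refine ⟨⟨H, fun v => ?_, fun v => ?_⟩⟩
    · apply Subtype.ext; simp [H, f, g]
    · apply Subtype.ext; simp [H]

lemma S3_sc : SimplyConnectedSpace S3 := by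
  obtain ⟨e⟩ := S3_hequiv
  have := W4_sc
  exact e.simplyConnectedSpace

lemma congr_pi {N M : Type} [DecidableEq N] [Nonempty N] [DecidableEq M] [Nonempty M] (e : M ≃ N) {X : Type}
    [TopologicalSpace X] (x : X) : Nonempty (HomotopyGroup M X x ≃* HomotopyGroup N X x) := by
  obtain ⟨i⟩ : Nonempty M := inferInstance
  have key : ∀ {N M : Type} (e : M ≃ N) (a b : Ω^ M X x), GenLoop.Homotopic a b →
      GenLoop.Homotopic (GenLoop.congr x e a) (GenLoop.congr x e b) := by
    intro N M e a b h
    rw [Fh_iff] at *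
    obtain ⟨h, h0, h1, h2⟩ := h
    refine ⟨⟨fun p => h (fun m => p.1 (e m), p.2), by fun_prop⟩, fun y => h0 _, fun y => h1 _, ?_⟩
    rintro y ⟨n, hn⟩ t
    exact h2 _ ⟨e.symm n, by simpa using hn⟩ t
  refine ⟨MulEquiv.ofBijective (mkHom (GenLoop.congr x e) (key e) i (e i) ?_) ⟨mkHom_inj _ _ _ _ _ ?_, mkHom_surj _ _ _ _ _ ?_⟩⟩
  · intro a b
    have : GenLoop.congr x e (GenLoop.transAt i a b) = GenLoop.transAt (e i) (GenLoop.congr x e a) (GenLoop.congr x e b) := by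
      ext t
      rw [transAt_apply]
      refine (transAt_apply i a b _).trans ?_
      have hk : ∀ u, Function.update (fun m => t (e m)) i u = fun m => Function.update t (e i) u (e m) := by
        intro u
        ext m
        by_cases h : m = i
        · subst h; simp
        · rw [Function.update_of_ne h, Function.update_of_ne (by simpa using h)]
      by_cases h : (t (e i) : ℝ) ≤ 1 / 2
      · rw [if_pos h]
        exact (if_pos h).trans (congrArg a (hk _))
      · rw [if_neg h]
        exact (if_neg h).trans (congrArg b (hk _))
    rw [this]
  · intro a b h
    have := key e.symm _ _ h
    have e1 : ∀ a : Ω^ M X x, GenLoop.congr x e.symm (GenLoop.congr x e a) = a := fun a => (GenLoop.congr x e).left_inv a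
    rwa [e1, e1] at this
  · intro b
    exact ⟨(GenLoop.congr x e).symm b, by simp; exact GenLoop.Homotopic.refl _⟩

lemma S3_pi3 (s : S3) : Nonempty (HomotopyGroup (Fin 3) S3 s ≃* Multiplicative ℤ) := by
  obtain ⟨e⟩ := S3_hequiv
  have := W4_pc
  obtain ⟨a⟩ := pi_equiv (N := Fin 3) e s
  obtain ⟨b⟩ := pi_basechange (N := Fin 3) (PathConnectedSpace.joined (e s) base4)
  obtain ⟨c⟩ := congr_pi (N := Option (Option (Fin 1))) (M := Fin 3) (Fintype.equivOfCardEq (by simp)) base4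
  obtain ⟨d⟩ := pi3
  exact ⟨a.trans (b.trans (c.trans d))⟩

theorem final_of_hequiv (X : Type) [TopologicalSpace X] (e : X ≃ₕ S3) :
    PathConnectedSpace X ∧ SimplyConnectedSpace X ∧
    (∀ x : X, Nonempty (HomotopyGroup (Fin 3) X x ≃* Multiplicative ℤ)) ∧
    (∀ (n : ℕ) (x : X) (s : S3), Nonempty (HomotopyGroup (Fin (n + 1)) X x ≃* HomotopyGroup (Fin (n + 1)) S3 s)) := by
  have := S3_sc
  have := e.simplyConnectedSpace
  refine ⟨inferInstance, inferInstance, fun x => ?_, fun n x s => ?_⟩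
  · obtain ⟨a⟩ := pi_equiv (N := Fin 3) e x
    obtain ⟨b⟩ := S3_pi3 (e x)
    exact ⟨a.trans b⟩
  · obtain ⟨a⟩ := pi_equiv (N := Fin (n + 1)) e x
    obtain ⟨b⟩ := pi_basechange (N := Fin (n + 1)) (PathConnectedSpace.joined (e x) s)
    exact ⟨a.trans b⟩

end S3
end HopfModel

namespace HopfModel
open Opposite

section dec

def dec {m n : ℕ} (θ : ⦋m⦌ ⟶ ⦋n⦌) : ⦋m + 1⦌ ⟶ ⦋n + 1⦌ :=
  SimplexCategory.mkHom ⟨Fin.cases 0 (fun i => (θ.toOrderHom i).succ), by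
    intro a b
    refine Fin.cases ?_ (fun a => ?_) a
    · intro _; exact Fin.zero_le _
    · refine Fin.cases ?_ (fun b => ?_) b
      · intro h; exact absurd h (by simp)
      · intro h; exact Fin.succ_le_succ_iff.2 (θ.toOrderHom.monotone (Fin.succ_le_succ_iff.1 h))⟩

@[simp] lemma dec_zero {m n : ℕ} (θ : ⦋m⦌ ⟶ ⦋n⦌) : (dec θ).toOrderHom 0 = 0 := rfl
@[simp] lemma dec_succ {m n : ℕ} (θ : ⦋m⦌ ⟶ ⦋n⦌) (i : Fin (m + 1)) :
    (dec θ).toOrderHom i.succ = (θ.toOrderHom i).succ := rfl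

lemma hom_ext' {m n : ℕ} {f g : ⦋m⦌ ⟶ ⦋n⦌} (h : ∀ i, f.toOrderHom i = g.toOrderHom i) : f = g :=
  SimplexCategory.Hom.ext _ _ (OrderHom.ext _ _ (funext h))

lemma comp_ap {m n k : ℕ} (f : ⦋m⦌ ⟶ ⦋n⦌) (g : ⦋n⦌ ⟶ ⦋k⦌) (i) :
    (f ≫ g).toOrderHom i = g.toOrderHom (f.toOrderHom i) := rfl

lemma δ_ap {m : ℕ} (j : Fin (m + 2)) (i) : (SimplexCategory.δ j).toOrderHom i = j.succAbove i := rfl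
lemma σ_ap {m : ℕ} (j : Fin (m + 1)) (i) : (SimplexCategory.σ j).toOrderHom i = j.predAbove i := rfl

lemma dec_id (n : ℕ) : dec (𝟙 ⦋n⦌) = 𝟙 ⦋n + 1⦌ := by
  refine hom_ext' (Fin.cases ?_ ?_) <;> intros <;> rfl

lemma dec_comp {m n k : ℕ} (f : ⦋m⦌ ⟶ ⦋n⦌) (g : ⦋n⦌ ⟶ ⦋k⦌) : dec (f ≫ g) = dec f ≫ dec g := by
  refine hom_ext' (Fin.cases ?_ ?_) <;> intros <;> rfl

lemma dec_δ {n : ℕ} (j : Fin (n + 2)) : dec (SimplexCategory.δ j) = SimplexCategory.δ j.succ := by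
  refine hom_ext' (Fin.cases ?_ ?_)
  · simp [δ_ap]
  · intro i; simp [δ_ap]

lemma dec_σ {n : ℕ} (j : Fin (n + 1)) : dec (SimplexCategory.σ j) = SimplexCategory.σ j.succ := by
  refine hom_ext' (Fin.cases ?_ ?_)
  · simp [σ_ap]
  · intro i; simp [σ_ap]

def rr (n : ℕ) : ⦋n + 1⦌ ⟶ ⦋n + 1⦌ := SimplexCategory.σ 0 ≫ SimplexCategory.δ 0

@[simp] lemma rr_zero (n : ℕ) : (rr n).toOrderHom 0 = 1 := rfl
@[simp] lemma rr_succ (n : ℕ) (i : Fin (n + 1)) : (rr n).toOrderHom i.succ = i.succ := by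
  change (SimplexCategory.δ 0).toOrderHom ((SimplexCategory.σ 0).toOrderHom i.succ) = _
  simp [δ_ap, σ_ap]

lemma rr_dec {m n : ℕ} (θ : ⦋m⦌ ⟶ ⦋n⦌) : rr m ≫ dec θ ≫ rr n = rr m ≫ dec θ := by
  refine hom_ext' fun i => ?_
  rw [comp_ap, comp_ap, comp_ap]
  have : ∃ j : Fin (m + 1), (rr m).toOrderHom i = j.succ := by
    refine Fin.cases ⟨0, rfl⟩ (fun i => ⟨i, ?_⟩) i
    simp
  obtain ⟨j, hj⟩ := this
  rw [hj, dec_succ, rr_succ]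

def eh {n : ℕ} (ε : ⦋n⦌ ⟶ ⦋1⦌) : ⦋n + 1⦌ ⟶ ⦋n + 1⦌ :=
  SimplexCategory.mkHom ⟨Fin.cases 0 (fun i => if ε.toOrderHom i = 0 then 0 else i.succ), by
    intro a b
    refine Fin.cases ?_ (fun a => ?_) a
    · intro _; exact Fin.zero_le _
    · refine Fin.cases ?_ (fun b => ?_) b
      · intro h; exact absurd h (by simp)
      · intro h
        have h1 := ε.toOrderHom.monotone (Fin.succ_le_succ_iff.1 h)
        simp only [Fin.cases_succ]
        split_ifs with h2 h3
        · simp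
        · simp
        · exact absurd h1 (by rename_i h3; rw [h3]; simpa using h2)
        · exact h⟩

@[simp] lemma eh_succ {n : ℕ} (ε : ⦋n⦌ ⟶ ⦋1⦌) (i : Fin (n + 1)) :
    (eh ε).toOrderHom i.succ = if ε.toOrderHom i = 0 then 0 else i.succ := rfl

lemma eh_dec {m n : ℕ} (θ : ⦋m⦌ ⟶ ⦋n⦌) (ε : ⦋n⦌ ⟶ ⦋1⦌) :
    eh (θ ≫ ε) ≫ dec θ = dec θ ≫ eh ε := by
  refine hom_ext' (Fin.cases ?_ ?_)
  · rfl
  · intro i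
    rw [comp_ap, comp_ap, eh_succ, dec_succ, eh_succ, comp_ap]
    split_ifs <;> rfl

lemma nat_of_gen (W : MorphismProperty SimplexCategory) (hid : ∀ n : ℕ, W (𝟙 ⦋n⦌))
    (hc : ∀ {a b c : ℕ} (f : ⦋a⦌ ⟶ ⦋b⦌) (g : ⦋b⦌ ⟶ ⦋c⦌), W f → W g → W (f ≫ g))
    (δ_mem : ∀ {n : ℕ} (i : Fin (n + 2)), W (SimplexCategory.δ i))
    (σ_mem : ∀ {n : ℕ} (i : Fin (n + 1)), W (SimplexCategory.σ i)) {m n : ℕ} (f : ⦋m⦌ ⟶ ⦋n⦌) : W f := by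
  have : W.IsMultiplicative := { id_mem := fun X => hid X.len, comp_mem := fun {a b c} f g => hc (a := a.len) (b := b.len) (c := c.len) f g }
  rw [SimplexCategory.morphismProperty_eq_top W δ_mem σ_mem]
  trivial

end dec
end HopfModel

namespace HopfModel
open Opposite

section loop

abbrev KK (K : SimplicialObject AddCommGrpCat.{0}) (n : ℕ) : Type := K.obj (op ⦋n⦌)
abbrev GG (G : SimplicialObject GrpCat.{0}) (n : ℕ) : Type := G.obj (op ⦋n⦌)

variable {K : SimplicialObject AddCommGrpCat.{0}} {G : SimplicialObject GrpCat.{0}}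

def km {m n : ℕ} (f : ⦋m⦌ ⟶ ⦋n⦌) : KK K n →+ KK K m := (K.map f.op).hom
def gm {m n : ℕ} (f : ⦋m⦌ ⟶ ⦋n⦌) : GG G n →* GG G m := (G.map f.op).hom

lemma km_km {a b c : ℕ} (f : ⦋a⦌ ⟶ ⦋b⦌) (g : ⦋b⦌ ⟶ ⦋c⦌) (x : KK K c) : km f (km g x) = km (f ≫ g) x := by
  simp [km]
lemma gm_gm {a b c : ℕ} (f : ⦋a⦌ ⟶ ⦋b⦌) (g : ⦋b⦌ ⟶ ⦋c⦌) (x : GG G c) : gm f (gm g x) = gm (f ≫ g) x := by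
  simp [gm]
lemma km_id {a : ℕ} (x : KK K a) : km (𝟙 ⦋a⦌) x = x := by
  simp [km]
lemma gm_id {a : ℕ} (x : GG G a) : gm (𝟙 ⦋a⦌) x = x := by
  simp [gm]

variable (ζ : TwistingFunction (K ⋙ forget AddCommGrpCat) G)

def zt {n : ℕ} (x : KK K (n + 1)) : GG G n := ζ.map n x

lemma zt_s0 {n : ℕ} (x : KK K n) : zt ζ (km (SimplexCategory.σ 0) x) = 1 := ζ.map_σ₀ n x

lemma zt_rr {n : ℕ} (x : KK K (n + 1)) : zt ζ (km (rr n) x) = 1 := by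
  rw [rr, <- km_km, zt_s0]

lemma zt_rr' {m n : ℕ} (θ : ⦋m + 1⦌ ⟶ ⦋n⦌) (h : rr m ≫ θ = θ) (x : KK K n) : zt ζ (km θ x) = 1 := by
  rw [<- h, <- km_km, zt_rr]

lemma zt_zero (n : ℕ) : zt ζ (0 : KK K (n + 1)) = 1 := by
  rw [<- map_zero (km (rr n)), zt_rr]

lemma zt_const {m n : ℕ} (θ : ⦋m⦌ ⟶ ⦋n⦌) (h : θ.toOrderHom 0 = 0) (x : KK K (n + 1)) :
    zt ζ (km (dec θ) (km (rr n) x)) = 1 := by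
  rw [km_km]
  apply zt_rr'
  refine hom_ext' (Fin.cases ?_ ?_)
  · rw [comp_ap, rr_zero]
    change (rr n).toOrderHom ((dec θ).toOrderHom (Fin.succ 0)) = (rr n).toOrderHom ((dec θ).toOrderHom 0)
    rw [dec_succ, h]
    rfl
  · intro i
    rw [comp_ap, rr_succ]

lemma zt_nat {m n : ℕ} (θ : ⦋m⦌ ⟶ ⦋n⦌) (x : KK K (n + 1)) :
    gm θ (zt ζ x) = (zt ζ (km (dec θ) (km (rr n) x)))⁻¹ * zt ζ (km (dec θ) x) := by
  let W : MorphismProperty SimplexCategory := fun a b θ => ∀ x : KK K (b.len + 1),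
    gm (m := a.len) (n := b.len) θ (zt ζ x) =
      (zt ζ (km (dec (m := a.len) (n := b.len) θ) (km (rr b.len) x)))⁻¹ * zt ζ (km (dec (m := a.len) (n := b.len) θ) x)
  refine nat_of_gen W ?_ ?_ ?_ ?_ θ x
  · intro n x
    change gm (𝟙 ⦋n⦌) (zt ζ x) = (zt ζ (km (dec (𝟙 ⦋n⦌)) (km (rr n) x)))⁻¹ * zt ζ (km (dec (𝟙 ⦋n⦌)) x)
    rw [gm_id, zt_const _ _ rfl, dec_id, km_id, inv_one, one_mul]
  · intro a b c f g hf hg x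
    change gm (f ≫ g) (zt ζ x) = (zt ζ (km (dec (f ≫ g)) (km (rr c) x)))⁻¹ * zt ζ (km (dec (f ≫ g)) x)
    have hg' : gm g (zt ζ x) = (zt ζ (km (dec g) (km (rr c) x)))⁻¹ * zt ζ (km (dec g) x) := hg x
    have hf' : ∀ x, gm f (zt ζ x) = (zt ζ (km (dec f) (km (rr b) x)))⁻¹ * zt ζ (km (dec f) x) := hf
    rw [<- gm_gm, hg', map_mul, map_inv, hf', hf', dec_comp, km_km (rr b) (dec g) (km (rr c) x), km_km (rr b ≫ dec g), Category.assoc, rr_dec,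
      <- km_km (rr b), <- km_km (dec f) (dec g), <- km_km (dec f) (dec g)]
    group
  · intro n i x
    change gm (SimplexCategory.δ i) (zt ζ x) = (zt ζ (km (dec (SimplexCategory.δ i)) (km (rr (n + 1)) x)))⁻¹ * zt ζ (km (dec (SimplexCategory.δ i)) x)
    revert i
    refine Fin.cases ?_ fun j => ?_
    · rw [dec_δ, km_km]
      have : SimplexCategory.δ (Fin.succ 0) ≫ rr (n + 1) = SimplexCategory.δ 0 := by
        rw [rr, <- Category.assoc]
        erw [SimplexCategory.δ_comp_σ_succ (i := (0 : Fin (n + 2)))]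
        rw [Category.id_comp]
      rw [this]
      exact ζ.map_δ₀ n x
    · rw [zt_const _ _ (by rw [δ_ap]; simp), dec_δ, inv_one, one_mul]
      exact ζ.map_δ n j x
  · intro n i x
    change gm (SimplexCategory.σ i) (zt ζ x) = (zt ζ (km (dec (SimplexCategory.σ i)) (km (rr n) x)))⁻¹ * zt ζ (km (dec (SimplexCategory.σ i)) x)
    rw [zt_const _ _ (by rw [σ_ap]; simp), dec_σ, inv_one, one_mul]
    exact ζ.map_σ n i x

structure IsLoop : Prop where
  lift : ∀ (n : ℕ) (M : Type) [Group M] (f : KK K (n + 1) → M), (∀ x, f (km (SimplexCategory.σ 0) x) = 1) →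
    ∃ F : GG G n →* M, ∀ x, F (zt ζ x) = f x
  ind : ∀ (n : ℕ) (p : GG G n → Prop), p 1 → (∀ x h, p h ↔ p (zt ζ x * h)) → ∀ h, p h

variable {ζ} (L : IsLoop ζ)

lemma phi_ex (L : IsLoop ζ) (n : ℕ) : ∃ F : GG G n →* Multiplicative (KK K (n + 1)),
    ∀ x, F (zt ζ x) = Multiplicative.ofAdd (x - km (rr n) x) := by
  refine L.lift n _ _ fun x => ?_
  have : (SimplexCategory.σ 0 ≫ SimplexCategory.δ 0) ≫ SimplexCategory.σ 0 = SimplexCategory.σ (0 : Fin (n + 1)) := by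
    rw [Category.assoc, SimplexCategory.δ_comp_σ_self' (by rfl), Category.comp_id]
  rw [km_km, rr, this, sub_self]
  rfl

noncomputable def phi {n : ℕ} (h : GG G n) : KK K (n + 1) := ((phi_ex L n).choose h).toAdd

lemma phi_mul {n : ℕ} (h k : GG G n) : phi L (h * k) = phi L h + phi L k := by simp [phi]
lemma phi_one {n : ℕ} : phi L (1 : GG G n) = 0 := by simp [phi]
lemma phi_inv {n : ℕ} (h : GG G n) : phi L h⁻¹ = - phi L h := by simp [phi]
lemma phi_zt {n : ℕ} (x : KK K (n + 1)) : phi L (zt ζ x) = x - km (rr n) x := by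
  simp [phi, (phi_ex L n).choose_spec]

lemma rr_rr (n : ℕ) : rr n ≫ rr n = rr n := by
  refine hom_ext' (Fin.cases rfl ?_)
  intro i; rw [comp_ap]; simp

lemma rr_phi {n : ℕ} (h : GG G n) : km (rr n) (phi L h) = 0 := by
  refine L.ind n (fun h => km (rr n) (phi L h) = 0) (by rw [phi_one, map_zero]) (fun x h => ?_) h
  rw [phi_mul, phi_zt, map_add, map_sub, km_km, rr_rr, sub_self, zero_add]

lemma phi_nat {m n : ℕ} (θ : ⦋m⦌ ⟶ ⦋n⦌) (h : GG G n) : phi L (gm θ h) = km (dec θ) (phi L h) := by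
  refine L.ind n (fun h => phi L (gm θ h) = km (dec θ) (phi L h)) (by simp [phi_one]) (fun x h => ?_) h
  have : phi L (gm θ (zt ζ x)) = km (dec θ) (phi L (zt ζ x)) := by
    rw [zt_nat, phi_mul, phi_inv, phi_zt, phi_zt, phi_zt, map_sub, km_km (rr m) (dec θ), km_km (rr m) (dec θ), km_km (rr m ≫ dec θ), Category.assoc, rr_dec]
    abel
  rw [map_mul, phi_mul, phi_mul, map_add, this]
  simp

lemma phi_zt' {n : ℕ} (x : KK K (n + 1)) (h : km (rr n) x = 0) : phi L (zt ζ x) = x := by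
  rw [phi_zt, h, sub_zero]

noncomputable def sp {n : ℕ} (h : GG G n) : GG G n := zt ζ (phi L h)

lemma sp_nat {m n : ℕ} (θ : ⦋m⦌ ⟶ ⦋n⦌) (h : GG G n) : gm θ (sp L h) = sp L (gm θ h) := by
  rw [sp, zt_nat, rr_phi, map_zero, zt_zero, inv_one, one_mul, sp, phi_nat]

lemma sp_sp {n : ℕ} (h : GG G n) : sp L (sp L h) = sp L h := by
  rw [sp, sp, phi_zt' _ _ (rr_phi _ _)]

lemma sp_one {n : ℕ} : sp L (1 : GG G n) = 1 := by
  rw [sp, phi_one, zt_zero]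

noncomputable def qq {n : ℕ} (ε : ⦋n⦌ ⟶ ⦋1⦌) (x : KK K (n + 1)) (h : GG G n) : GG G n :=
  h⁻¹ * (zt ζ (km (eh ε) x))⁻¹ * zt ζ (km (eh ε) x + phi L h)

lemma qq_nat {m n : ℕ} (θ : ⦋m⦌ ⟶ ⦋n⦌) (ε : ⦋n⦌ ⟶ ⦋1⦌) (x : KK K (n + 1)) (h : GG G n) :
    gm θ (qq L ε x h) = qq L (θ ≫ ε) (km (dec θ) x) (gm θ h) := by
  rw [qq, map_mul, map_mul, map_inv, map_inv, zt_nat, zt_nat, map_add (km (rr n)), rr_phi, add_zero, map_add, <- phi_nat,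
    km_km (dec θ) (eh ε), <- eh_dec, <- km_km, qq]
  group

noncomputable def uu {n : ℕ} (ε : ⦋n⦌ ⟶ ⦋1⦌) (x : KK K (n + 1)) (h : GG G n) : GG G n :=
  qq L ε x h * (qq L ε (km (rr n) x) (zt ζ x * h))⁻¹

lemma bb_ex {n : ℕ} (ε : ⦋n⦌ ⟶ ⦋1⦌) : ∃ b : GG G n → GG G n, b 1 = 1 ∧
    ∀ x h, b (zt ζ x * h) = b h * uu L ε x h := by
  obtain ⟨F, hF⟩ := L.lift n (Equiv.Perm (GG G n × GG G n)) (fun x =>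
    { toFun := fun p => (zt ζ x * p.1, p.2 * uu L ε x p.1)
      invFun := fun p => ((zt ζ x)⁻¹ * p.1, p.2 * (uu L ε x ((zt ζ x)⁻¹ * p.1))⁻¹)
      left_inv := fun p => by simp
      right_inv := fun p => by simp }) (by
      intro x
      ext p : 1
      have e : km (rr n) (km (SimplexCategory.σ 0) x) = km (SimplexCategory.σ 0) x := by
        rw [km_km, rr, Category.assoc, SimplexCategory.δ_comp_σ_self' (by rfl), Category.comp_id]
      simp [uu, zt_s0, e])
  have h1 : ∀ h, (F h (1, 1)).1 = h := by
    refine L.ind n _ (by simp) fun x h => ?_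
    rw [map_mul, Equiv.Perm.mul_apply, hF]
    simp
  refine ⟨fun h => (F h (1, 1)).2, by simp, fun x h => ?_⟩
  beta_reduce
  rw [map_mul, Equiv.Perm.mul_apply, hF]
  simp [h1]

noncomputable def bb {n : ℕ} (ε : ⦋n⦌ ⟶ ⦋1⦌) : GG G n → GG G n := (bb_ex L ε).choose
lemma bb_one {n : ℕ} (ε : ⦋n⦌ ⟶ ⦋1⦌) : bb L ε 1 = 1 := (bb_ex L ε).choose_spec.1
lemma bb_mul {n : ℕ} (ε : ⦋n⦌ ⟶ ⦋1⦌) (x h) : bb L ε (zt ζ x * h) = bb L ε h * uu L ε x h := (bb_ex L ε).choose_spec.2 x h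

lemma bb_nat {m n : ℕ} (θ : ⦋m⦌ ⟶ ⦋n⦌) (ε : ⦋n⦌ ⟶ ⦋1⦌) (h : GG G n) :
    gm θ (bb L ε h) = bb L (θ ≫ ε) (gm θ h) := by
  refine L.ind n (fun h => gm θ (bb L ε h) = bb L (θ ≫ ε) (gm θ h)) (by simp [bb_one]) (fun x h => ?_) h
  have key : bb L (θ ≫ ε) (gm θ (zt ζ x * h)) = bb L (θ ≫ ε) (gm θ h) * gm θ (uu L ε x h) := by
    rw [uu, map_mul (gm θ) (qq _ _ _ _), map_inv, qq_nat, qq_nat]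
    set k := gm θ (zt ζ x * h) with hk
    set a := km (dec θ) x with ha
    set c := km (dec θ) (km (rr n) x) with hc
    have e1 : zt ζ c * k = zt ζ a * gm θ h := by
      rw [hk, map_mul, zt_nat, <- ha, <- hc]; group
    have e2 := bb_mul L (θ ≫ ε) a (gm θ h)
    have e3 := bb_mul L (θ ≫ ε) c k
    have e4 : km (rr m) c = km (rr m) a := by
      rw [ha, hc, km_km, km_km, km_km, Category.assoc, rr_dec]
    rw [<- e1, e3, uu, uu, e1, e4] at e2
    have e5 := eq_mul_inv_of_mul_eq e2
    rw [e5]; group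
  rw [key, bb_mul, map_mul]
  constructor
  · intro h; rw [h]
  · intro h; exact mul_right_cancel h

def cst (n : ℕ) (v : Fin 2) : ⦋n⦌ ⟶ ⦋1⦌ := SimplexCategory.mkHom ⟨fun _ => v, fun _ _ _ => le_rfl⟩

lemma eh_cst1 (n : ℕ) : eh (cst n 1) = 𝟙 _ := by
  refine hom_ext' (Fin.cases rfl ?_)
  intro i; rw [eh_succ]; rfl

lemma bb_cst1 {n : ℕ} (h : GG G n) : bb L (cst n 1) h = 1 := by
  refine L.ind n (fun h => bb L (cst n 1) h = 1) (bb_one _ _) (fun x h => ?_) h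
  have : uu L (cst n 1) x h = 1 := by
    simp only [uu, qq, eh_cst1, km_id, zt_rr, phi_mul, phi_zt]
    have e : km (rr n) x + (x - km (rr n) x + phi L h) = x + phi L h := by abel
    rw [e]; group
  rw [bb_mul, this, mul_one]

noncomputable def dg {n : ℕ} (h : GG G n) : GG G n := h⁻¹ * sp L h

lemma bb_cst0 (h0 : ∀ x : KK K 0, x = 0) {n : ℕ} (h : GG G n) : bb L (cst n 0) h = (dg L h)⁻¹ := by
  have e : ∀ x : KK K (n + 1), km (eh (cst n 0)) x = 0 := by
    intro x
    let c : ⦋n + 1⦌ ⟶ ⦋0⦌ := SimplexCategory.mkHom ⟨fun _ => 0, fun _ _ _ => le_rfl⟩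
    let d : ⦋0⦌ ⟶ ⦋n + 1⦌ := SimplexCategory.mkHom ⟨fun _ => 0, fun _ _ _ => le_rfl⟩
    have : eh (cst n 0) = c ≫ d := by
      refine hom_ext' (Fin.cases rfl ?_)
      intro i; rw [eh_succ]; rfl
    rw [this, <- km_km, h0 (km d x), map_zero]
  refine L.ind n (fun h => bb L (cst n 0) h = (dg L h)⁻¹) (by simp [bb_one, dg, sp_one]) (fun x h => ?_) h
  have : uu L (cst n 0) x h = dg L h * (dg L (zt ζ x * h))⁻¹ := by
    simp only [uu, qq, e, zt_zero, zero_add, dg, sp, inv_one, mul_one]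
  rw [bb_mul, this]
  constructor
  · intro h; rw [h]; group
  · intro h
    rw [<- mul_assoc] at h
    exact eq_inv_of_mul_eq_one_left (mul_eq_right.1 h)

noncomputable def HH {n : ℕ} (ε : ⦋n⦌ ⟶ ⦋1⦌) (h : GG G n) : GG G n :=
  h * (bb L ε h * dg L h) * (bb L ε (sp L h) * dg L (sp L h))⁻¹

lemma HH_nat {m n : ℕ} (θ : ⦋m⦌ ⟶ ⦋n⦌) (ε : ⦋n⦌ ⟶ ⦋1⦌) (h : GG G n) :
    gm θ (HH L ε h) = HH L (θ ≫ ε) (gm θ h) := by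
  simp only [HH, map_mul, map_inv, dg, bb_nat, sp_nat]

lemma HH_1 {n : ℕ} (h : GG G n) : HH L (cst n 1) h = sp L h := by
  simp [HH, bb_cst1, dg, sp_sp]

lemma HH_0 (h0 : ∀ x : KK K 0, x = 0) {n : ℕ} (h : GG G n) : HH L (cst n 0) h = h := by
  simp [HH, bb_cst0 _ h0]

lemma HH_sp {n : ℕ} (ε : ⦋n⦌ ⟶ ⦋1⦌) (h : GG G n) (hh : sp L h = h) : HH L ε h = h := by
  rw [HH, hh]; group

end loop
end HopfModel

namespace HopfModel
set_option linter.unusedVariables false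
open Opposite MonoidalCategory

section sdr

def mkMap {X Y : SSet.{0}} (f : ∀ n : ℕ, X _⦋n⦌ → Y _⦋n⦌)
    (h : ∀ {m n : ℕ} (θ : ⦋m⦌ ⟶ ⦋n⦌) (x : X _⦋n⦌), f m (X.map θ.op x) = Y.map θ.op (f n x)) : X ⟶ Y where
  app U := ↾ (f U.unop.len)
  naturality U V φ := by
    ext x
    exact h (m := V.unop.len) (n := U.unop.len) φ.unop x

lemma sset_ext {X Y : SSet.{0}} {f g : X ⟶ Y} (h : ∀ (n : ℕ) (x : X _⦋n⦌), f.app (op ⦋n⦌) x = g.app (op ⦋n⦌) x) : f = g := by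
  ext U x
  exact h U.unop.len x

lemma sdr_anodyne {X : SSet.{0}} (A : X.Subcomplex) (H : ∀ n : ℕ, (⦋n⦌ ⟶ ⦋1⦌) → X _⦋n⦌ → X _⦋n⦌)
    (hn : ∀ {m n : ℕ} (θ : ⦋m⦌ ⟶ ⦋n⦌) (ε) (x : X _⦋n⦌), X.map θ.op (H n ε x) = H m (θ ≫ ε) (X.map θ.op x))
    (h0 : ∀ (n : ℕ) (x : X _⦋n⦌), H n (cst n 0) x = x)
    (h1 : ∀ (n : ℕ) (x : X _⦋n⦌), H n (cst n 1) x ∈ A.obj _)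
    (hA : ∀ (n : ℕ) (ε) (x : X _⦋n⦌), x ∈ A.obj _ → H n ε x = x) : SSet.anodyneExtensions A.ι := by
  let Hm : X ⊗ Δ[1] ⟶ X := mkMap (fun n p => H n (SSet.stdSimplex.objEquiv p.2) p.1) (by
    intro m n θ x
    exact (hn θ (SSet.stdSimplex.objEquiv x.2) x.1).symm)
  let W := A.unionProd (SSet.horn 1 1)
  have hW : SSet.anodyneExtensions W.ι := SSet.anodyneExtensions_unionProd_ι A _ (SSet.anodyneExtensions.horn_ι (n := 1) 1)
  let I0 : X ⟶ X ⊗ Δ[1] := mkMap (fun n x => (x, SSet.stdSimplex.objEquiv.symm (cst n 0))) (by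
    intro m n θ x
    rfl)
  have e0 : I0 ≫ Hm = 𝟙 X := sset_ext fun n x => h0 n x
  have r1 : SSet.Subcomplex.range (A.ι ≫ I0) ≤ W := by
    rintro U _ ⟨x, rfl⟩
    exact (SSet.Subcomplex.mem_unionProd_iff _ _ _).2 (Or.inr x.2)
  have r2 : SSet.Subcomplex.range (W.ι ≫ Hm) ≤ A := by
    rintro ⟨⟨n⟩⟩ _ ⟨⟨⟨x, s⟩, hx⟩, rfl⟩
    change H n (SSet.stdSimplex.objEquiv s) x ∈ A.obj (op ⦋n⦌)
    rcases (SSet.Subcomplex.mem_unionProd_iff _ _ _).1 hx with h | h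
    · obtain ⟨j, hj, hj'⟩ := (SSet.mem_horn_iff_notMem_range s _).1 h
      have : SSet.stdSimplex.objEquiv s = cst n 1 := by
        refine hom_ext' fun i => ?_
        have : s i ≠ j := fun h => hj' ⟨i, h⟩
        change s i = 1
        lia
      rw [this]
      exact h1 n x
    · rw [hA n _ x h]
      exact h
  have R : RetractArrow A.ι W.ι :=
    { i := Arrow.homMk (SSet.Subcomplex.lift (A.ι ≫ I0) r1) I0 rfl
      r := Arrow.homMk (SSet.Subcomplex.lift (W.ι ≫ Hm) r2) Hm rfl
      retract := by
        ext : 1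
        · rw [<- cancel_mono A.ι]
          change A.ι ≫ (I0 ≫ Hm) = A.ι
          rw [e0, Category.comp_id]
        · exact e0 }
  exact MorphismProperty.of_retract R hW

end sdr

section loop
variable {K : SimplicialObject AddCommGrpCat.{0}} {G : SimplicialObject GrpCat.{0}}
variable {ζ : TwistingFunction (K ⋙ forget AddCommGrpCat) G} (L : IsLoop ζ)

def Asub : (uSSet G).Subcomplex where
  obj U := Set.ofPred fun h => sp L (n := U.unop.len) h = h
  map {U V} φ h hh := by

    exact (sp_nat L (m := V.unop.len) (n := U.unop.len) φ.unop h).symm.trans (congrArg (gm (G := G) (m := V.unop.len) (n := U.unop.len) φ.unop) hh)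

lemma Asub_anodyne (h0 : ∀ x : KK K 0, x = 0) : SSet.anodyneExtensions (Asub L).ι :=
  sdr_anodyne (X := uSSet G) (Asub L) (fun n ε h => HH L ε h) (fun θ ε x => HH_nat L θ ε x) (fun n x => HH_0 L h0 x)
    (fun n x => (congrArg (sp L) (HH_1 L x)).trans ((sp_sp L x).trans (HH_1 L x).symm)) (fun n ε x hx => HH_sp L ε x hx)

end loop

lemma isLoop_of {G : SimplicialObject GrpCat.{0}} (ζ : TwistingFunction GammaZ2SSet G)
    (ψ : ∀ n : ℕ, PresentedGroup (loopRels GammaZ2SSet n) ≃* (G _⦋n⦌ : Type))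
    (hψ : ∀ (n : ℕ) (x : GammaZ2SSet _⦋n + 1⦌), ψ n (PresentedGroup.of x) = ζ.map n x) :
    IsLoop (K := GammaZ2) ζ where
  lift n M _ f hf := by
    have : ∀ r ∈ loopRels GammaZ2SSet n, FreeGroup.lift (β := M) (α := GammaZ2SSet _⦋n + 1⦌) f r = 1 := by
      rintro _ ⟨x, rfl⟩
      exact (FreeGroup.lift_apply_of (β := M) (α := GammaZ2SSet _⦋n + 1⦌)).trans (hf x)
    refine ⟨(PresentedGroup.toGroup this).comp (ψ n).symm.toMonoidHom, fun x => ?_⟩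
    have h2 : (ψ n).symm (zt (K := GammaZ2) ζ x) = PresentedGroup.of (rels := loopRels GammaZ2SSet n) (α := GammaZ2SSet _⦋n + 1⦌) x :=
      (MulEquiv.symm_apply_eq _).2 (hψ n x).symm
    change PresentedGroup.toGroup this ((ψ n).symm (zt (K := GammaZ2) ζ x)) = f x
    rw [h2]
    exact PresentedGroup.toGroup.of this
  ind n p h1 hp h := by
    obtain ⟨w, rfl⟩ := (ψ n).surjective h
    obtain ⟨w, rfl⟩ := PresentedGroup.mk_surjective _ w
    have key : ∀ w : FreeGroup (GammaZ2SSet _⦋n + 1⦌), ∀ h : GG G n, p h → p (ψ n (PresentedGroup.mk _ w) * h) := by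
      intro w
      induction w using FreeGroup.induction_on with
      | C1 => intro h hh; rw [map_one, map_one, one_mul]; exact hh
      | of x => intro h hh; exact (congrArg (fun z => p (z * h)) (hψ n x)).mpr ((hp x h).1 hh)
      | inv_of x _ =>
        intro h hh
        refine (hp x _).2 ?_
        have : zt (K := GammaZ2) ζ x * (ψ n (PresentedGroup.mk (loopRels GammaZ2SSet n) (FreeGroup.of (α := GammaZ2SSet _⦋n + 1⦌) x)⁻¹) * h) = h := by
          rw [map_inv, map_inv, <- mul_assoc]
          have e : ψ n (PresentedGroup.mk (loopRels GammaZ2SSet n) (FreeGroup.of (α := GammaZ2SSet _⦋n + 1⦌) x)) = zt (K := GammaZ2) ζ x := hψ n x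
          rw [e, mul_inv_cancel, one_mul]
        rw [this]
        exact hh
      | mul x y hx hy => intro h hh; rw [map_mul, map_mul, mul_assoc]; exact hx _ (hy _ hh)
    have := key w 1 h1
    rwa [mul_one] at this

end HopfModel

namespace HopfModel
open Opposite

section gamma
open AlgebraicTopology AlgebraicTopology.DoldKan

noncomputable abbrev PIg : (AlternatingFaceMapComplex.obj GammaZ2) ⟶ (AlternatingFaceMapComplex.obj GammaZ2) := PInfty

lemma gam_PInfty {m : ℕ} (hm : m ≠ 2) : PIg.f m = 0 := by
  have h := (Γ₀.splitting Z2).πSummand_comp_cofan_inj_id_comp_PInfty_eq_PInfty m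
  have hz : Limits.IsZero (Z2.X m) := HomologicalComplex.isZero_single_obj_X _ _ _ _ hm
  have : (Γ₀.splitting Z2).πSummand (SimplicialObject.Splitting.IndexSet.id (op ⦋m⦌)) = 0 := hz.eq_of_tgt _ _
  rw [this, Limits.zero_comp] at h
  exact h.symm

lemma gam0 (x : KK GammaZ2 0) : x = 0 :=
  congrArg (fun f : GammaZ2 _⦋0⦌ ⟶ GammaZ2 _⦋0⦌ => f x) (gam_PInfty (m := 0) (by norm_num))

lemma gam_van {m : ℕ} (hm : m + 1 ≠ 2) (x : KK GammaZ2 (m + 1))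
    (h : ∀ j : Fin (m + 1), km (SimplexCategory.δ j.succ) x = 0) : x = 0 := by
  let φ : AddCommGrpCat.of ℤ ⟶ GammaZ2 _⦋m + 1⦌ := AddCommGrpCat.ofHom (zmultiplesHom (KK GammaZ2 (m + 1)) x)
  have hv : HigherFacesVanish (m + 1) φ := by
    intro j _
    ext
    change km (SimplexCategory.δ j.succ) ((1 : ℤ) • x) = 0
    rw [one_zsmul, h]
  have h2 := hv.comp_P_eq_self
  have h4 : φ ≫ PIg.f (m + 1) = φ := h2
  rw [gam_PInfty hm, Limits.comp_zero] at h4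
  have h3 := congrArg (fun f : AddCommGrpCat.of ℤ ⟶ GammaZ2 _⦋m + 1⦌ => f 1) h4
  have h5 : 0 = (1 : ℤ) • x := h3
  rw [h5, one_zsmul]

lemma gam1 (x : KK GammaZ2 1) : x = 0 := gam_van (by norm_num) x fun _ => gam0 _

lemma gam_coc (x : KK GammaZ2 3) : km (SimplexCategory.δ 0) x - km (SimplexCategory.δ 1) x
    + km (SimplexCategory.δ 2) x - km (SimplexCategory.δ 3) x = 0 := by
  have h := PIg.comm 3 2
  have hv : HigherFacesVanish 2 (𝟙 (GammaZ2 _⦋1 + 1⦌)) := by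
    intro j _
    ext x
    exact gam1 _
  have h2 := hv.comp_P_eq_self
  rw [Category.id_comp] at h2
  have h4 : PIg.f 2 = 𝟙 _ := h2
  rw [gam_PInfty (by norm_num), Limits.zero_comp, h4, Category.comp_id] at h
  have h3 : (AlternatingFaceMapComplex.objD GammaZ2 2) x = 0 := by
    have := AlternatingFaceMapComplex.obj_d_eq GammaZ2 2
    rw [AlternatingFaceMapComplex.objD, <- this]
    exact (congrArg (fun f : GammaZ2 _⦋3⦌ ⟶ GammaZ2 _⦋2⦌ => f x) h).symm
  rw [AlternatingFaceMapComplex.objD] at h3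
  have e : (∑ i : Fin (2 + 2), (-1 : ℤ) ^ (i : ℕ) • GammaZ2.δ i) = GammaZ2.δ 0 - GammaZ2.δ 1 + GammaZ2.δ 2 - GammaZ2.δ 3 := by
    rw [Fin.sum_univ_four]
    simp [pow_succ]
    abel
  rw [e] at h3
  exact h3
end gamma
end HopfModel

namespace HopfModel
open Opposite

section bz

def Bz : SSet.{0} where
  obj U := {v : Fin (U.unop.len + 1) → ℤ // v 0 = 0}
  map φ := ↾ fun v => ⟨fun i => v.1 (φ.unop.toOrderHom i) - v.1 (φ.unop.toOrderHom 0), sub_self _⟩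
  map_id U := by
    ext v i
    change v.1 i - v.1 0 = v.1 i
    rw [v.2, sub_zero]
  map_comp f g := by
    ext v i
    exact (sub_sub_sub_cancel_right _ _ _).symm

lemma bz_ext {n : ℕ} {v w : Bz _⦋n⦌} (h : ∀ i, v.1 i = w.1 i) : v = w := Subtype.ext (funext h)

lemma bz_δ {n : ℕ} (j : Fin (n + 2)) (v : Bz _⦋n + 1⦌) (i) :
    (Bz.δ j v).1 i = v.1 (j.succAbove i) - v.1 (j.succAbove 0) := rfl

lemma bz_δ0 {n : ℕ} (v : Bz _⦋n + 1⦌) (i) : (Bz.δ 0 v).1 i = v.1 i.succ - v.1 1 := by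
  rw [bz_δ]; simp

lemma bz_δs {n : ℕ} (j : Fin (n + 1)) (v : Bz _⦋n + 1⦌) (i) :
    (Bz.δ j.succ v).1 i = v.1 (j.succ.succAbove i) := by
  rw [bz_δ]; simp [v.2]

lemma bz_nd {n : ℕ} (v : Bz _⦋n⦌) : v ∈ Bz.nonDegenerate n ↔ ∀ i : Fin n, v.1 i.castSucc ≠ v.1 i.succ := by
  rcases n with - | n
  · simp
  rw [SSet.mem_nonDegenerate_iff_notMem_degenerate, SSet.degenerate_eq_iUnion_range_σ]
  simp only [Set.mem_iUnion, not_exists]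
  refine forall_congr' fun i => not_congr ?_
  constructor
  · rintro ⟨w, rfl⟩
    change w.1 (i.predAbove i.castSucc) - w.1 (i.predAbove 0) = w.1 (i.predAbove i.succ) - w.1 (i.predAbove 0)
    simp
  · intro h
    refine ⟨Bz.δ i.succ v, bz_ext fun k => ?_⟩
    change (Bz.δ i.succ v).1 (i.predAbove k) - (Bz.δ i.succ v).1 (i.predAbove 0) = _
    have hp : i.predAbove (0 : Fin (n + 2)) = 0 := by simp
    have hq : (Bz.δ i.succ v).1 (i.predAbove (0 : Fin (n + 2))) = 0 := by rw [hp]; exact (Bz.δ i.succ v).2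
    refine (congrArg (fun z => _ - z) hq).trans ?_
    rw [sub_zero, bz_δs]
    by_cases hk : k = i.succ
    · subst hk
      rw [Fin.predAbove_succ_self, Fin.succAbove_of_castSucc_lt _ _ (by simp), h]
    · exact congrArg v.1 (Fin.succ_succAbove_predAbove hk)

def bgen : Bz _⦋1⦌ := ⟨fun i => i, rfl⟩

abbrev bC : Bz.Subcomplex := SSet.Subcomplex.ofSimplex bgen

lemma bC_01 {n : ℕ} (v : Bz _⦋n⦌) (h : v ∈ bC.obj _) (i) : v.1 i = 0 ∨ v.1 i = 1 := by
  obtain ⟨f, rfl⟩ := (SSet.Subcomplex.mem_ofSimplex_obj_iff _ _).1 h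
  change (((f.toOrderHom i : Fin 2) : ℕ) : ℤ) - (((f.toOrderHom 0 : Fin 2) : ℕ) : ℤ) = 0 ∨ (((f.toOrderHom i : Fin 2) : ℕ) : ℤ) - (((f.toOrderHom 0 : Fin 2) : ℕ) : ℤ) = 1
  have := f.toOrderHom.monotone (Fin.zero_le i)
  have h1 := (f.toOrderHom i).2
  simp only [SimplexCategory.len_mk] at h1
  have h2 : ((f.toOrderHom 0 : Fin 2) : ℕ) ≤ (f.toOrderHom i : Fin 2) := this
  lia

def wfill {n : ℕ} (v : Bz _⦋n + 1⦌) : Bz _⦋n + 2⦌ :=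
  ⟨fun i => if v.1 1 < 0 then (Fin.cons 0 (fun i : Fin (n + 2) => v.1 i + 1) : Fin (n + 3) → ℤ) i
    else (Fin.cons 0 (fun i : Fin (n + 2) => if i = 0 then 1 else v.1 i) : Fin (n + 3) → ℤ) i, by split_ifs <;> rfl⟩

def widx {n : ℕ} (v : Bz _⦋n + 1⦌) : Fin (n + 3) := if v.1 1 < 0 then 0 else 1

lemma wfill_neg {n : ℕ} {v : Bz _⦋n + 1⦌} (h : v.1 1 < 0) (i : Fin (n + 2)) : (wfill v).1 i.succ = v.1 i + 1 := by
  have : (wfill v).1 i.succ = _ := if_pos h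
  rw [this]; simp
lemma wfill_pos1 {n : ℕ} {v : Bz _⦋n + 1⦌} (h : ¬ v.1 1 < 0) : (wfill v).1 1 = 1 := by
  have : (wfill v).1 1 = _ := if_neg h
  rw [this]; rfl
lemma wfill_pos {n : ℕ} {v : Bz _⦋n + 1⦌} (h : ¬ v.1 1 < 0) (i : Fin (n + 1)) : (wfill v).1 i.succ.succ = v.1 i.succ := by
  have : (wfill v).1 i.succ.succ = _ := if_neg h
  rw [this]; simp

lemma wfill_1 {n : ℕ} (v : Bz _⦋n + 1⦌) : (wfill v).1 1 = 1 := by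
  by_cases h : v.1 1 < 0
  · have := wfill_neg h 0
    rw [v.2] at this
    exact this
  · exact wfill_pos1 h

lemma δ_wfill {n : ℕ} (v : Bz _⦋n + 1⦌) : Bz.δ (widx v) (wfill v) = v := by
  refine bz_ext fun i => ?_
  by_cases h : v.1 1 < 0
  · have : widx v = 0 := if_pos h
    rw [this, bz_δ0, wfill_1]
    have := wfill_neg h i
    lia
  · have : widx v = Fin.succ 0 := if_neg h
    rw [this, bz_δs]
    revert i
    refine Fin.cases ?_ fun i => ?_
    · rw [v.2]; simp [(wfill v).2]
    · rw [Fin.succ_succAbove_succ, Fin.zero_succAbove, wfill_pos h]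

lemma wfill_nd {n : ℕ} (v : Bz _⦋n + 1⦌) (h : v ∈ Bz.nonDegenerate _) (h1 : v.1 1 ≠ 1) : wfill v ∈ Bz.nonDegenerate _ := by
  rw [bz_nd] at h ⊢
  refine Fin.cases ?_ fun i => ?_
  · change (wfill v).1 0 ≠ (wfill v).1 1
    rw [wfill_1, (wfill v).2]; simp
  · by_cases hv : v.1 1 < 0
    · rw [wfill_neg hv, <- Fin.succ_castSucc, wfill_neg hv]
      have := h i
      lia
    · revert i
      refine Fin.cases ?_ fun i => ?_
      · rw [wfill_pos hv]
        change (wfill v).1 1 ≠ v.1 1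
        rw [wfill_1]; exact h1.symm
      · rw [wfill_pos hv, <- Fin.succ_castSucc, <- Fin.succ_castSucc, wfill_pos hv, Fin.succ_castSucc]
        exact h i.succ

lemma wfill_eq {n : ℕ} (w : Bz _⦋n + 2⦌) (h : w ∈ Bz.nonDegenerate _) (h1 : w.1 1 = 1) :
    ∃ v ∈ Bz.nonDegenerate (n + 1), v.1 1 ≠ 1 ∧ wfill v = w := by
  rw [bz_nd] at h
  have h2 : w.1 2 ≠ 1 := fun e => h 1 (h1.trans e.symm)
  by_cases h3 : w.1 2 < 1
  · have e1 : (Bz.δ 0 w).1 1 < 0 := by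
      rw [bz_δ0, h1]
      change w.1 2 - 1 < 0
      lia
    refine ⟨Bz.δ 0 w, (bz_nd _).2 fun i => ?_, by lia, bz_ext (Fin.cases ?_ fun i => ?_)⟩
    · rw [bz_δ0, bz_δ0]
      have := h i.succ
      rw [<- Fin.succ_castSucc] at this
      lia
    · rw [w.2, (wfill _).2]
    · rw [wfill_neg e1, bz_δ0]; lia
  · have e0 : (Bz.δ (Fin.succ 0) w).1 1 = w.1 2 := by
      rw [bz_δs]; rfl
    have e1 : ¬ (Bz.δ (Fin.succ 0) w).1 1 < 0 := by lia
    refine ⟨Bz.δ (Fin.succ 0) w, (bz_nd _).2 fun i => ?_, by lia, bz_ext (Fin.cases ?_ (Fin.cases ?_ fun i => ?_))⟩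
    · rw [bz_δs, bz_δs, Fin.succ_succAbove_succ, Fin.zero_succAbove]
      revert i
      refine Fin.cases ?_ fun i => ?_
      · have : w.1 ((Fin.succ (0 : Fin (n + 2))).succAbove (Fin.castSucc 0)) = 0 := by
          simp [w.2]
        rw [this]
        change 0 ≠ w.1 2
        lia
      · rw [<- Fin.succ_castSucc, Fin.succ_succAbove_succ, Fin.zero_succAbove]
        exact h i.succ.succ
    · rw [w.2, (wfill _).2]
    · change (wfill _).1 1 = w.1 1
      rw [wfill_1, h1]
    · rw [wfill_pos e1, bz_δs, Fin.succ_succAbove_succ, Fin.zero_succAbove]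

lemma δ_wfill_other {n : ℕ} (v : Bz _⦋n + 1⦌) (h0 : v.1 1 ≠ 0) (h1 : v.1 1 ≠ 1) (j : Fin (n + 3)) (hj : j ≠ widx v) :
    (Bz.δ j (wfill v)).1 1 = 0 ∨ (Bz.δ j (wfill v)).1 1 = 1 ∨ ((Bz.δ j (wfill v)).1 1).natAbs < (v.1 1).natAbs := by
  revert hj
  refine Fin.cases ?_ (Fin.cases ?_ fun i => ?_) j
  · intro h
    have hv : ¬ v.1 1 < 0 := fun e => h (if_pos e).symm
    right; right
    rw [bz_δ0, wfill_1]
    have := wfill_pos hv 0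
    change (wfill v).1 2 = v.1 1 at this
    change ((wfill v).1 2 - 1).natAbs < _
    lia
  · intro h
    have hv : v.1 1 < 0 := by by_contra e; exact h (if_neg e).symm
    right; right
    rw [bz_δs, Fin.succ_succAbove_one]
    have := wfill_neg hv 1
    change (wfill v).1 2 = v.1 1 + 1 at this
    change ((wfill v).1 2).natAbs < _
    lia
  · intro _
    right; left
    rw [bz_δs]
    have : (i.succ.succ).succAbove 1 = 1 := by
      rw [Fin.succ_succAbove_one]; simp
    rw [this, wfill_1]

structure bI where
  n : ℕ
  v : Bz _⦋n + 1⦌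
  nd : v ∈ Bz.nonDegenerate _
  n1 : v.1 1 ≠ 1

lemma bI.n0 (s : bI) : s.v.1 1 ≠ 0 := by
  have := (bz_nd _).1 s.nd 0
  intro h
  exact this (s.v.2.trans h.symm)

lemma bI.nm (s : bI) : s.v ∉ bC.obj _ := fun h => by
  rcases bC_01 _ h 1 with h | h
  · exact s.n0 h
  · exact s.n1 h

lemma bI.ext' {s t : bI} (h : SSet.S.mk s.v = SSet.S.mk t.v) : s = t := by
  obtain ⟨n, v, _, _⟩ := s
  obtain ⟨m, w, _, _⟩ := t
  have := SSet.S.dim_eq_of_mk_eq h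
  have : n = m := by lia
  subst this
  have := (SSet.S.ext_iff _ _).1 h
  change v = w at this
  subst this
  rfl

def bPC : bC.PairingCore where
  ι := bI
  dim s := s.n + 1
  simplex s := wfill s.v
  index s := widx s.v
  nonDegenerate₁ s := wfill_nd _ s.nd s.n1
  nonDegenerate₂ s := by rw [δ_wfill]; exact s.nd
  notMem₁ s h := s.nm (by
    rw [<- δ_wfill s.v]
    exact bC.map (SimplexCategory.δ (widx s.v)).op h)
  notMem₂ s := by rw [δ_wfill]; exact s.nm
  injective_type₁' {s t} h := by
    apply bI.ext'
    obtain ⟨n, v, _, _⟩ := s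
    obtain ⟨m, w, h3, h4⟩ := t
    have := SSet.S.dim_eq_of_mk_eq h
    have : n = m := by lia
    subst this
    have := (SSet.S.ext_iff _ _).1 h
    change wfill v = wfill w at this
    have hi : widx v = widx w := by
      by_contra hne
      have h5 := δ_wfill v
      rw [this] at h5
      have h6 := δ_wfill_other w (bI.n0 ⟨_, w, h3, h4⟩) h4 _ hne
      have h7 := δ_wfill_other v (bI.n0 ⟨_, v, ‹_›, ‹_›⟩) ‹_› _ (Ne.symm hne)
      rw [this, δ_wfill] at h7
      rw [h5] at h6
      have := bI.n0 ⟨_, w, h3, h4⟩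
      have := bI.n0 ⟨_, v, ‹_›, ‹_›⟩
      simp only at *
      lia
    have : v = w := by rw [<- δ_wfill v, <- δ_wfill w, hi, this]
    exact congrArg SSet.S.mk this
  injective_type₂' {s t} h := by
    rw [δ_wfill, δ_wfill] at h
    exact bI.ext' h
  type₁_ne_type₂' s t h := by
    rw [δ_wfill] at h
    obtain ⟨n, v, _, _⟩ := s
    obtain ⟨m, w, h3, h4⟩ := t
    have := SSet.S.dim_eq_of_mk_eq h
    have : n + 1 = m := by simp only at this; lia
    subst this
    have := (SSet.S.ext_iff _ _).1 h
    simp only at this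
    apply h4
    rw [<- this]
    exact wfill_1 v
  surjective' x := by
    obtain ⟨⟨@⟨d, x⟩, nd⟩, nm⟩ := x
    change Bz _⦋d⦌ at x
    change x ∈ Bz.nonDegenerate d at nd
    change x ∉ bC.obj _ at nm
    change ∃ s : bI, SSet.S.mk x = SSet.S.mk (wfill s.v) ∨ SSet.S.mk x = SSet.S.mk (Bz.δ (widx s.v) (wfill s.v))
    rcases d with - | d
    · refine absurd ?_ nm
      refine (SSet.Subcomplex.mem_ofSimplex_obj_iff _ _).2 ⟨SimplexCategory.δ 1, bz_ext fun i => ?_⟩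
      rw [show i = 0 from Subsingleton.elim (α := Fin 1) i 0, x.2]
      rfl
    · by_cases h1 : x.1 1 = 1
      · rcases d with - | d
        · refine absurd ?_ nm
          refine (SSet.Subcomplex.mem_ofSimplex_obj_iff _ _).2 ⟨𝟙 _, bz_ext (Fin.forall_fin_two.2 ⟨?_, ?_⟩)⟩
          · rw [x.2]; rfl
          · rw [h1]; rfl
        · obtain ⟨v, h2, h3, rfl⟩ := wfill_eq x nd h1
          exact ⟨⟨d, v, h2, h3⟩, Or.inl rfl⟩
      · refine ⟨⟨d, x, nd, h1⟩, Or.inr ?_⟩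
        rw [δ_wfill]

instance : bPC.IsProper where
  isUniquelyCodimOneFace (s : bI) := by
    refine (SSet.S.IsUniquelyCodimOneFace.iff _ _).2 ⟨widx s.v, rfl, fun (j : Fin (s.n + 3)) hj => ?_⟩
    by_contra hne
    have h6 := δ_wfill_other s.v s.n0 s.n1 j hne
    have h7 : Bz.δ j (wfill s.v) = s.v := hj.trans (δ_wfill s.v)
    have h8 : (s.v.1 1) = 0 ∨ (s.v.1 1) = 1 ∨ ((s.v.1 1)).natAbs < (s.v.1 1).natAbs := by
      rw [h7] at h6
      exact h6
    have := s.n0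
    have := s.n1
    lia

def bRank : bPC.WeakRankFunction ℕ where
  rank (s : bI) := (s.v.1 1).natAbs
  lt {s t} h hd := by
    obtain ⟨n, v, h1, h2⟩ := s
    obtain ⟨m, w, h3, h4⟩ := t
    have : n + 1 = m + 1 := hd
    have : n = m := by lia
    subst this
    obtain ⟨hne, hlt⟩ := h
    obtain ⟨f, hf, e⟩ := SSet.N.le_iff_exists_mono.1 hlt.le
    obtain ⟨j, rfl⟩ : ∃ j, f = SimplexCategory.δ (n := n + 1) j := @SimplexCategory.eq_δ_of_mono (n + 1) f hf
    have e' : Bz.δ j (wfill w) = v := e.trans (δ_wfill v)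
    have hj : j ≠ widx w := by
      rintro rfl
      apply hne
      have : v = w := e'.symm.trans (δ_wfill w)
      subst this
      rfl
    have h6 := δ_wfill_other w (bI.n0 ⟨_, w, h3, h4⟩) h4 j hj
    rw [e'] at h6
    have := bI.n0 ⟨_, v, h1, h2⟩
    simp only at *
    lia

lemma bC_anodyne : SSet.anodyneExtensions bC.ι := by
  have := bRank.isRegular
  exact bPC.pairing.anodyneExtensions

end bz
end HopfModel

namespace HopfModel
set_option linter.unusedVariables false
open Opposite

section fz
open SimplexCategory (mkOfLe)
variable (e : KK GammaZ2 2 ≃+ ℤ)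

lemma mkOfLe_comp {m n : ℕ} (i j : Fin (m + 1)) (h : i ≤ j) (θ : ⦋m⦌ ⟶ ⦋n⦌) :
    mkOfLe i j h ≫ θ = mkOfLe (θ.toOrderHom i) (θ.toOrderHom j) (θ.toOrderHom.monotone h) :=
  hom_ext' (Fin.forall_fin_two.2 ⟨rfl, rfl⟩)

noncomputable def ww {n : ℕ} (a : KK GammaZ2 (n + 1)) (i j : Fin (n + 1)) (h : i ≤ j) : ℤ := e (km (dec (mkOfLe i j h)) a)

lemma ww_sub {n : ℕ} (a b : KK GammaZ2 (n + 1)) (i j : Fin (n + 1)) (h : i ≤ j) :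
    ww e (a - b) i j h = ww e a i j h - ww e b i j h := by
  rw [ww, map_sub, map_sub]; rfl

lemma ww_km {m n : ℕ} (θ : ⦋m⦌ ⟶ ⦋n⦌) (a : KK GammaZ2 (n + 1)) (i j : Fin (m + 1)) (h : i ≤ j) :
    ww e (km (dec θ) a) i j h = ww e a (θ.toOrderHom i) (θ.toOrderHom j) (θ.toOrderHom.monotone h) := by
  rw [ww, km_km, <- dec_comp, mkOfLe_comp]; rfl

lemma ww_self {n : ℕ} (a : KK GammaZ2 (n + 1)) (i : Fin (n + 1)) : ww e a i i le_rfl = 0 := by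
  have : mkOfLe i i le_rfl = SimplexCategory.σ 0 ≫ SimplexCategory.const ⦋0⦌ ⦋n⦌ i :=
    hom_ext' (Fin.forall_fin_two.2 ⟨rfl, rfl⟩)
  rw [ww, this, dec_comp, <- km_km, gam1 (km _ a), map_zero, map_zero]

lemma rr_km {m n : ℕ} (θ : ⦋m⦌ ⟶ ⦋n⦌) (a : KK GammaZ2 (n + 1)) (ha : km (rr n) a = 0) : km (rr m) (km (dec θ) a) = 0 := by
  rw [km_km, <- rr_dec, <- Category.assoc, <- km_km, ha, map_zero]

lemma ww_coc {n : ℕ} (a : KK GammaZ2 (n + 1)) (ha : km (rr n) a = 0) (i j k : Fin (n + 1)) (h1 : i ≤ j) (h2 : j ≤ k) :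
    ww e a i k (h1.trans h2) = ww e a i j h1 + ww e a j k h2 := by
  let θ : ⦋2⦌ ⟶ ⦋n⦌ := SimplexCategory.mkOfLeComp i j k h1 h2
  have h := gam_coc (km (dec θ) a)
  have d0 : km (SimplexCategory.δ (0 : Fin 4)) (km (dec θ) a) = 0 := by
    have : SimplexCategory.δ (0 : Fin 4) = SimplexCategory.δ (0 : Fin 4) ≫ rr 2 := by
      refine hom_ext' fun i => ?_
      rw [comp_ap, δ_ap, Fin.zero_succAbove, rr_succ]
    rw [this, <- km_km, rr_km _ _ ha, map_zero]
  have d1 : km (SimplexCategory.δ (1 : Fin 4)) (km (dec θ) a) = km (dec (mkOfLe j k h2)) a := by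
    rw [show SimplexCategory.δ (1 : Fin 4) = dec (SimplexCategory.δ (0 : Fin 3)) from (dec_δ (n := 1) 0).symm, km_km, <- dec_comp]
    exact congrArg (fun t => km (dec t) a) (hom_ext' (Fin.forall_fin_two.2 ⟨rfl, rfl⟩))
  have d2 : km (SimplexCategory.δ (2 : Fin 4)) (km (dec θ) a) = km (dec (mkOfLe i k (h1.trans h2))) a := by
    rw [show SimplexCategory.δ (2 : Fin 4) = dec (SimplexCategory.δ (1 : Fin 3)) from (dec_δ (n := 1) 1).symm, km_km, <- dec_comp]
    exact congrArg (fun t => km (dec t) a) (hom_ext' (Fin.forall_fin_two.2 ⟨rfl, rfl⟩))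
  have d3 : km (SimplexCategory.δ (3 : Fin 4)) (km (dec θ) a) = km (dec (mkOfLe i j h1)) a := by
    rw [show SimplexCategory.δ (3 : Fin 4) = dec (SimplexCategory.δ (2 : Fin 3)) from (dec_δ (n := 1) 2).symm, km_km, <- dec_comp]
    exact congrArg (fun t => km (dec t) a) (hom_ext' (Fin.forall_fin_two.2 ⟨rfl, rfl⟩))
  rw [d0, d1, d2, d3] at h
  have := congrArg e h
  rw [map_sub, map_add, map_sub, map_zero] at this
  change 0 - ww e a j k h2 + ww e a i k (h1.trans h2) - ww e a i j h1 = 0 at this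
  lia

lemma ww_inj {n : ℕ} : ∀ a : KK GammaZ2 (n + 1), km (rr n) a = 0 → (∀ i j h, ww e a i j h = 0) → a = 0 := by
  induction n with
  | zero => exact fun a _ _ => gam1 a
  | succ n ih =>
    rcases n with _ | n
    · intro a _ h
      have := h 0 1 (by simp)
      have e1 : dec (mkOfLe (0 : Fin 2) 1 (by simp)) = 𝟙 ⦋2⦌ := by
        rw [<- dec_id]; congr 1
        exact hom_ext' (Fin.forall_fin_two.2 ⟨rfl, rfl⟩)
      rw [ww, e1, km_id] at this
      exact e.map_eq_zero_iff.1 this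
    · intro a ha h
      refine gam_van (by lia) a fun j => ?_
      rw [<- dec_δ]
      refine ih _ (rr_km _ _ ha) fun i k hik => ?_
      rw [ww_km]
      exact h _ _ _

def al {n : ℕ} (p : Fin n) : ⦋n⦌ ⟶ ⦋1⦌ :=
  SimplexCategory.mkHom ⟨fun i => if p.castSucc < i then 1 else 0, fun a b h => by
    dsimp only
    split_ifs with h1 h2
    · exact le_rfl
    · exact absurd (h1.trans_le h) h2
    · simp
    · exact le_rfl⟩

lemma al_ap {n : ℕ} (p : Fin n) (i) : (al p).toOrderHom i = if p.castSucc < i then 1 else 0 := rfl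

lemma tele {n : ℕ} (v : Fin (n + 1) → ℤ) (k : Fin (n + 1)) :
    ∑ p : Fin n, (if p.castSucc < k then v p.succ - v p.castSucc else 0) = v k - v 0 := by
  induction k using Fin.induction with
  | zero => simp
  | succ k ih =>
    have : ∀ p : Fin n, (if p.castSucc < k.succ then v p.succ - v p.castSucc else 0) =
      (if p.castSucc < k.castSucc then v p.succ - v p.castSucc else 0) + if p = k then v p.succ - v p.castSucc else 0 := by
      intro p
      rcases lt_trichotomy p k with h | h | h
      · simp [h, h.le, h.ne]
      · simp [h]
      · simp [h.not_gt, h.ne', h]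
    simp only [this, Finset.sum_add_distrib, ih, Finset.sum_ite_eq', Finset.mem_univ, if_true]
    ring

noncomputable def ahat {n : ℕ} (g : KK GammaZ2 2) (v : Bz _⦋n⦌) : KK GammaZ2 (n + 1) :=
  ∑ p : Fin n, (v.1 p.succ - v.1 p.castSucc) • km (dec (al p)) g

lemma rr_g (g : KK GammaZ2 2) : km (rr 1) g = 0 := by
  rw [rr, <- km_km, gam1 (km _ g), map_zero]

lemma rr_ahat {n : ℕ} (g : KK GammaZ2 2) (v : Bz _⦋n⦌) : km (rr n) (ahat g v) = 0 := by
  rw [ahat, map_sum]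
  refine Finset.sum_eq_zero fun p _ => ?_
  rw [map_zsmul, rr_km _ _ (rr_g g), smul_zero]

lemma ww_g (g : KK GammaZ2 2) (hg : e g = 1) (i j : Fin 2) (h : i ≤ j) : ww e g i j h = (j : ℤ) - i := by
  have e1 : dec (mkOfLe (0 : Fin 2) 1 (by simp)) = 𝟙 ⦋2⦌ := by
    rw [<- dec_id]; congr 1
    exact hom_ext' (Fin.forall_fin_two.2 ⟨rfl, rfl⟩)
  revert i j
  refine Fin.forall_fin_two.2 ⟨Fin.forall_fin_two.2 ⟨?_, ?_⟩, Fin.forall_fin_two.2 ⟨?_, ?_⟩⟩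
  · intro _; rw [ww_self]; rfl
  · intro _; rw [ww, e1, km_id]; simpa using hg
  · intro h; simp at h
  · intro _; rw [ww_self]; rfl

lemma ww_ahat {n : ℕ} (g : KK GammaZ2 2) (hg : e g = 1) (v : Bz _⦋n⦌) (k : Fin (n + 1)) : ww e (ahat g v) 0 k (Fin.zero_le _) = v.1 k := by
  rw [ww, ahat, map_sum, map_sum]
  have := tele v.1 k
  rw [v.2, sub_zero] at this
  refine Eq.trans (Finset.sum_congr rfl fun p _ => ?_) this
  rw [map_zsmul, map_zsmul]
  change _ • ww e (km (dec (al p)) g) 0 k _ = _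
  rw [ww_km, ww_g e g hg, al_ap, al_ap]
  split_ifs with h1 h2 h2
  all_goals simp at *

variable {G : SimplicialObject GrpCat.{0}} {ζ : TwistingFunction (GammaZ2 ⋙ forget AddCommGrpCat) G} (L : IsLoop ζ)

lemma ff_nat {m n : ℕ} (θ : ⦋m⦌ ⟶ ⦋n⦌) (h : GG G n) (k : Fin (m + 1)) : ww e (phi L (gm θ h)) 0 k (Fin.zero_le _) =
    ww e (phi L h) 0 (θ.toOrderHom k) (Fin.zero_le _) - ww e (phi L h) 0 (θ.toOrderHom 0) (Fin.zero_le _) := by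
  have := ww_coc e (phi L h) (rr_phi L _) 0 (θ.toOrderHom 0) (θ.toOrderHom k) (Fin.zero_le _) (θ.toOrderHom.monotone (Fin.zero_le _))
  rw [phi_nat, ww_km]
  lia

lemma ff_inj {n : ℕ} (h h' : GG G n) (hk : ∀ k, ww e (phi L h) 0 k (Fin.zero_le _) = ww e (phi L h') 0 k (Fin.zero_le _)) :
    phi L h = phi L h' := by
  rw [<- sub_eq_zero]
  have hr : km (rr n) (phi L h - phi L h') = 0 := by rw [map_sub, rr_phi, rr_phi, sub_zero]
  refine ww_inj e _ hr fun i j hij => ?_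
  have h1 := ww_coc e _ hr 0 i j (Fin.zero_le _) hij
  rw [ww_sub, ww_sub, hk, hk] at h1
  lia

noncomputable def FF : (Asub L).toSSet ⟶ Bz := mkMap (fun n h => ⟨fun k => ww e (phi L h.1) 0 k (Fin.zero_le _), ww_self e _ _⟩)
  fun θ h => bz_ext fun k => ff_nat e L θ h.1 k

lemma FF_bij (g : KK GammaZ2 2) (hg : e g = 1) (n : ℕ) : Function.Bijective ((FF e L).app (op ⦋n⦌)) := by
  constructor
  · intro h h' hh
    exact Subtype.ext (h.2.symm.trans ((congrArg (zt ζ) (ff_inj e L h.1 h'.1 fun k =>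
      congrArg (fun z : Bz _⦋n⦌ => z.1 k) hh)).trans h'.2))
  · intro v
    have hp : phi L (zt ζ (ahat g v)) = ahat g v := phi_zt' L _ (rr_ahat g v)
    refine ⟨⟨zt ζ (ahat g v), congrArg (zt ζ) hp⟩, bz_ext fun k => ?_⟩
    change ww e (phi L (zt ζ (ahat g v))) 0 k _ = v.1 k
    rw [hp, ww_ahat e g hg]

lemma FF_g (g : KK GammaZ2 2) (hg : e g = 1) (h : zt ζ g ∈ (Asub L).obj (op ⦋1⦌)) : (FF e L).app (op ⦋1⦌) ⟨zt ζ g, h⟩ = bgen := by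
  refine bz_ext fun k => ?_
  change ww e (phi L (zt ζ g)) 0 k _ = _
  rw [phi_zt' L _ (rr_g g), ww_g e g hg]
  simp [bgen]

lemma range_anodyne {X Y : SSet.{0}} (f : X ⟶ Y) [Mono f] (hf : SSet.anodyneExtensions f) :
    SSet.anodyneExtensions (SSet.Subcomplex.range f).ι := by
  have : Mono (SSet.Subcomplex.toRange f) := by
    have : Mono (SSet.Subcomplex.toRange f ≫ (SSet.Subcomplex.range f).ι) := by
      rw [SSet.Subcomplex.toRange_ι]; infer_instance
    exact mono_of_mono _ (SSet.Subcomplex.range f).ι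
  have : IsIso (SSet.Subcomplex.toRange f) := isIso_of_mono_of_epi _
  refine (MorphismProperty.cancel_left_of_respectsIso SSet.anodyneExtensions (SSet.Subcomplex.toRange f) _).1 ?_
  rw [SSet.Subcomplex.toRange_ι]
  exact hf

lemma C_anodyne (L : IsLoop ζ) (g : KK GammaZ2 2) (hg : e g = 1) :
    SSet.anodyneExtensions (SSet.Subcomplex.ofSimplex (X := uSSet G) (n := 1) (zt ζ g)).ι := by
  have hA : zt ζ g ∈ (Asub L).obj (op ⦋1⦌) := congrArg (zt ζ) (phi_zt' L _ (rr_g g))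
  have : IsIso (FF e L) := by
    rw [NatTrans.isIso_iff_isIso_app]
    intro U
    rw [isIso_iff_bijective]
    exact FF_bij e L g hg U.unop.len
  have h1 : SSet.anodyneExtensions (inv (FF e L) ≫ (Asub L).ι) :=
    (MorphismProperty.cancel_left_of_respectsIso _ _ _).2 (Asub_anodyne L gam0)
  have h2 := MorphismProperty.comp_mem _ _ _ bC_anodyne h1
  have h3 := range_anodyne _ h2
  have h4 : SSet.Subcomplex.range (bC.ι ≫ inv (FF e L) ≫ (Asub L).ι) = SSet.Subcomplex.ofSimplex (X := uSSet G) (n := 1) (zt ζ g) := by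
    have hb : (inv (FF e L)).app (op ⦋1⦌) bgen = ⟨zt ζ g, hA⟩ := by
      rw [<- FF_g e L g hg hA]
      exact congrArg (fun t : (Asub L).toSSet ⟶ (Asub L).toSSet => t.app (op ⦋1⦌) ⟨zt ζ g, hA⟩) (IsIso.hom_inv_id (FF e L))
    have hk : (inv (FF e L) ≫ (Asub L).ι).app (op ⦋1⦌) bgen = zt ζ g := congrArg Subtype.val hb
    rw [SSet.Subcomplex.range_comp, show SSet.Subcomplex.range bC.ι = bC from Subfunctor.range_ι _]
    apply le_antisymm
    · rw [SSet.Subcomplex.image_le_iff, bC, SSet.Subcomplex.ofSimplex_le_iff]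
      refine (SSet.Subcomplex.mem_ofSimplex_obj_iff _ _).2 ⟨𝟙 _, ?_⟩
      rw [hk]; simp; rfl
    · refine (SSet.Subcomplex.ofSimplex_le_iff _ _).2 ?_
      exact ⟨bgen, SSet.Subcomplex.mem_ofSimplex_obj _, hk⟩
  rw [h4] at h3
  exact h3

end fz
end HopfModel

namespace HopfModel
set_option linter.unusedVariables false
open Opposite Limits

section po
variable {X Y : SSet.{0}} (f : X ⟶ Y) (V : X.Subcomplex) (Z Z' : Y.Subcomplex) (hZ : Z ≤ Z')

lemma po (h1 : ∀ (n : ℕ) (x : X _⦋n⦌), f.app (op ⦋n⦌) x ∈ Z'.obj _)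
    (h2 : ∀ (n : ℕ) (x : X _⦋n⦌), f.app (op ⦋n⦌) x ∈ Z.obj _ ↔ x ∈ V.obj _)
    (h3 : ∀ (n : ℕ) (x x' : X _⦋n⦌), x ∉ V.obj _ → x' ∉ V.obj _ → f.app (op ⦋n⦌) x = f.app (op ⦋n⦌) x' → x = x')
    (h4 : ∀ (n : ℕ) (z : Y _⦋n⦌), z ∈ Z'.obj _ → z ∈ Z.obj _ ∨ ∃ x, f.app (op ⦋n⦌) x = z) :
    ∃ (a : V.toSSet ⟶ Z.toSSet) (b : X ⟶ Z'.toSSet), IsPushout a V.ι (SSet.Subcomplex.homOfLE hZ) b := by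
  have r1 : SSet.Subcomplex.range (V.ι ≫ f) ≤ Z := by
    rintro U _ ⟨x, rfl⟩
    exact (h2 U.unop.len x.1).2 x.2
  have r2 : SSet.Subcomplex.range f ≤ Z' := by
    rintro U _ ⟨x, rfl⟩
    exact h1 U.unop.len x
  refine ⟨SSet.Subcomplex.lift _ r1, SSet.Subcomplex.lift f r2, ⟨⟨rfl⟩, ⟨evaluationJointlyReflectsColimits _ (fun ⟨⟨n⟩⟩ => ?_)⟩⟩⟩
  refine (isColimitMapCoconePushoutCoconeEquiv _ _).2 (IsPushout.isColimit ?_)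
  have : Mono (((evaluation SimplexCategoryᵒᵖ (Type)).obj (op ⦋n⦌)).map (SSet.Subcomplex.homOfLE hZ)) := by
    infer_instance
  refine Types.isPushout_of_isPullback_of_mono' ?_ ?_ ?_
  · rw [Types.isPullback_iff]
    refine ⟨rfl, fun x y h => Subtype.ext h.2, fun z x h => ?_⟩
    have hz : f.app (op ⦋n⦌) x = z.1 := (congrArg Subtype.val h).symm
    exact ⟨⟨x, (h2 n x).1 (hz ▸ z.2)⟩, Subtype.ext hz, rfl⟩
  · refine Set.eq_univ_of_forall fun z => ?_
    rcases h4 n z.1 z.2 with h | ⟨x, h⟩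
    · exact Or.inl ⟨⟨z.1, h⟩, rfl⟩
    · exact Or.inr ⟨x, Subtype.ext h⟩
  · intro x x' hx hx' h
    exact h3 n x x' (fun h => hx ⟨⟨x, h⟩, rfl⟩) (fun h => hx' ⟨⟨x', h⟩, rfl⟩) (congrArg Subtype.val h)

lemma po_an (hV : SSet.anodyneExtensions V.ι) (h1 : ∀ (n : ℕ) (x : X _⦋n⦌), f.app (op ⦋n⦌) x ∈ Z'.obj _)
    (h2 : ∀ (n : ℕ) (x : X _⦋n⦌), f.app (op ⦋n⦌) x ∈ Z.obj _ ↔ x ∈ V.obj _)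
    (h3 : ∀ (n : ℕ) (x x' : X _⦋n⦌), x ∉ V.obj _ → x' ∉ V.obj _ → f.app (op ⦋n⦌) x = f.app (op ⦋n⦌) x' → x = x')
    (h4 : ∀ (n : ℕ) (z : Y _⦋n⦌), z ∈ Z'.obj _ → z ∈ Z.obj _ ∨ ∃ x, f.app (op ⦋n⦌) x = z) :
    SSet.anodyneExtensions (SSet.Subcomplex.homOfLE hZ) := by
  obtain ⟨a, b, h⟩ := po f V Z Z' hZ h1 h2 h3 h4
  exact MorphismProperty.of_isPushout h hV
end po
end HopfModel

namespace HopfModel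
set_option linter.unusedVariables false
open Opposite

section S2
variable {S2 : SSet.{0}} {y : S2 _⦋2⦌} (hS : IsMinimalS2 S2 y)

lemma smap_smap {X : SSet.{0}} {a b c : ℕ} (f : ⦋a⦌ ⟶ ⦋b⦌) (g : ⦋b⦌ ⟶ ⦋c⦌) (x : X _⦋c⦌) :
    X.map f.op (X.map g.op x) = X.map (f ≫ g).op x := by
  rw [op_comp, X.map_comp]; rfl
lemma smap_id {X : SSet.{0}} {a : ℕ} (x : X _⦋a⦌) : X.map (𝟙 ⦋a⦌ : ⦋a⦌ ⟶ ⦋a⦌).op x = x := by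
  rw [op_id, X.map_id]; rfl

def tt (n : ℕ) : ⦋n⦌ ⟶ ⦋0⦌ := SimplexCategory.const ⦋n⦌ ⦋0⦌ 0
lemma tt_eq {n : ℕ} (f : ⦋n⦌ ⟶ ⦋0⦌) : f = tt n := hom_ext' fun i => Subsingleton.elim (α := Fin 1) _ _

def bp (v : S2 _⦋0⦌) (n : ℕ) : S2 _⦋n⦌ := S2.map (tt n).op v

lemma bp_map (v : S2 _⦋0⦌) {m n : ℕ} (θ : ⦋m⦌ ⟶ ⦋n⦌) : S2.map θ.op (bp v n) = bp v m := by
  rw [bp, smap_smap, tt_eq (θ ≫ _)]; rfl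

def sj {n k : ℕ} (b : ⦋n⦌ ⟶ ⦋k⦌) : Prop := Function.Surjective b.toOrderHom

lemma sj_sec {n k : ℕ} (b : ⦋n⦌ ⟶ ⦋k⦌) (h : sj b) (i : Fin (n + 1)) :
    ∃ s : ⦋k⦌ ⟶ ⦋n⦌, s ≫ b = 𝟙 _ ∧ s.toOrderHom (b.toOrderHom i) = i := by
  choose s hs using h
  let t : Fin (k + 1) → Fin (n + 1) := fun j => if j = b.toOrderHom i then i else s j
  have ht : ∀ j, b.toOrderHom (t j) = j := by
    intro j
    by_cases hj : j = b.toOrderHom i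
    · simp [t, hj]
    · simp only [t, hj, if_false]; exact hs j
  refine ⟨SimplexCategory.mkHom ⟨t, fun a c hac => ?_⟩, hom_ext' ht, ?_⟩
  · by_contra hcon
    have h1 := b.toOrderHom.monotone (not_le.1 hcon).le
    rw [ht, ht] at h1
    obtain rfl := le_antisymm hac h1
    exact hcon le_rfl
  · exact if_pos rfl

lemma s2_cases (hS : IsMinimalS2 S2 y) (v : S2 _⦋0⦌) : ∀ (n : ℕ) (z : S2 _⦋n⦌), z = bp v n ∨ ∃ b : ⦋n⦌ ⟶ ⦋2⦌, sj b ∧ z = S2.map b.op y := by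
  intro n
  induction n with
  | zero => exact fun z => Or.inl (hS.subsingleton₀.elim _ _)
  | succ n ih =>
    have key : ∀ (i : Fin (n + 1)) (w : S2 _⦋n⦌), S2.σ i w = bp v (n + 1) ∨ ∃ b : ⦋n + 1⦌ ⟶ ⦋2⦌, sj b ∧ S2.σ i w = S2.map b.op y := by
      intro i w
      rcases ih w with rfl | ⟨b, hb, rfl⟩
      · exact Or.inl (bp_map v (SimplexCategory.σ i))
      · refine Or.inr ⟨SimplexCategory.σ i ≫ b, ?_, smap_smap (SimplexCategory.σ i) b y⟩
        exact hb.comp (SimplexCategory.epi_iff_surjective.1 inferInstance : Function.Surjective (SimplexCategory.σ i).toOrderHom)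
    match n, key with
    | 0, _ => exact fun z => Or.inl (hS.subsingleton₁.elim _ _)
    | 1, key =>
      intro z
      rcases hS.two_simplices z with rfl | ⟨w, rfl⟩
      · exact Or.inr ⟨𝟙 _, fun i => ⟨i, rfl⟩, (smap_id z).symm⟩
      · exact key 0 w
    | n + 2, key =>
      intro z
      obtain ⟨i, w, rfl⟩ := hS.degen_above n z
      exact key i w

lemma s2_ne (hS : IsMinimalS2 S2 y) (v : S2 _⦋0⦌) {n : ℕ} (b : ⦋n⦌ ⟶ ⦋2⦌) (hb : sj b) : S2.map b.op y ≠ bp v n := by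
  intro h
  obtain ⟨s, hs, _⟩ := sj_sec b hb 0
  have := congrArg (S2.map s.op) h
  rw [smap_smap, hs, smap_id, bp_map] at this
  exact hS.nondegen₀ (bp v 1) (this.trans (bp_map v (SimplexCategory.σ 0)).symm)

lemma s2_id (hS : IsMinimalS2 S2 y) (b : ⦋2⦌ ⟶ ⦋2⦌) (h : S2.map b.op y = y) : b = 𝟙 _ := by
  by_contra hb
  have : ¬ Function.Injective b.toOrderHom := fun hi => hb (by
    have : Mono b := SimplexCategory.mono_iff_injective.2 hi
    exact SimplexCategory.eq_id_of_mono b)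
  obtain ⟨i, θ, rfl⟩ := SimplexCategory.eq_σ_comp_of_not_injective b this
  rw [<- smap_smap] at h
  match i with
  | 0 => exact hS.nondegen₀ _ h.symm
  | 1 => exact hS.nondegen₁ _ h.symm

lemma s2_inj (hS : IsMinimalS2 S2 y) {n : ℕ} (b b' : ⦋n⦌ ⟶ ⦋2⦌) (hb : sj b) (h : S2.map b.op y = S2.map b'.op y) : b = b' := by
  refine hom_ext' fun i => ?_
  obtain ⟨s, hs, hi⟩ := sj_sec b hb i
  have := congrArg (S2.map s.op) h
  rw [smap_smap, hs, smap_id, smap_smap] at this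
  have h1 := s2_id hS _ this.symm
  have h2 : (s ≫ b').toOrderHom (b.toOrderHom i) = b.toOrderHom i := by rw [h1]; rfl
  rw [comp_ap, hi] at h2
  exact h2.symm

lemma not_sj {n : ℕ} (b : ⦋n⦌ ⟶ ⦋2⦌) (h : ¬ sj b) : ∃ (j : Fin 3) (θ : ⦋n⦌ ⟶ ⦋1⦌), b = θ ≫ SimplexCategory.δ j :=
  SimplexCategory.eq_comp_δ_of_not_surjective b h
end S2

structure Mdl (G : SimplicialObject GrpCat.{0}) (t : GG G 1) (P : SSet.{0}) where
  Xi : ∀ {n : ℕ}, GG G n → (⦋n⦌ ⟶ ⦋2⦌) → P _⦋n⦌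
  Ph : ∀ {n : ℕ}, GG G n → P _⦋n⦌
  Xi_nat : ∀ {m n : ℕ} (θ : ⦋m⦌ ⟶ ⦋n⦌) (h : GG G n) (b : ⦋n⦌ ⟶ ⦋2⦌), P.map θ.op (Xi h b) = Xi (gm θ h) (θ ≫ b)
  Ph_nat : ∀ {m n : ℕ} (θ : ⦋m⦌ ⟶ ⦋n⦌) (h : GG G n), P.map θ.op (Ph h) = Ph (gm θ h)
  Ph_inj : ∀ {n : ℕ} (h h' : GG G n), Ph h = Ph h' → h = h'
  Xi0 : Xi 1 (SimplexCategory.δ 0) = Ph t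
  Xij : ∀ j : Fin 3, j ≠ 0 → Xi 1 (SimplexCategory.δ j) = Ph 1
  Xi_bd : ∀ {n : ℕ} (h : GG G n) (b : ⦋n⦌ ⟶ ⦋2⦌), ¬ sj b → ∃ h' : GG G n, Xi h b = Ph h'
  Xi_inj : ∀ {n : ℕ} (h h' : GG G n) (b b' : ⦋n⦌ ⟶ ⦋2⦌), sj b → Xi h b = Xi h' b' → h = h' ∧ b = b'
  Xi_ne : ∀ {n : ℕ} (h h' : GG G n) (b : ⦋n⦌ ⟶ ⦋2⦌), sj b → Xi h b ≠ Ph h'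
  cases : ∀ {n : ℕ} (z : P _⦋n⦌), (∃ h, z = Ph h) ∨ ∃ (h : GG G n) (b : ⦋n⦌ ⟶ ⦋2⦌), sj b ∧ z = Xi h b

section mk
variable {S2 : SSet.{0}} {y : S2 _⦋2⦌} {G : SimplicialObject GrpCat.{0}} {η : TwistingFunction S2 G}
  {P : SSet.{0}} {p : P ⟶ S2} (T : TCP G (uSSet G) S2 (leftMulAction G) η P p)

def rt {n : ℕ} (h : GG G n) (x : P _⦋n⦌) : P _⦋n⦌ := (T.e n).symm ((show GG G n from (T.e n x).1) * h, (T.e n x).2)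

lemma rt_e {n : ℕ} (h : GG G n) (x : P _⦋n⦌) : T.e n (rt T h x) = ((show GG G n from (T.e n x).1) * h, (T.e n x).2) :=
  (T.e n).apply_symm_apply _

lemma rt_nat {m n : ℕ} (θ : ⦋m⦌ ⟶ ⦋n⦌) : ∀ (h : GG G n) (x : P _⦋n⦌), P.map θ.op (rt T h x) = rt T (gm θ h) (P.map θ.op x) := by
  let W : MorphismProperty SimplexCategory := fun a b θ => ∀ (h : GG G b.len) (x : P _⦋b.len⦌),
    P.map θ.op (rt T (n := b.len) h x) = rt T (n := a.len) (gm (m := a.len) (n := b.len) θ h) (P.map θ.op x)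
  refine nat_of_gen W ?_ ?_ ?_ ?_ θ
  · intro n h x
    exact (smap_id _).trans ((congrArg₂ (rt T) (gm_id h) (smap_id x)).symm)
  · intro a b c f g hf hg h x
    exact (smap_smap f g _).symm.trans ((congrArg (P.map f.op) (hg h x)).trans ((hf _ _).trans
      (congrArg₂ (rt T) (gm_gm f g h) (smap_smap f g x))))
  · intro n i h x
    refine (T.e n).injective ?_
    refine Eq.trans ?_ (rt_e T _ _).symm
    induction i using Fin.cases with
    | zero =>
      refine (T.e_δ₀ n _).trans ?_
      refine (congrArg (fun E : (uSSet G) _⦋n + 1⦌ × S2 _⦋n + 1⦌ =>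
        ((leftMulAction G).act n (η.map n E.2) ((uSSet G).δ 0 E.1), S2.δ 0 E.2)) (rt_e T h x)).trans ?_
      refine Eq.trans ?_ (congrArg (fun E : (uSSet G) _⦋n⦌ × S2 _⦋n⦌ =>
        ((show GG G n from E.1) * gm (SimplexCategory.δ 0) h, E.2)) (T.e_δ₀ n x)).symm
      refine Prod.ext ?_ rfl
      exact (congrArg (fun k : GG G n => (show GG G n from η.map n (T.e (n + 1) x).2) * k)
        (map_mul (gm (SimplexCategory.δ 0)) (show GG G (n + 1) from (T.e (n + 1) x).1) h)).trans (mul_assoc _ _ _).symm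
    | succ i =>
      refine (T.e_δ n i _).trans ?_
      refine (congrArg (fun E : (uSSet G) _⦋n + 1⦌ × S2 _⦋n + 1⦌ =>
        ((uSSet G).δ i.succ E.1, S2.δ i.succ E.2)) (rt_e T h x)).trans ?_
      refine Eq.trans ?_ (congrArg (fun E : (uSSet G) _⦋n⦌ × S2 _⦋n⦌ =>
        ((show GG G n from E.1) * gm (SimplexCategory.δ i.succ) h, E.2)) (T.e_δ n i x)).symm
      exact Prod.ext (map_mul (gm (SimplexCategory.δ i.succ)) (show GG G (n + 1) from (T.e (n + 1) x).1) h) rfl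
  · intro n i h x
    refine (T.e (n + 1)).injective ?_
    refine Eq.trans ?_ (rt_e T _ _).symm
    refine (T.e_σ n i _).trans ?_
    refine (congrArg (fun E : (uSSet G) _⦋n⦌ × S2 _⦋n⦌ =>
        ((uSSet G).σ i E.1, S2.σ i E.2)) (rt_e T h x)).trans ?_
    refine Eq.trans ?_ (congrArg (fun E : (uSSet G) _⦋n + 1⦌ × S2 _⦋n + 1⦌ =>
      ((show GG G (n + 1) from E.1) * gm (SimplexCategory.σ i) h, E.2)) (T.e_σ n i x)).symm
    exact Prod.ext (map_mul (gm (SimplexCategory.σ i)) (show GG G n from (T.e n x).1) h) rfl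

def fb (v : S2 _⦋0⦌) {n : ℕ} (h : GG G n) : P _⦋n⦌ := (T.e n).symm (h, bp v n)

lemma fb_e (v : S2 _⦋0⦌) {n : ℕ} (h : GG G n) : T.e n (fb T v h) = (h, bp v n) := (T.e n).apply_symm_apply _

lemma η_bp (v : S2 _⦋0⦌) (n : ℕ) : η.map n (bp v (n + 1)) = 1 :=
  (congrArg (η.map n) (bp_map v (SimplexCategory.σ 0)).symm).trans (η.map_σ₀ n _)

lemma fb_nat (v : S2 _⦋0⦌) {m n : ℕ} (θ : ⦋m⦌ ⟶ ⦋n⦌) : ∀ h : GG G n, P.map θ.op (fb T v h) = fb T v (gm θ h) := by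
  let W : MorphismProperty SimplexCategory := fun a b θ => ∀ (h : GG G b.len),
    P.map θ.op (fb T v (n := b.len) h) = fb T v (n := a.len) (gm (m := a.len) (n := b.len) θ h)
  refine nat_of_gen W ?_ ?_ ?_ ?_ θ
  · intro n h
    exact (smap_id _).trans (congrArg (fb T v) (gm_id h)).symm
  · intro a b c f g hf hg h
    exact (smap_smap f g _).symm.trans ((congrArg (P.map f.op) (hg h)).trans ((hf _).trans (congrArg (fb T v) (gm_gm f g h))))
  · intro n i h
    refine (T.e n).injective ?_
    refine Eq.trans ?_ (fb_e T v _).symm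
    induction i using Fin.cases with
    | zero =>
      refine (T.e_δ₀ n _).trans ?_
      refine (congrArg (fun E : (uSSet G) _⦋n + 1⦌ × S2 _⦋n + 1⦌ =>
        ((leftMulAction G).act n (η.map n E.2) ((uSSet G).δ 0 E.1), S2.δ 0 E.2)) (fb_e T v h)).trans ?_
      refine Prod.ext ?_ (bp_map v _)
      exact (congrArg (fun k : GG G n => k * gm (SimplexCategory.δ 0) h) (η_bp v n)).trans (one_mul _)
    | succ i =>
      refine (T.e_δ n i _).trans ?_
      refine (congrArg (fun E : (uSSet G) _⦋n + 1⦌ × S2 _⦋n + 1⦌ =>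
        ((uSSet G).δ i.succ E.1, S2.δ i.succ E.2)) (fb_e T v h)).trans ?_
      exact Prod.ext rfl (bp_map v _)
  · intro n i h
    refine (T.e (n + 1)).injective ?_
    refine Eq.trans ?_ (fb_e T v _).symm
    refine (T.e_σ n i _).trans ?_
    refine (congrArg (fun E : (uSSet G) _⦋n⦌ × S2 _⦋n⦌ =>
        ((uSSet G).σ i E.1, S2.σ i E.2)) (fb_e T v h)).trans ?_
    exact Prod.ext rfl (bp_map v _)

lemma e_2 {m n : ℕ} (θ : ⦋m⦌ ⟶ ⦋n⦌) (x : P _⦋n⦌) : (T.e m (P.map θ.op x)).2 = S2.map θ.op (T.e n x).2 := by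
  rw [<- T.proj, <- T.proj]
  exact NatTrans.naturality_apply p θ.op x

def mdl (hS : IsMinimalS2 S2 y) (v : S2 _⦋0⦌) (t : GG G 1) (ht : η.map 1 y = t) : Mdl G t P :=
  let p0 : P _⦋2⦌ := (T.e 2).symm (show GG G 2 from 1, y)
  have hp0 : T.e 2 p0 = (show GG G 2 from 1, y) := (T.e 2).apply_symm_apply _
  have h2 {n : ℕ} (h : GG G n) (b : ⦋n⦌ ⟶ ⦋2⦌) : (T.e n (rt T h (P.map b.op p0))).2 = S2.map b.op y := by
    rw [rt_e]
    change (T.e n (P.map b.op p0)).2 = _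
    rw [e_2, hp0]
  have rt1 {n : ℕ} (x : P _⦋n⦌) : rt T (1 : GG G n) x = x := (T.e n).injective ((rt_e T _ _).trans (Prod.ext (mul_one (show GG G n from (T.e n x).1)) rfl))
  have y1 (w : S2 _⦋1⦌) : w = bp v 1 := hS.subsingleton₁.elim _ _
  { Xi := fun h b => rt T h (P.map b.op p0)
    Ph := fun h => fb T v h
    Xi_nat := fun θ h b => (rt_nat T θ _ _).trans (congrArg (rt T _) (smap_smap θ b p0))
    Ph_nat := fun θ h => fb_nat T v θ h
    Ph_inj := fun h h' e => congrArg Prod.fst ((T.e _).symm.injective e)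
    Xi0 := by
      refine (rt1 _).trans ((T.e 1).injective (((T.e_δ₀ 1 p0).trans ?_).trans (fb_e T v t).symm))
      rw [hp0]
      refine Prod.ext ?_ (y1 _)
      change (show GG G 1 from η.map 1 y) * gm (SimplexCategory.δ 0) (1 : GG G 2) = t
      rw [map_one, mul_one]; exact ht
    Xij := by
      intro j hj
      obtain ⟨i, rfl⟩ := Fin.exists_succ_eq.2 hj
      refine (rt1 _).trans ((T.e 1).injective (((T.e_δ 1 i p0).trans ?_).trans (fb_e T v 1).symm))
      rw [hp0]
      exact Prod.ext (map_one (gm (SimplexCategory.δ i.succ))) (y1 _)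
    Xi_bd := by
      intro n h b hb
      refine ⟨(T.e n (rt T h (P.map b.op p0))).1, (T.e n).injective (Eq.trans (b := ((T.e n (rt T h (P.map b.op p0))).1, bp v n)) (Prod.ext rfl ?_) (fb_e T v _).symm)⟩
      rw [h2]
      obtain ⟨j, θ, rfl⟩ := not_sj b hb
      rw [<- smap_smap, y1 (S2.map _ y), bp_map]
    Xi_inj := by
      intro n h h' b b' hb e
      have hb' : b = b' := s2_inj hS b b' hb (by rw [<- h2 h b, e, h2])
      subst hb'
      have := congrArg Prod.fst ((rt_e T _ _).symm.trans ((congrArg (T.e n) e).trans (rt_e T _ _)))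
      exact ⟨mul_left_cancel this, rfl⟩
    Xi_ne := by
      intro n h h' b hb e
      refine s2_ne hS v b hb ?_
      rw [<- h2 h b, e, fb_e]
    cases := by
      intro n z
      rcases s2_cases hS v n (T.e n z).2 with hz | ⟨b, hb, hz⟩
      · exact Or.inl ⟨(T.e n z).1, (T.e n).injective (Eq.trans (b := ((T.e n z).1, bp v n)) (Prod.ext rfl hz) (fb_e T v _).symm)⟩
      · refine Or.inr ⟨(show GG G n from (T.e n (P.map b.op p0)).1)⁻¹ * (show GG G n from (T.e n z).1), b, hb, (T.e n).injective ?_⟩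
        refine Eq.trans ?_ (rt_e T _ _).symm
        refine Prod.ext (mul_inv_cancel_left (show GG G n from (T.e n (P.map b.op p0)).1) (show GG G n from (T.e n z).1)).symm ?_
        change (T.e n z).2 = (T.e n (P.map b.op p0)).2
        rw [e_2, hp0, hz] }
end mk
end HopfModel

namespace HopfModel
set_option linter.unusedVariables false
open Opposite MonoidalCategory

section att
variable {P : SSet.{0}} {k : ℕ} (q : P _⦋k⦌) (Z : P.Subcomplex)

lemma att (V : (Δ[k] : SSet.{0}).Subcomplex) (p : ∀ {n : ℕ}, (⦋n⦌ ⟶ ⦋k⦌) → Prop)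
    (hV : ∀ (n : ℕ) (x : (Δ[k] : SSet.{0}) _⦋n⦌), x ∈ V.obj _ ↔ p (SSet.stdSimplex.objEquiv x))
    (h2 : ∀ {n : ℕ} (θ : ⦋n⦌ ⟶ ⦋k⦌), P.map θ.op q ∈ Z.obj _ ↔ p θ)
    (h3 : ∀ {n : ℕ} (θ θ' : ⦋n⦌ ⟶ ⦋k⦌), ¬ p θ → ¬ p θ' → P.map θ.op q = P.map θ'.op q → θ = θ') :
    ∃ (a : V.toSSet ⟶ Z.toSSet) (b : Δ[k] ⟶ (Z ⊔ SSet.Subcomplex.ofSimplex q).toSSet),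
      IsPushout a V.ι (SSet.Subcomplex.homOfLE (le_sup_left : Z ≤ Z ⊔ SSet.Subcomplex.ofSimplex q)) b := by
  refine po (SSet.yonedaEquiv.symm q) V Z _ le_sup_left ?_ ?_ ?_ ?_
  · intro n x
    exact Or.inr ((SSet.Subcomplex.mem_ofSimplex_obj_iff _ _).2 ⟨SSet.stdSimplex.objEquiv x, rfl⟩)
  · intro n x
    exact (h2 (SSet.stdSimplex.objEquiv x)).trans (hV n x).symm
  · intro n x x' hx hx' h
    exact SSet.stdSimplex.objEquiv.injective (h3 _ _ (fun h => hx ((hV n x).2 h)) (fun h => hx' ((hV n x').2 h)) h)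
  · rintro n z (h | h)
    · exact Or.inl h
    · obtain ⟨θ, h⟩ := (SSet.Subcomplex.mem_ofSimplex_obj_iff _ _).1 h
      exact Or.inr ⟨SSet.stdSimplex.objEquiv.symm θ, h⟩

def ms (i : Fin (k + 1)) {n : ℕ} (θ : ⦋n⦌ ⟶ ⦋k⦌) : Prop := ∃ j, j ≠ i ∧ ∀ m, θ.toOrderHom m ≠ j

lemma att_horn [NeZero k] (i : Fin (k + 1)) (h2 : ∀ {n : ℕ} (θ : ⦋n⦌ ⟶ ⦋k⦌), P.map θ.op q ∈ Z.obj _ ↔ ms i θ)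
    (h3 : ∀ {n : ℕ} (θ θ' : ⦋n⦌ ⟶ ⦋k⦌), ¬ ms i θ → ¬ ms i θ' → P.map θ.op q = P.map θ'.op q → θ = θ') :
    SSet.anodyneExtensions (SSet.Subcomplex.homOfLE (le_sup_left : Z ≤ Z ⊔ SSet.Subcomplex.ofSimplex q)) := by
  obtain ⟨a, b, h⟩ := att q Z (SSet.horn k i) (ms i) (fun n x => by
    rw [SSet.mem_horn_iff_notMem_range]
    exact exists_congr fun j => by rw [exists_prop, Set.mem_range, not_exists]; rfl) h2 h3
  exact MorphismProperty.of_isPushout h (SSet.anodyneExtensions.horn_ι i)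

lemma mem_bd {n : ℕ} (x : (Δ[k] : SSet.{0}) _⦋n⦌) : x ∈ (SSet.boundary k).obj _ ↔ ¬ sj (SSet.stdSimplex.objEquiv x : ⦋n⦌ ⟶ ⦋k⦌) := by
  rw [SSet.mem_boundary_iff_notMem_range, sj, Function.Surjective, not_forall]; rfl
end att

lemma sj_comp {n k l : ℕ} (θ : ⦋n⦌ ⟶ ⦋k⦌) (f : ⦋k⦌ ⟶ ⦋l⦌) : sj (θ ≫ f) ↔ ∀ a, ∃ j, f.toOrderHom j = a ∧ ∃ m, θ.toOrderHom m = j := by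
  refine forall_congr' fun a => ⟨fun ⟨m, hm⟩ => ⟨_, hm, m, rfl⟩, fun ⟨j, hj, m, hm⟩ => ⟨m, ?_⟩⟩
  rw [comp_ap, hm, hj]

lemma sj_of_comp {n k l : ℕ} (θ : ⦋n⦌ ⟶ ⦋k⦌) (f : ⦋k⦌ ⟶ ⦋l⦌) (h : sj θ) (hf : sj f) : sj (θ ≫ f) :=
  fun a => by
    obtain ⟨j, hj⟩ := hf a
    obtain ⟨m, hm⟩ := h j
    exact ⟨m, by rw [comp_ap, hm, hj]⟩

lemma sj_al (k : Fin 3) : sj (al k) := by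
  intro a
  change ∃ i : Fin 4, (if k.castSucc < i then 1 else 0) = a
  revert a k
  decide
lemma sj_sg (k : Fin 3) : sj (SimplexCategory.σ k) := SimplexCategory.epi_iff_surjective.1 inferInstance

lemma pr_inj (k : Fin 3) {n : ℕ} (θ θ' : ⦋n⦌ ⟶ ⦋3⦌) (h1 : θ ≫ al k = θ' ≫ al k)
    (h2 : θ ≫ SimplexCategory.σ k = θ' ≫ SimplexCategory.σ k) : θ = θ' := by
  have : ∀ k : Fin 3, ∀ i j : Fin 4, (if k.castSucc < i then (1 : Fin 2) else 0) = (if k.castSucc < j then 1 else 0) →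
    k.predAbove i = k.predAbove j → i = j := by decide
  exact hom_ext' fun m => this k _ _ (congrArg (fun t : ⦋n⦌ ⟶ ⦋1⦌ => t.toOrderHom m) h1) (congrArg (fun t : ⦋n⦌ ⟶ ⦋2⦌ => t.toOrderHom m) h2)

open Classical in
noncomputable def im {n : ℕ} (θ : ⦋n⦌ ⟶ ⦋3⦌) : Fin 4 → Bool := fun j => decide (∃ m, θ.toOrderHom m = j)
lemma im_iff {n : ℕ} (θ : ⦋n⦌ ⟶ ⦋3⦌) (j : Fin 4) : (∃ m, θ.toOrderHom m = j) ↔ im θ j = true := by simp [im]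

lemma sja {n : ℕ} (θ : ⦋n⦌ ⟶ ⦋3⦌) (k : Fin 3) : sj (θ ≫ al k) ↔
    ∀ a : Fin 2, ∃ j : Fin 4, (if k.castSucc < j then 1 else 0) = a ∧ im θ j = true := by
  rw [sj_comp]
  exact forall_congr' fun a => exists_congr fun j => and_congr Iff.rfl (im_iff θ j)
lemma sjs {n : ℕ} (θ : ⦋n⦌ ⟶ ⦋3⦌) (k : Fin 3) : sj (θ ≫ SimplexCategory.σ k) ↔
    ∀ a : Fin 3, ∃ j : Fin 4, k.predAbove j = a ∧ im θ j = true := by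
  rw [sj_comp]
  exact forall_congr' fun a => exists_congr fun j => and_congr Iff.rfl (im_iff θ j)
lemma ms_im {n : ℕ} (θ : ⦋n⦌ ⟶ ⦋3⦌) (i : Fin 4) : ms i θ ↔ ∃ j, j ≠ i ∧ ¬ im θ j = true :=
  exists_congr fun j => and_congr Iff.rfl (by rw [<- im_iff, not_exists])

lemma pr0 {n : ℕ} (θ : ⦋n⦌ ⟶ ⦋3⦌) : ¬ sj (θ ≫ al 0) ∨ ¬ sj (θ ≫ SimplexCategory.σ (0 : Fin 3)) ↔ ms 1 θ := by
  rw [sja, sjs, ms_im]; generalize im θ = b; revert b; decide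
lemma pr2 {n : ℕ} (θ : ⦋n⦌ ⟶ ⦋3⦌) : ¬ sj (θ ≫ al 2) ∨ ¬ sj (θ ≫ SimplexCategory.σ (2 : Fin 3)) ↔ ms 2 θ := by
  rw [sja, sjs, ms_im]; generalize im θ = b; revert b; decide

lemma pr1 {n : ℕ} (θ : ⦋n⦌ ⟶ ⦋3⦌) (h : ¬ sj θ) : ¬ sj (θ ≫ SimplexCategory.σ (1 : Fin 3)) ∨
    (θ ≫ al 1 = θ ≫ al 0 ∧ θ ≫ SimplexCategory.σ (1 : Fin 3) = θ ≫ SimplexCategory.σ (0 : Fin 3)) ∨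
    (θ ≫ al 1 = θ ≫ al 2 ∧ θ ≫ SimplexCategory.σ (1 : Fin 3) = θ ≫ SimplexCategory.σ (2 : Fin 3)) := by
  have hb : (∀ j, ¬ im θ j = true → j = 1 ∨ j = 2) ∨ ¬ sj (θ ≫ SimplexCategory.σ (1 : Fin 3)) := by
    rw [sjs]; generalize im θ = b; revert b; decide
  rcases hb with hb | hb
  · simp only [sj, Function.Surjective, not_forall] at h
    obtain ⟨j, hj⟩ := h
    rw [im_iff] at hj
    refine Or.inr ?_
    have hm : ∀ m, θ.toOrderHom m ≠ j := by simpa [<- im_iff] using hj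
    have k0 : ∀ i : Fin 4, i ≠ 1 → (if (1 : Fin 3).castSucc < i then (1 : Fin 2) else 0) = (if (0 : Fin 3).castSucc < i then (1 : Fin 2) else 0) ∧
      (1 : Fin 3).predAbove i = (0 : Fin 3).predAbove i := by decide
    have k2 : ∀ i : Fin 4, i ≠ 2 → (if (1 : Fin 3).castSucc < i then (1 : Fin 2) else 0) = (if (2 : Fin 3).castSucc < i then (1 : Fin 2) else 0) ∧
      (1 : Fin 3).predAbove i = (2 : Fin 3).predAbove i := by decide
    rcases hb j hj with rfl | rfl
    · exact Or.inl ⟨hom_ext' fun m => (k0 _ (hm m)).1, hom_ext' fun m => (k0 _ (hm m)).2⟩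
    · exact Or.inr ⟨hom_ext' fun m => (k2 _ (hm m)).1, hom_ext' fun m => (k2 _ (hm m)).2⟩
  · exact Or.inl hb

lemma pr_ne {n : ℕ} (θ θ' : ⦋n⦌ ⟶ ⦋3⦌) (k k' : Fin 3) (j : Fin 4) (hj : ∃ m, θ.toOrderHom m = j)
    (hd : ∀ i : Fin 4, (if k.castSucc < j then (1 : Fin 2) else 0) = (if k'.castSucc < i then (1 : Fin 2) else 0) → k.predAbove j ≠ k'.predAbove i)
    (h1 : θ ≫ al k = θ' ≫ al k') (h2 : θ ≫ SimplexCategory.σ k = θ' ≫ SimplexCategory.σ k') : False := by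
  obtain ⟨m, rfl⟩ := hj
  exact hd _ (congrArg (fun t : ⦋n⦌ ⟶ ⦋1⦌ => t.toOrderHom m) h1) (congrArg (fun t : ⦋n⦌ ⟶ ⦋2⦌ => t.toOrderHom m) h2)

lemma cover {n : ℕ} (α : ⦋n⦌ ⟶ ⦋1⦌) (β : ⦋n⦌ ⟶ ⦋2⦌) : ∃ (k : Fin 3) (θ : ⦋n⦌ ⟶ ⦋3⦌), θ ≫ al k = α ∧ θ ≫ SimplexCategory.σ k = β := by
  let a : Fin (n + 1) → Fin 2 := fun m => α.toOrderHom m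
  let b : Fin (n + 1) → Fin 3 := fun m => β.toOrderHom m
  have ha : ∀ i j, i ≤ j → a i ≤ a j := fun i j h => α.toOrderHom.monotone h
  have hb : ∀ i j, i ≤ j → b i ≤ b j := fun i j h => β.toOrderHom.monotone h
  let c (u : Fin 2) (v : Fin 3) : Fin 4 := ⟨u + v, by omega⟩
  let θ : ⦋n⦌ ⟶ ⦋3⦌ := SimplexCategory.mkHom ⟨fun m => c (a m) (b m), fun i j h => by
    have := Fin.le_def.1 (ha i j h)
    have := Fin.le_def.1 (hb i j h)
    exact Fin.le_def.2 (by simp only [c]; omega)⟩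
  have key : ∀ k : Fin 3, (∀ m, (if k.castSucc < c (a m) (b m) then (1 : Fin 2) else 0) = a m ∧ k.predAbove (c (a m) (b m)) = b m) →
    ∃ (k : Fin 3) (θ : ⦋n⦌ ⟶ ⦋3⦌), θ ≫ al k = α ∧ θ ≫ SimplexCategory.σ k = β :=
    fun k h => ⟨k, θ, hom_ext' fun m => (h m).1, hom_ext' fun m => (h m).2⟩
  by_cases h0 : ∀ m, a m = 0 → b m = 0
  · refine key 0 fun m => ?_
    have := h0 m; revert this
    generalize a m = u; generalize b m = v; revert u v; decide
  by_cases h2 : ∀ m, a m = 1 → b m = 2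
  · refine key 2 fun m => ?_
    have := h2 m; revert this
    generalize a m = u; generalize b m = v; revert u v; decide
  simp only [not_forall] at h0 h2
  obtain ⟨i, hi, hi'⟩ := h0
  obtain ⟨i', hj, hj'⟩ := h2
  have h01 : ∀ u : Fin 2, u = 0 ∨ u = 1 := by decide
  refine key 1 fun m => ?_
  have e1 : a m = 0 → b m ≠ 2 := fun h h' => by
    rcases le_total m i' with hm | hm
    · have := hb _ _ hm; rw [h'] at this; revert this hj'; generalize b i' = v; revert v; decide
    · have := ha _ _ hm; rw [h, hj] at this; revert this; decide
  have e2 : a m = 1 → b m ≠ 0 := fun h h' => by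
    rcases le_total m i with hm | hm
    · have := ha _ _ hm; rw [h, hi] at this; revert this; decide
    · have := hb _ _ hm; rw [h'] at this; revert this hi'; generalize b i = v; revert v; decide
  revert e1 e2
  generalize a m = u; generalize b m = v; revert u v; decide

end HopfModel

namespace HopfModel
set_option linter.unusedVariables false
open Opposite MonoidalCategory

section chain
variable {G : SimplicialObject GrpCat.{0}} {t : GG G 1} {P : SSet.{0}} (M : Mdl G t P)
  (hG0 : ∀ h : GG G 0, h = 1)
  (hc : ∀ {n : ℕ} (α α' : ⦋n⦌ ⟶ ⦋1⦌), sj α → gm α t = gm α' t → α = α')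

lemma c_not (hG0 : ∀ h : GG G 0, h = 1) {n : ℕ} (α : ⦋n⦌ ⟶ ⦋1⦌) (h : ¬ sj α) : gm α t = 1 := by
  simp only [sj, Function.Surjective, not_forall, not_exists] at h
  obtain ⟨j, hj⟩ := h
  have h2 : ∀ a b j : Fin 2, a ≠ j → b ≠ j → a = b := by decide
  have : α = tt n ≫ SimplexCategory.const ⦋0⦌ ⦋1⦌ (α.toOrderHom 0) := hom_ext' fun m => h2 _ _ j (hj m) (hj 0)
  rw [this, <- gm_gm, hG0 (gm _ t), map_one]

lemma ncst {n : ℕ} : ¬ sj (cst n 0) := fun h => by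
  obtain ⟨m, hm⟩ := h 1
  exact absurd (show (0 : Fin 2) = 1 from hm) (by decide)

lemma c_iff (hG0 : ∀ h : GG G 0, h = 1) (hc : ∀ {n : ℕ} (α α' : ⦋n⦌ ⟶ ⦋1⦌), sj α → gm α t = gm α' t → α = α')
    {n : ℕ} (α : ⦋n⦌ ⟶ ⦋1⦌) : gm α t = 1 ↔ ¬ sj α := by
  refine ⟨fun h hs => ?_, c_not hG0 α⟩
  rw [hc α (cst n 0) hs (h.trans (c_not hG0 _ ncst).symm)] at hs
  exact ncst hs

def A0 : P.Subcomplex := SSet.Subcomplex.ofSimplex (M.Ph (1 : GG G 0))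
def A1 : P.Subcomplex := A0 M ⊔ SSet.Subcomplex.ofSimplex (M.Xi 1 (𝟙 ⦋2⦌))
def ph : uSSet G ⟶ P := mkMap (X := uSSet G) (fun _ h => M.Ph h) fun θ h => (M.Ph_nat θ h).symm
def A2 : P.Subcomplex := A1 M ⊔ SSet.Subcomplex.range (ph M)
def Q (k : Fin 3) : P.Subcomplex := SSet.Subcomplex.ofSimplex (M.Xi (gm (al k) t) (SimplexCategory.σ k))
def A3 : P.Subcomplex := A2 M ⊔ Q M 0
def A4 : P.Subcomplex := A3 M ⊔ Q M 2
def A5 : P.Subcomplex := A4 M ⊔ Q M 1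

lemma mA0 {n : ℕ} (z : P _⦋n⦌) : z ∈ (A0 M).obj _ ↔ z = M.Ph 1 := by
  refine (SSet.Subcomplex.mem_ofSimplex_obj_iff _ _).trans ⟨fun ⟨f, h⟩ => ?_, fun h => ⟨tt n, ?_⟩⟩
  · rw [<- h, M.Ph_nat, map_one]
  · rw [h, M.Ph_nat, map_one]
lemma p_map {n : ℕ} (θ : ⦋n⦌ ⟶ ⦋2⦌) : P.map θ.op (M.Xi 1 (𝟙 ⦋2⦌)) = M.Xi 1 θ := by
  rw [M.Xi_nat, map_one, Category.comp_id]
lemma q_map (k : Fin 3) {n : ℕ} (θ : ⦋n⦌ ⟶ ⦋3⦌) :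
    P.map θ.op (M.Xi (gm (al k) t) (SimplexCategory.σ k)) = M.Xi (gm (θ ≫ al k) t) (θ ≫ SimplexCategory.σ k) := by
  rw [M.Xi_nat, gm_gm]
lemma mA1 {n : ℕ} (z : P _⦋n⦌) : z ∈ (A1 M).obj _ ↔ z = M.Ph 1 ∨ ∃ b, M.Xi 1 b = z :=
  or_congr (mA0 M z) ((SSet.Subcomplex.mem_ofSimplex_obj_iff _ _).trans (exists_congr fun f => by rw [p_map]))
lemma mA2 {n : ℕ} (z : P _⦋n⦌) : z ∈ (A2 M).obj _ ↔ (∃ b, M.Xi 1 b = z) ∨ ∃ h, M.Ph h = z := by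
  refine (or_congr (mA1 M z) (Iff.rfl (a := ∃ h, M.Ph h = z))).trans ⟨?_, ?_⟩
  · rintro ((h | h) | h)
    exacts [Or.inr ⟨_, h.symm⟩, Or.inl h, Or.inr h]
  · rintro (h | h)
    exacts [Or.inl (Or.inr h), Or.inr h]
lemma mQ (k : Fin 3) {n : ℕ} (z : P _⦋n⦌) : z ∈ (Q M k).obj _ ↔ ∃ θ : ⦋n⦌ ⟶ ⦋3⦌, M.Xi (gm (θ ≫ al k) t) (θ ≫ SimplexCategory.σ k) = z :=
  (SSet.Subcomplex.mem_ofSimplex_obj_iff _ _).trans (exists_congr fun f => by rw [q_map])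

lemma gU (hG0 : ∀ h : GG G 0, h = 1) (hc : ∀ {n : ℕ} (α α' : ⦋n⦌ ⟶ ⦋1⦌), sj α → gm α t = gm α' t → α = α')
    {n : ℕ} (α : ⦋n⦌ ⟶ ⦋1⦌) (β : ⦋n⦌ ⟶ ⦋2⦌) : M.Xi (gm α t) β ∈ (A2 M).obj _ ↔ ¬ sj α ∨ ¬ sj β := by
  refine (mA2 M _).trans ⟨fun h => ?_, ?_⟩
  · by_cases hb : sj β
    · rcases h with ⟨b, h⟩ | ⟨h', h⟩
      · exact Or.inl ((c_iff hG0 hc α).1 (M.Xi_inj _ _ _ _ hb h.symm).1)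
      · exact (M.Xi_ne _ _ _ hb h.symm).elim
    · exact Or.inr hb
  · rintro (h | h)
    · exact Or.inl ⟨β, by rw [c_not hG0 α h]⟩
    · obtain ⟨h', e⟩ := M.Xi_bd (gm α t) β h
      exact Or.inr ⟨h', e.symm⟩
lemma gI (hc : ∀ {n : ℕ} (α α' : ⦋n⦌ ⟶ ⦋1⦌), sj α → gm α t = gm α' t → α = α') {n : ℕ} (α α' : ⦋n⦌ ⟶ ⦋1⦌) (β β' : ⦋n⦌ ⟶ ⦋2⦌) (ha : sj α) (hb : sj β)
    (h : M.Xi (gm α t) β = M.Xi (gm α' t) β') : α = α' ∧ β = β' :=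
  ⟨hc _ _ ha (M.Xi_inj _ _ _ _ hb h).1, (M.Xi_inj _ _ _ _ hb h).2⟩

lemma fac {n : ℕ} (θ : ⦋n⦌ ⟶ ⦋2⦌) (j : Fin 3) (h : ∀ m, θ.toOrderHom m ≠ j) : ∃ α : ⦋n⦌ ⟶ ⦋1⦌, θ = α ≫ SimplexCategory.δ j := by
  obtain ⟨α, h⟩ := SimplexCategory.eq_comp_δ_of_not_surjective' θ j h
  exact ⟨α, h⟩

lemma Xi1 {n : ℕ} (θ : ⦋n⦌ ⟶ ⦋2⦌) (h : ms 0 θ) : M.Xi 1 θ = M.Ph 1 := by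
  obtain ⟨j, hj, h⟩ := h
  obtain ⟨α, rfl⟩ := fac θ j h
  have := M.Xi_nat α 1 (SimplexCategory.δ j)
  rw [map_one] at this
  rw [<- this, M.Xij j hj, M.Ph_nat, map_one]
lemma Xi1' {n : ℕ} (α : ⦋n⦌ ⟶ ⦋1⦌) : M.Xi 1 (α ≫ SimplexCategory.δ 0) = M.Ph (gm α t) := by
  have := M.Xi_nat α 1 (SimplexCategory.δ 0)
  rw [map_one] at this
  rw [<- this, M.Xi0, M.Ph_nat]

lemma nms {n : ℕ} (θ : ⦋n⦌ ⟶ ⦋2⦌) (h : ¬ ms 0 θ) : sj θ ∨ ∃ α : ⦋n⦌ ⟶ ⦋1⦌, sj α ∧ θ = α ≫ SimplexCategory.δ 0 := by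
  by_cases hs : sj θ
  · exact Or.inl hs
  right
  simp only [sj, Function.Surjective, not_forall, not_exists] at hs
  obtain ⟨j, hj⟩ := hs
  have hj0 : j = 0 := by by_contra h'; exact h ⟨j, h', hj⟩
  subst hj0
  obtain ⟨α, rfl⟩ := fac θ 0 hj
  refine ⟨α, fun a => ?_, rfl⟩
  by_contra ha
  refine h ⟨(SimplexCategory.δ (0 : Fin 3)).toOrderHom a, ?_, fun m hm => ha ⟨m, ?_⟩⟩
  · exact Fin.succAbove_ne (0 : Fin 3) a
  · exact Fin.succAbove_right_injective (p := (0 : Fin 3)) hm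

lemma an01 (hG0 : ∀ h : GG G 0, h = 1) (hc : ∀ {n : ℕ} (α α' : ⦋n⦌ ⟶ ⦋1⦌), sj α → gm α t = gm α' t → α = α') :
    SSet.anodyneExtensions (SSet.Subcomplex.homOfLE (le_sup_left : A0 M ≤ A1 M)) := by
  refine att_horn _ _ 0 (fun θ => ?_) (fun θ θ' hθ hθ' h => ?_)
  · rw [p_map, mA0]
    refine ⟨fun h => ?_, Xi1 M θ⟩
    by_contra hn
    rcases nms θ hn with hs | ⟨α, ha, rfl⟩
    · exact M.Xi_ne _ _ _ hs h
    · rw [Xi1'] at h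
      exact (c_iff hG0 hc α).1 (M.Ph_inj _ _ h) ha
  · rw [p_map, p_map] at h
    rcases nms θ hθ with hs | ⟨α, ha, rfl⟩
    · exact (M.Xi_inj _ _ _ _ hs h).2
    rcases nms θ' hθ' with hs | ⟨α', ha', rfl⟩
    · exact (M.Xi_inj _ _ _ _ hs h.symm).2.symm
    rw [Xi1', Xi1'] at h
    rw [hc α α' ha (M.Ph_inj _ _ h)]

lemma an12 (hG0 : ∀ h : GG G 0, h = 1) (hC : SSet.anodyneExtensions (SSet.Subcomplex.ofSimplex (X := uSSet G) (n := 1) t).ι) :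
    SSet.anodyneExtensions (SSet.Subcomplex.homOfLE (le_sup_left : A1 M ≤ A2 M)) := by
  refine po_an (ph M) _ _ _ _ hC (fun n x => Or.inr ⟨x, rfl⟩) (fun n x => ?_) (fun n x x' _ _ h => M.Ph_inj _ _ h) ?_
  · refine (mA1 M _).trans (Iff.trans ?_ (SSet.Subcomplex.mem_ofSimplex_obj_iff _ _).symm)
    change (M.Ph (show GG G n from x) = _ ∨ ∃ b, _ = M.Ph (show GG G n from x)) ↔ ∃ α : ⦋n⦌ ⟶ ⦋1⦌, gm α t = x
    constructor
    · rintro (h | ⟨b, h⟩)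
      · exact ⟨cst n 0, (c_not hG0 _ ncst).trans (M.Ph_inj _ _ h).symm⟩
      · by_cases hm : ms 0 b
        · exact ⟨cst n 0, (c_not hG0 _ ncst).trans (M.Ph_inj _ _ (h.symm.trans (Xi1 M b hm))).symm⟩
        rcases nms b hm with hs | ⟨α, ha, rfl⟩
        · exact (M.Xi_ne _ _ _ hs h).elim
        · exact ⟨α, M.Ph_inj _ _ ((Xi1' M α).symm.trans h)⟩
    · rintro ⟨α, h⟩
      exact Or.inr ⟨_, (Xi1' M α).trans (congrArg M.Ph h)⟩
  · rintro n z (h | ⟨x, h⟩)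
    exacts [Or.inl h, Or.inr ⟨x, h⟩]

lemma an23 (hG0 : ∀ h : GG G 0, h = 1) (hc : ∀ {n : ℕ} (α α' : ⦋n⦌ ⟶ ⦋1⦌), sj α → gm α t = gm α' t → α = α') :
    SSet.anodyneExtensions (SSet.Subcomplex.homOfLE (le_sup_left : A2 M ≤ A3 M)) := by
  refine att_horn _ _ 1 (fun θ => ?_) (fun θ θ' hθ hθ' h => ?_)
  · rw [q_map, gU M hG0 hc, pr0]
  · rw [q_map, q_map] at h
    rw [<- pr0, not_or, not_not, not_not] at hθ
    obtain ⟨h1, h2⟩ := gI M hc _ _ _ _ hθ.1 hθ.2 h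
    exact pr_inj 0 _ _ h1 h2

lemma hit {n k : ℕ} {i : Fin (k + 1)} {θ : ⦋n⦌ ⟶ ⦋k⦌} (h : ¬ ms i θ) (j : Fin (k + 1)) (hj : j ≠ i) : ∃ m, θ.toOrderHom m = j := by
  by_contra hn
  exact h ⟨j, hj, not_exists.1 hn⟩

lemma an34 (hG0 : ∀ h : GG G 0, h = 1) (hc : ∀ {n : ℕ} (α α' : ⦋n⦌ ⟶ ⦋1⦌), sj α → gm α t = gm α' t → α = α') :
    SSet.anodyneExtensions (SSet.Subcomplex.homOfLE (le_sup_left : A3 M ≤ A4 M)) := by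
  refine att_horn _ _ 2 (fun θ => ?_) (fun θ θ' hθ hθ' h => ?_)
  · rw [q_map]
    refine (or_congr (gU M hG0 hc _ _) (mQ M 0 _)).trans ?_
    rw [pr2, or_iff_left_iff_imp]
    rintro ⟨θ', h⟩
    by_contra hn
    have hn' := hn
    rw [<- pr2, not_or, not_not, not_not] at hn'
    obtain ⟨h1, h2⟩ := gI M hc _ _ _ _ hn'.1 hn'.2 h.symm
    exact pr_ne θ θ' 2 0 1 (hit hn 1 (by decide)) (by decide) h1 h2
  · rw [q_map, q_map] at h
    rw [<- pr2, not_or, not_not, not_not] at hθ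
    obtain ⟨h1, h2⟩ := gI M hc _ _ _ _ hθ.1 hθ.2 h
    exact pr_inj 2 _ _ h1 h2

lemma po45 (hG0 : ∀ h : GG G 0, h = 1) (hc : ∀ {n : ℕ} (α α' : ⦋n⦌ ⟶ ⦋1⦌), sj α → gm α t = gm α' t → α = α') :
    ∃ (a : (SSet.boundary 3 : (Δ[3] : SSet.{0}).Subcomplex).toSSet ⟶ (A4 M).toSSet) (b : Δ[3] ⟶ (A5 M).toSSet),
      IsPushout a (SSet.boundary 3).ι (SSet.Subcomplex.homOfLE (le_sup_left : A4 M ≤ A5 M)) b := by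
  refine att _ _ _ (fun θ => ¬ sj θ) (fun n x => mem_bd x) (fun θ => ?_) (fun θ θ' hθ hθ' h => ?_)
  · rw [q_map]
    refine (or_congr (or_congr (gU M hG0 hc _ _) (mQ M 0 _)) (mQ M 2 _)).trans ⟨fun h hs => ?_, fun h => ?_⟩
    · have ha := sj_of_comp θ _ hs (sj_al 1)
      have hb := sj_of_comp θ _ hs (sj_sg 1)
      rcases h with ((h | h) | ⟨θ', h⟩) | ⟨θ', h⟩
      · exact h ha
      · exact h hb
      · obtain ⟨h1, h2⟩ := gI M hc _ _ _ _ ha hb h.symm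
        exact pr_ne θ θ' 1 0 1 (hs _) (by decide) h1 h2
      · obtain ⟨h1, h2⟩ := gI M hc _ _ _ _ ha hb h.symm
        exact pr_ne θ θ' 1 2 2 (hs _) (by decide) h1 h2
    · rcases pr1 θ h with h | ⟨h1, h2⟩ | ⟨h1, h2⟩
      · exact Or.inl (Or.inl (Or.inr h))
      · exact Or.inl (Or.inr ⟨θ, by rw [h1, h2]⟩)
      · exact Or.inr ⟨θ, by rw [h1, h2]⟩
  · rw [q_map, q_map] at h
    rw [not_not] at hθ
    obtain ⟨h1, h2⟩ := gI M hc _ _ _ _ (sj_of_comp θ _ hθ (sj_al 1)) (sj_of_comp θ _ hθ (sj_sg 1)) h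
    exact pr_inj 1 _ _ h1 h2

def xi : uSSet G ⊗ Δ[2] ⟶ P := mkMap (X := uSSet G ⊗ Δ[2]) (fun n x => M.Xi (show GG G n from x.1) (SSet.stdSimplex.objEquiv x.2))
  fun θ x => (M.Xi_nat θ x.1 (SSet.stdSimplex.objEquiv x.2)).symm

lemma an5 (hG0 : ∀ h : GG G 0, h = 1) (hc : ∀ {n : ℕ} (α α' : ⦋n⦌ ⟶ ⦋1⦌), sj α → gm α t = gm α' t → α = α')
    (hC : SSet.anodyneExtensions (SSet.Subcomplex.ofSimplex (X := uSSet G) (n := 1) t).ι) :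
    SSet.anodyneExtensions (SSet.Subcomplex.homOfLE (le_top : A5 M ≤ ⊤)) := by
  have hq : ∀ (k : Fin 3) {n : ℕ} (z : P _⦋n⦌), z ∈ (Q M k).obj _ → z ∈ (A5 M).obj _ := by
    intro k n z h
    match k with
    | 0 => exact Or.inl (Or.inl (Or.inr h))
    | 1 => exact Or.inr h
    | 2 => exact Or.inl (Or.inr h)
  refine po_an (xi M) _ _ _ _ (SSet.anodyneExtensions_unionProd_ι' _ (SSet.boundary 2) hC) (fun n x => trivial) (fun n x => ?_) ?_ ?_
  · obtain ⟨h, b⟩ := x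
    refine Iff.trans ?_ (SSet.Subcomplex.mem_unionProd_iff _ _ _).symm
    refine Iff.trans ?_ (or_congr (mem_bd b).symm (SSet.Subcomplex.mem_ofSimplex_obj_iff _ _).symm)
    change M.Xi (show GG G n from h) (SSet.stdSimplex.objEquiv b) ∈ _ ↔ ¬ sj (SSet.stdSimplex.objEquiv b) ∨ ∃ α : ⦋n⦌ ⟶ ⦋1⦌, gm α t = h
    generalize (SSet.stdSimplex.objEquiv b : ⦋n⦌ ⟶ ⦋2⦌) = β
    constructor
    · intro hm
      by_cases hb : sj β
      · right
        have : ∀ k : Fin 3, M.Xi (show GG G n from h) β ∈ (Q M k).obj _ → ∃ α : ⦋n⦌ ⟶ ⦋1⦌, gm α t = h := fun k hk => by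
          obtain ⟨θ, e⟩ := (mQ M k _).1 hk
          exact ⟨_, (M.Xi_inj _ _ _ _ hb e.symm).1.symm⟩
        rcases hm with ((hm | hm) | hm) | hm
        · rcases (mA2 M _).1 hm with ⟨b', e⟩ | ⟨h', e⟩
          · exact ⟨cst n 0, (c_not hG0 _ ncst).trans (M.Xi_inj _ _ _ _ hb e.symm).1.symm⟩
          · exact (M.Xi_ne _ _ _ hb e.symm).elim
        exacts [this 0 hm, this 2 hm, this 1 hm]
      · exact Or.inl hb
    · rintro (hb | ⟨α, rfl⟩)
      · obtain ⟨h', e⟩ := M.Xi_bd h β hb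
        exact Or.inl (Or.inl (Or.inl ((mA2 M _).2 (Or.inr ⟨h', e.symm⟩))))
      · obtain ⟨k, θ, rfl, rfl⟩ := cover α β
        exact hq k _ ((mQ M k _).2 ⟨θ, rfl⟩)
  · rintro n ⟨h, b⟩ ⟨h', b'⟩ hx hx' e
    have hb : sj (SSet.stdSimplex.objEquiv b : ⦋n⦌ ⟶ ⦋2⦌) := by
      by_contra hn
      exact hx ((SSet.Subcomplex.mem_unionProd_iff _ _ _).2 (Or.inl ((mem_bd b).2 hn)))
    obtain ⟨h1, h2⟩ := M.Xi_inj h h' (SSet.stdSimplex.objEquiv b) (SSet.stdSimplex.objEquiv b') hb e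
    exact Prod.ext h1 (SSet.stdSimplex.objEquiv.injective h2)
  · intro n z _
    rcases M.cases z with ⟨h, rfl⟩ | ⟨h, b, hb, rfl⟩
    · exact Or.inl (Or.inl (Or.inl (Or.inl ((mA2 M _).2 (Or.inr ⟨h, rfl⟩)))))
    · exact Or.inr ⟨(h, SSet.stdSimplex.objEquiv.symm b), congrArg (M.Xi h) (Equiv.apply_symm_apply _ _)⟩

lemma anv : ∃ a : Δ[0] ⟶ (A0 M).toSSet, SSet.anodyneExtensions a := by
  have hr : SSet.Subcomplex.range (SSet.yonedaEquiv.symm (M.Ph (1 : GG G 0))) ≤ A0 M := by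
    rintro U _ ⟨x, rfl⟩
    exact (SSet.Subcomplex.mem_ofSimplex_obj_iff _ _).2 ⟨SSet.stdSimplex.objEquiv x, rfl⟩
  have : IsIso (SSet.Subcomplex.lift _ hr) := by
    rw [NatTrans.isIso_iff_isIso_app]
    rintro ⟨⟨n⟩⟩
    rw [isIso_iff_bijective]
    refine ⟨fun x y _ => SSet.stdSimplex.objEquiv.injective ((tt_eq (n := n) _).trans (tt_eq _).symm), fun z => ?_⟩
    obtain ⟨f, h⟩ := (SSet.Subcomplex.mem_ofSimplex_obj_iff _ _).1 z.2
    exact ⟨SSet.stdSimplex.objEquiv.symm f, Subtype.ext h⟩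
  exact ⟨SSet.Subcomplex.lift _ hr, MorphismProperty.of_isIso _ _⟩

lemma chain (M : Mdl G t P) (hG0 : ∀ h : GG G 0, h = 1) (hc : ∀ {n : ℕ} (α α' : ⦋n⦌ ⟶ ⦋1⦌), sj α → gm α t = gm α' t → α = α')
    (hC : SSet.anodyneExtensions (SSet.Subcomplex.ofSimplex (X := uSSet G) (n := 1) t).ι) :
    ∃ (N S : SSet.{0}) (a : Δ[0] ⟶ N) (i : N ⟶ S) (c : (SSet.boundary 3 : (Δ[3] : SSet.{0}).Subcomplex).toSSet ⟶ N) (b : Δ[3] ⟶ S) (j : S ⟶ P),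
      SSet.anodyneExtensions a ∧ IsPushout c (SSet.boundary 3).ι i b ∧ SSet.anodyneExtensions j := by
  obtain ⟨a, ha⟩ := anv M
  obtain ⟨c, b, h⟩ := po45 M hG0 hc
  exact ⟨_, _, _, _, c, b, _ ≫ (SSet.Subcomplex.topIso P).hom, MorphismProperty.comp_mem _ _ _ ha (MorphismProperty.comp_mem _ _ _ (an01 M hG0 hc)
    (MorphismProperty.comp_mem _ _ _ (an12 M hG0 hC) (MorphismProperty.comp_mem _ _ _ (an23 M hG0 hc) (an34 M hG0 hc)))),
    h, MorphismProperty.comp_mem _ _ _ (an5 M hG0 hc hC) (MorphismProperty.of_isIso _ _)⟩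
end chain

lemma chain_loop {G : SimplicialObject GrpCat.{0}} {ζ : _} (e : KK GammaZ2 2 ≃+ ℤ) (L : IsLoop (K := GammaZ2) (G := G) ζ) (g : KK GammaZ2 2) (hg : e g = 1) {P : SSet.{0}} (M : Mdl G (zt ζ g) P) :
    ∃ (N S : SSet.{0}) (a : Δ[0] ⟶ N) (i : N ⟶ S) (c : (SSet.boundary 3 : (Δ[3] : SSet.{0}).Subcomplex).toSSet ⟶ N) (b : Δ[3] ⟶ S) (j : S ⟶ P),
      SSet.anodyneExtensions a ∧ IsPushout c (SSet.boundary 3).ι i b ∧ SSet.anodyneExtensions j := by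
  refine chain M ?_ ?_ (C_anodyne e L g hg)
  · refine L.ind 0 _ rfl fun x h => ?_
    rw [gam1 x, zt_zero, one_mul]
  · intro n α α' hs h
    have hw : ∀ i, (((α.toOrderHom i : Fin 2) : ℕ) : ℤ) - (α.toOrderHom 0 : Fin 2) = ((α'.toOrderHom i : Fin 2) : ℕ) - (α'.toOrderHom 0 : Fin 2) := fun i => by
      have := congrArg (fun x => ww e (phi L x) 0 i (Fin.zero_le _)) h
      simp only [phi_nat, phi_zt' L g (rr_g g), ww_km] at this
      erw [ww_g e g hg, ww_g e g hg] at this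
      exact this
    have h0 : α.toOrderHom 0 = (0 : Fin 2) := by
      obtain ⟨m, hm⟩ := hs 0
      exact le_antisymm ((α.toOrderHom.monotone (Fin.zero_le m)).trans hm.le) (Fin.zero_le _)
    have h0' : α'.toOrderHom 0 = (0 : Fin 2) := by
      obtain ⟨m, hm⟩ := hs 1
      have := hw m
      rw [hm, h0] at this
      have h1 : ∀ x y : Fin 2, (((1 : Fin 2) : ℕ) : ℤ) - ((0 : Fin 2) : ℕ) = ((x : ℕ) : ℤ) - ((y : ℕ) : ℤ) → y = 0 := by decide
      exact h1 _ _ this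
    refine hom_ext' fun i => Fin.ext ?_
    have := hw i
    rw [h0, h0'] at this
    omega
end HopfModel

namespace HopfModel
set_option linter.unusedVariables false

section kap

lemma r2 (t : TS 3) (j : Fin 4) : 1 - rho t ≤ 4 * t j := by
  have := rho_coord t j; norm_num at this ⊢; linarith
lemma r2' (t : TS 3) : ∃ j, 1 - rho t = 4 * t j := by
  obtain ⟨j, h⟩ := rho_mem t; exact ⟨j, by norm_num at h ⊢; linarith⟩

noncomputable def ss (t : TS 3) : ℝ := (4 * t 0 - 1) ^ 2 + (4 * t 1 - 1) ^ 2 + (4 * t 2 - 1) ^ 2 + (4 * t 3 - 1) ^ 2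
noncomputable def dd (t : TS 3) : ℝ := ss t + (1 - rho t) ^ 2

lemma ts_sum (t : TS 3) : t 0 + t 1 + t 2 + t 3 = 1 := by
  have := stdSimplex.sum_eq_one t
  rwa [Fin.sum_univ_four] at this

lemma ss_le (t : TS 3) (j : Fin 4) : (4 * t j - 1) ^ 2 ≤ ss t := by
  have h0 := sq_nonneg (4 * t 0 - 1)
  have h1 := sq_nonneg (4 * t 1 - 1)
  have h2 := sq_nonneg (4 * t 2 - 1)
  have h3 := sq_nonneg (4 * t 3 - 1)
  unfold ss
  match j with
  | 0 => linarith
  | 1 => linarith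
  | 2 => linarith
  | 3 => linarith

lemma dd_pos (t : TS 3) : 0 < dd t := by
  obtain ⟨j, h⟩ := r2' t
  have := ss_le t j
  rw [<- h] at this
  unfold dd
  nlinarith [sq_nonneg (1 - rho t - 1 / 2)]

noncomputable def kf (t : TS 3) (j : Fin 4) : ℝ :=
  (2 * (1 - rho t) * (4 * t j - 1) + (ss t - (1 - rho t) ^ 2) / 2) / dd t

lemma kf_sq (t : TS 3) : kf t 0 ^ 2 + kf t 1 ^ 2 + kf t 2 ^ 2 + kf t 3 ^ 2 = 1 := by
  have h := (dd_pos t).ne'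
  simp only [kf, div_pow, <- add_div]
  rw [div_eq_one_iff_eq (by positivity)]
  have h3 : t 3 = 1 - t 0 - t 1 - t 2 := by linarith [ts_sum t]
  simp only [dd, ss, h3]
  ring

noncomputable def kap : C(TS 3, S3) where
  toFun t := ⟨WithLp.toLp 2 (kf t), by
    rw [mem_sphere_zero_iff_norm, EuclideanSpace.norm_eq, Real.sqrt_eq_one, Fin.sum_univ_four]
    simpa using kf_sq t⟩
  continuous_toFun := by
    refine Continuous.subtype_mk ((PiLp.continuous_toLp 2 _).comp (continuous_pi fun j => ?_)) _
    have hr : Continuous fun t : TS 3 => 1 - rho t := continuous_const.sub rho_cont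
    have hx : ∀ j : Fin 4, Continuous fun t : TS 3 => 4 * t j - 1 := fun j =>
      (continuous_const.mul (continuous_coord j)).sub continuous_const
    have hs : Continuous ss := ((((hx 0).pow 2).add ((hx 1).pow 2)).add ((hx 2).pow 2)).add ((hx 3).pow 2)
    exact (((continuous_const.mul hr).mul (hx j)).add ((hs.sub (hr.pow 2)).div_const 2)).div (hs.add (hr.pow 2)) fun t => (dd_pos t).ne'

def bd (t : TS 3) : Prop := ∃ j, t j = 0

lemma bd_iff (t : TS 3) : bd t ↔ 1 - rho t = 0 := by
  constructor
  · rintro ⟨j, h⟩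
    rw [rho_eq_one ⟨j, trivial, h⟩, sub_self]
  · intro h
    obtain ⟨j, hj⟩ := r2' t
    exact ⟨j, by linarith⟩

lemma kf_bd (t : TS 3) (h : bd t) (j) : kf t j = 1 / 2 := by
  have := dd_pos t
  rw [bd_iff] at h
  simp only [kf, dd, h] at this ⊢
  field_simp
  ring

lemma kap_bd (t t' : TS 3) (h : bd t) (h' : bd t') : kap t = kap t' := by
  refine Subtype.ext (WithLp.ofLp_injective 2 (funext fun j => ?_))
  exact (kf_bd t h j).trans (kf_bd t' h' j).symm

lemma kf_sum (t : TS 3) : 2 - (kf t 0 + kf t 1 + kf t 2 + kf t 3) = 4 * (1 - rho t) ^ 2 / dd t := by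
  have h := (dd_pos t).ne'
  have h3 : t 3 = 1 - t 0 - t 1 - t 2 := by linarith [ts_sum t]
  simp only [kf]
  field_simp
  simp only [dd, h3]
  ring

lemma kf_x (t : TS 3) (j) : kf t j - (kf t 0 + kf t 1 + kf t 2 + kf t 3) / 4 = 2 * (1 - rho t) * (4 * t j - 1) / dd t := by
  have h := (dd_pos t).ne'
  have h3 : t 3 = 1 - t 0 - t 1 - t 2 := by linarith [ts_sum t]
  simp only [kf]
  field_simp
  rw [h3]
  ring

lemma kap_inj (t t' : TS 3) (h : kap t = kap t') : t = t' ∨ bd t ∧ bd t' := by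
  have hk : ∀ j, kf t j = kf t' j := fun j => congrArg (fun p : S3 => p.1 j) h
  have hd := dd_pos t
  have hd' := dd_pos t'
  have e1 := kf_sum t
  rw [hk, hk, hk, hk, kf_sum] at e1
  have e2 : ∀ j, 2 * (1 - rho t') * (4 * t' j - 1) / dd t' = 2 * (1 - rho t) * (4 * t j - 1) / dd t := fun j => by
    have e := kf_x t j
    rwa [hk, hk, hk, hk, hk, kf_x] at e
  rw [bd_iff, bd_iff]
  have m0 := sub_nonneg.2 (rho_le t)
  have m0' := sub_nonneg.2 (rho_le t')
  have c1 := r2 t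
  have c2 := r2 t'
  obtain ⟨i, c3⟩ := r2' t
  obtain ⟨i', c4⟩ := r2' t'
  revert e1 e2 m0 m0' c1 c2 c3 c4 hd hd'
  generalize 1 - rho t = m
  generalize 1 - rho t' = m'
  generalize dd t = D
  generalize dd t' = D'
  intro hd hd' e1 e2 m0 m0' c1 c2 c3 c4
  rw [div_eq_div_iff hd'.ne' hd.ne'] at e1
  rcases m0.eq_or_lt with rfl | hm
  · right
    refine ⟨rfl, ?_⟩
    have : m' ^ 2 * D = 0 := by linarith
    have := (mul_eq_zero.1 this).resolve_right hd.ne'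
    exact pow_eq_zero_iff two_ne_zero |>.1 this
  left
  have hm' : 0 < m' := by
    refine lt_of_le_of_ne m0' fun h => ?_
    subst h
    have : m ^ 2 * D' = 0 := by linarith
    rcases mul_eq_zero.1 this with h | h
    · exact hm.ne' (pow_eq_zero_iff two_ne_zero |>.1 h)
    · exact hd'.ne' h
  have e3 : ∀ j, (4 * t' j - 1) * m = (4 * t j - 1) * m' := fun j => by
    have e := e2 j
    rw [div_eq_div_iff hd'.ne' hd.ne'] at e
    have h5 : m' * D * ((4 * t' j - 1) * m) = m' * D * ((4 * t j - 1) * m') := by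
      linear_combination m / 2 * e - (4 * t j - 1) / 4 * e1
    exact mul_left_cancel₀ (by positivity) h5
  have hle : m' ≤ m := by
    have := e3 i; have := c2 i; nlinarith
  have hle' : m ≤ m' := by
    have := e3 i'; have := c1 i'; nlinarith
  have hmm := le_antisymm hle hle'
  ext j
  have := e3 j
  rw [hmm] at this
  have := mul_right_cancel₀ hm.ne' this
  linarith

lemma ex_bd : ∃ t : TS 3, bd t := ⟨stdSimplex.vertex 0, 1, by simp [stdSimplex.vertex]⟩

lemma kap_surj : Function.Surjective kap := by
  intro p
  have hp : p.1 0 ^ 2 + p.1 1 ^ 2 + p.1 2 ^ 2 + p.1 3 ^ 2 = 1 := by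
    have := mem_sphere_zero_iff_norm.1 p.2
    rw [EuclideanSpace.norm_eq, Real.sqrt_eq_one, Fin.sum_univ_four] at this
    simpa using this
  obtain ⟨c, hc⟩ : ∃ c, c = (p.1 0 + p.1 1 + p.1 2 + p.1 3) / 2 := ⟨_, rfl⟩
  have hc1 : (p.1 0 - 1 / 2) ^ 2 + (p.1 1 - 1 / 2) ^ 2 + (p.1 2 - 1 / 2) ^ 2 + (p.1 3 - 1 / 2) ^ 2 = 2 - 2 * c := by
    rw [hc]; linear_combination hp
  rcases eq_or_ne c 1 with h1 | h1
  · obtain ⟨t, ht⟩ := ex_bd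
    refine ⟨t, Subtype.ext (WithLp.ofLp_injective 2 (funext fun j => ?_))⟩
    refine (kf_bd t ht j).trans ?_
    rw [h1] at hc1
    have h0 := sq_nonneg (p.1 0 - 1 / 2)
    have h1 := sq_nonneg (p.1 1 - 1 / 2)
    have h2 := sq_nonneg (p.1 2 - 1 / 2)
    have h3 := sq_nonneg (p.1 3 - 1 / 2)
    have : (p.1 j - 1 / 2) ^ 2 = 0 := by
      match j with
      | 0 => linarith
      | 1 => linarith
      | 2 => linarith
      | 3 => linarith
    have := pow_eq_zero_iff two_ne_zero |>.1 this
    exact (sub_eq_zero.1 this).symm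
  have hlt : 0 < 1 - c := by
    refine lt_of_le_of_ne ?_ fun h => h1 (by linarith)
    nlinarith [sq_nonneg (p.1 0 - 1 / 2), sq_nonneg (p.1 1 - 1 / 2), sq_nonneg (p.1 2 - 1 / 2), sq_nonneg (p.1 3 - 1 / 2)]
  let w : Fin 4 → ℝ := fun j => (p.1 j - c / 2) / (1 - c)
  have hw : ∀ j, w j * (1 - c) = p.1 j - c / 2 := fun j => div_mul_cancel₀ _ hlt.ne'
  have hws : w 0 + w 1 + w 2 + w 3 = 0 := by
    have : (w 0 + w 1 + w 2 + w 3) * (1 - c) = 0 := by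
      simp only [add_mul, hw]; rw [hc]; ring
    exact (mul_eq_zero.1 this).resolve_right hlt.ne'
  obtain ⟨i, hi⟩ : ∃ i, ∀ j, w i ≤ w j := Finite.exists_min w
  have hi0 : w i ≤ 0 := by linarith [hi 0, hi 1, hi 2, hi 3]
  obtain ⟨m, hm⟩ : ∃ m, m = 1 / (1 - w i) := ⟨_, rfl⟩
  have hmp : 0 < m := by rw [hm]; apply one_div_pos.2; linarith
  have hmw : m * (1 - w i) = 1 := by rw [hm]; apply one_div_mul_cancel; linarith
  have hmin : ∀ j, m ≤ 1 + m * w j := fun j => by nlinarith [hi j]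
  let t : TS 3 := ⟨fun j => (1 + m * w j) / 4, fun j => by have := hmin j; dsimp only; linarith, by
    rw [Fin.sum_univ_four]; linear_combination m / 4 * hws⟩
  have htj : ∀ j, t j = (1 + m * w j) / 4 := fun j => rfl
  have hr : 1 - rho t = m := by
    apply le_antisymm
    · have := r2 t i
      rw [htj] at this
      linarith
    · obtain ⟨j, h⟩ := r2' t
      rw [h, htj]
      linarith [hmin j]
  have hx : ∀ j, 4 * t j - 1 = m * w j := fun j => by rw [htj]; ring
  have hW : (w 0 ^ 2 + w 1 ^ 2 + w 2 ^ 2 + w 3 ^ 2) * (1 - c) = 1 + c := by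
    have : (w 0 ^ 2 + w 1 ^ 2 + w 2 ^ 2 + w 3 ^ 2) * (1 - c) * (1 - c) = (1 + c) * (1 - c) := by
      have : (w 0 ^ 2 + w 1 ^ 2 + w 2 ^ 2 + w 3 ^ 2) * (1 - c) * (1 - c) = (w 0 * (1 - c)) ^ 2 + (w 1 * (1 - c)) ^ 2 + (w 2 * (1 - c)) ^ 2 + (w 3 * (1 - c)) ^ 2 := by ring
      rw [this, hw, hw, hw, hw]
      linear_combination hp + 2 * c * hc
    exact mul_right_cancel₀ hlt.ne' this
  refine ⟨t, Subtype.ext (WithLp.ofLp_injective 2 (funext fun j => ?_))⟩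
  change kf t j = p.1 j
  rw [kf, div_eq_iff (dd_pos t).ne']
  simp only [dd, ss, hr, hx]
  have hpj : p.1 j = w j * (1 - c) + c / 2 := by rw [hw]; ring
  rw [hpj]
  apply mul_right_cancel₀ hlt.ne'
  linear_combination (m ^ 2 * (1 / 2 - (w j * (1 - c) + c / 2))) * hW

lemma kap_q : Topology.IsQuotientMap kap :=
  (kap.continuous.isClosedMap).isQuotientMap kap.continuous kap_surj
end kap
end HopfModel

namespace HopfModel
set_option linter.unusedVariables false
open scoped ContinuousMap

section cell
variable {N S : SSet.{0}} {i : N ⟶ S} {c : (SSet.boundary 3 : (Δ[3] : SSet.{0}).Subcomplex).toSSet ⟶ N} {b : Δ[3] ⟶ S}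

noncomputable def chi (b : Δ[3] ⟶ S) : C(TS 3, |S|) := evS (b ≫ sSetTopAdj.unit.app S)

lemma un (i : N ⟶ S) : i ≫ sSetTopAdj.unit.app S = sSetTopAdj.unit.app N ≫ TopCat.toSSet.map (SSet.toTop.map i) :=
  sSetTopAdj.unit.naturality i

lemma chi_bd (hp : IsPushout c (SSet.boundary 3).ι i b) (t : TS 3) (h : bd t) : ∃ x : |N|, SSet.toTop.map i x = chi b t := by
  obtain ⟨j, h⟩ := h
  obtain ⟨u, rfl⟩ := TS_drop j t h
  refine ⟨evS (SSet.boundary.ι j ≫ c ≫ sSetTopAdj.unit.app N) u, ?_⟩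
  rw [chi, <- evS_δ, <- SSet.boundary.ι_ι j, <- evS_comp, Category.assoc, Category.assoc, Category.assoc, <- un, hp.w_assoc]

lemma chi_comp {X : TopCat.{0}} (F : |S| ⟶ X) (t : TS 3) : F (chi b t) = evS (b ≫ sSetTopAdj.homEquiv _ _ F) t := by
  rw [chi, <- evS_comp, Category.assoc, Adjunction.homEquiv_unit]

lemma cell_ext (hp : IsPushout c (SSet.boundary 3).ι i b) {X : TopCat.{0}} (F F' : |S| ⟶ X) (h1 : ∀ x, F (SSet.toTop.map i x) = F' (SSet.toTop.map i x))
    (h2 : ∀ t, F (chi b t) = F' (chi b t)) : F = F' := by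
  apply (sSetTopAdj.homEquiv _ _).injective
  apply hp.hom_ext
  · rw [<- Adjunction.homEquiv_naturality_left, <- Adjunction.homEquiv_naturality_left]
    congr 1
    ext x
    exact h1 x
  · apply evS_inj
    ext t : 1
    rw [<- chi_comp, <- chi_comp, h2]

lemma cell_desc (hp : IsPushout c (SSet.boundary 3).ι i b) {X : TopCat.{0}} (x0 : X) (φ : C(TS 3, X)) (h : ∀ t, bd t → φ t = x0) :
    ∃ F : |S| ⟶ X, (∀ x, F (SSet.toTop.map i x) = x0) ∧ ∀ t, F (chi b t) = φ t := by
  let fN : |N| ⟶ X := TopCat.ofHom (ContinuousMap.const _ x0)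
  have hw : c ≫ sSetTopAdj.homEquiv _ _ fN = (SSet.boundary 3).ι ≫ mkS φ := by
    apply SSet.boundary.hom_ext
    intro j
    apply evS_inj
    ext u : 1
    rw [SSet.boundary.ι_ι_assoc, evS_δ, evS_mkS, h _ ⟨j, TS_map_self j u⟩, Adjunction.homEquiv_unit, <- Category.assoc, <- Category.assoc, evS_comp]
    rfl
  refine ⟨(sSetTopAdj.homEquiv _ _).symm (hp.desc _ _ hw), fun x => ?_, fun t => ?_⟩
  · have : SSet.toTop.map i ≫ (sSetTopAdj.homEquiv _ _).symm (hp.desc _ _ hw) = fN := by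
      rw [<- Adjunction.homEquiv_naturality_left_symm, hp.inl_desc, Equiv.symm_apply_apply]
    exact ConcreteCategory.congr_hom this x
  · rw [chi_comp, Equiv.apply_symm_apply, hp.inr_desc, evS_mkS]

lemma cell_equiv (hp : IsPushout c (SSet.boundary 3).ι i b) (a : Δ[0] ⟶ N) (ha : SSet.anodyneExtensions a) : Nonempty (|S| ≃ₕ S3) := by
  obtain ⟨r, -, H, hH0, hH1, -⟩ := anodyne_sdr a ha
  have hsub : Subsingleton |(Δ[0] : SSet.{0})| := by
    have h1 : Subsingleton (TS 0) := ⟨fun u v => by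
      have hu := u.2.2
      have hv := v.2.2
      apply Subtype.ext
      funext k
      obtain rfl : k = 0 := Fin.ext (by omega)
      rw [Fin.sum_univ_one] at hu hv
      exact hu.trans hv.symm⟩
    exact (SimplexCategory.toTopHomeo ⦋0⦌).injective.subsingleton
  let ii : C(|N|, |S|) := (SSet.toTop.map i).hom
  let H' : C(|N|, C(unitInterval, |S|)) := ⟨fun x => ii.comp (H x), by fun_prop⟩
  obtain ⟨K, hK0, hK1⟩ := cell_hep i c b hp |S| (𝟙 _) H' fun x => congrArg ii (hH0 x)
  obtain ⟨t0, ht0⟩ := ex_bd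
  obtain ⟨f, hf1, hf2⟩ := cell_desc hp (X := TopCat.of S3) (kap t0) kap fun t ht => kap_bd t t0 ht ht0
  have hKi : ∀ x u, K (SSet.toTop.map i x) u = SSet.toTop.map i (H x u) := fun x u => by rw [hK1]; rfl
  have hpt : ∀ x x', K (SSet.toTop.map i x) 1 = K (SSet.toTop.map i x') 1 := fun x x' => by
    rw [hKi, hKi, hH1, hH1, Subsingleton.elim (r x) (r x')]
  let f' : C(|S|, S3) := f.hom
  let k1 : C(|S|, |S|) := ⟨fun x => K x 1, by fun_prop⟩
  have hfac : Function.FactorsThrough (k1.comp (chi b)) kap := fun t t' h => by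
    rcases kap_inj t t' h with rfl | ⟨h, h'⟩
    · rfl
    obtain ⟨x, hx⟩ := chi_bd hp t h
    obtain ⟨x', hx'⟩ := chi_bd hp t' h'
    change K (chi b t) 1 = K (chi b t') 1
    rw [<- hx, <- hx', hpt]
  let g : C(S3, |S|) := kap_q.lift (k1.comp (chi b)) hfac
  have hg : ∀ t, g (kap t) = K (chi b t) 1 := fun t => DFunLike.congr_fun (kap_q.lift_comp (k1.comp (chi b)) hfac) t
  have hgf : ∀ x, g (f' x) = K x 1 := fun x => by
    have := cell_ext hp (f ≫ TopCat.ofHom g) (TopCat.ofHom k1) (fun x => ?_) (fun t => ?_)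
    · exact ConcreteCategory.congr_hom this x
    · change g (f (SSet.toTop.map i x)) = K _ 1
      rw [hf1, hg]
      obtain ⟨x', hx'⟩ := chi_bd hp t0 ht0
      rw [<- hx', hpt]
    · change g (f (chi b t)) = K _ 1
      rw [hf2, hg]
  let L0 : C(TS 3, C(unitInterval, S3)) := ⟨fun t => f'.comp (K (chi b t)), by fun_prop⟩
  have hfac' : Function.FactorsThrough L0 kap := fun t t' h => by
    rcases kap_inj t t' h with rfl | ⟨h, h'⟩
    · rfl
    obtain ⟨x, hx⟩ := chi_bd hp t h
    obtain ⟨x', hx'⟩ := chi_bd hp t' h'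
    ext1 u
    change f (K (chi b t) u) = f (K (chi b t') u)
    rw [<- hx, <- hx', hKi, hKi, hf1, hf1]
  let L : C(S3, C(unitInterval, S3)) := kap_q.lift L0 hfac'
  have hL : ∀ t u, L (kap t) u = f' (K (chi b t) u) := fun t u => DFunLike.congr_fun (DFunLike.congr_fun (kap_q.lift_comp L0 hfac') t) u
  refine ⟨⟨f', g, ⟨ContinuousMap.Homotopy.symm ⟨⟨fun p => K p.2 p.1, by fun_prop⟩, fun x => hK0 x, fun x => (hgf x).symm⟩⟩,
    ⟨ContinuousMap.Homotopy.symm ⟨⟨fun p => L p.2 p.1, by fun_prop⟩, fun x => ?_, fun x => ?_⟩⟩⟩⟩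
  · obtain ⟨t, rfl⟩ := kap_surj x
    change L (kap t) 0 = kap t
    rw [hL, hK0, <- hf2]; rfl
  · obtain ⟨t, rfl⟩ := kap_surj x
    change L (kap t) 1 = f' (g (kap t))
    rw [hL, hg]

lemma sdr_equiv {A B : SSet.{0}} (j : A ⟶ B) (hj : SSet.anodyneExtensions j) : Nonempty (|B| ≃ₕ |A|) := by
  obtain ⟨r, hr, H, h0, h1, -⟩ := anodyne_sdr j hj
  refine ⟨⟨r.hom, (SSet.toTop.map j).hom, ⟨ContinuousMap.Homotopy.symm ⟨⟨fun p => H p.2 p.1, by fun_prop⟩, fun x => h0 x, fun x => h1 x⟩⟩, ?_⟩⟩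
  have : r.hom.comp (SSet.toTop.map j).hom = ContinuousMap.id _ := by
    ext x; exact ConcreteCategory.congr_hom hr x
  rw [this]
end cell
end HopfModel

open HopfModel in
/-- The geometric realization of the total space of the principal
twisted cartesian product `GΓℤ(2) ×_η S²` is weakly homotopy equivalent to the 3-sphere
`S³` (the unit sphere in `ℝ⁴`): it is path-connected and simply connected, `π₃ ≅ ℤ`, and
`πₙ` is isomorphic to `πₙ(S³)` for all `n`. -/
theorem hopf_model_total_space_weakly_equiv_S3
    (S2 : SSet.{0}) (y : S2 _⦋2⦌) (hS2 : IsMinimalS2 S2 y)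
    (GK : SimplicialObject GrpCat) (ζ : TwistingFunction GammaZ2SSet GK)
    (ψ : ∀ n : ℕ, PresentedGroup (loopRels GammaZ2SSet n) ≃* (GK _⦋n⦌ : Type))
    (hψ : ∀ (n : ℕ) (x : GammaZ2SSet _⦋n + 1⦌),
      ψ n (PresentedGroup.of x) = ζ.map n x)
    (g : GammaZ2SSet _⦋2⦌)
    (hg : ∃ e : (GammaZ2 _⦋2⦌ : Type) ≃+ ℤ, e g = 1)
    (η : TwistingFunction S2 GK) (hη : η.map 1 y = ζ.map 1 g)
    (P : SSet.{0}) (p : P ⟶ S2) (T : TCP GK (uSSet GK) S2 (leftMulAction GK) η P p) :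
    PathConnectedSpace (SSet.toTop.obj P) ∧
    SimplyConnectedSpace (SSet.toTop.obj P) ∧
    (∀ x : SSet.toTop.obj P,
      Nonempty (HomotopyGroup (Fin 3) (SSet.toTop.obj P) x ≃* Multiplicative ℤ)) ∧
    (∀ (n : ℕ) (x : SSet.toTop.obj P)
        (s : Metric.sphere (0 : EuclideanSpace ℝ (Fin 4)) 1),
      Nonempty (HomotopyGroup (Fin (n + 1)) (SSet.toTop.obj P) x ≃*
        HomotopyGroup (Fin (n + 1)) (Metric.sphere (0 : EuclideanSpace ℝ (Fin 4)) 1) s)) := by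
  have L := isLoop_of ζ ψ hψ
  obtain ⟨e, he⟩ := hg
  obtain ⟨v⟩ := hS2.nonempty₀
  obtain ⟨N, S, a, i, c, b, j, ha, hp, hj⟩ := chain_loop e L g he (mdl T hS2 v (zt ζ g) hη)
  obtain ⟨e1⟩ := sdr_equiv j hj
  obtain ⟨e2⟩ := cell_equiv hp a ha
  exact final_of_hequiv _ (e1.trans e2)
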